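/- There exist η > 0, C > 0 and X₀ > 0 such that the following holds for every integer X ≥ X₀. Let H = ⌊10·X^{1−γ+η}/γ⌋. Then for all reals M, N, V ≥ 1 with M ≤ X^{15/22} and V ≤ H, and all complex coefficients a_m (m ∼ M) and d_h (h a nonzero integer with |h| ∼ V) of modulus at most 1, one has |S₂*| ≤ C·X^{1−2η}, where S₂* = Σ_{m ∼ M} Σ_{n ∼ N, mn ∼ X} Σ_{|h| ∼ V} a_m·d_h·e(h·(mn)^γ), the sums running over positive integers m, n and nonzero integers h in the indicated ranges. -/

import Mathlib

open Finset

noncomputable def e (z : ℝ) : ℂ := Complex.exp (2 * Real.pi * Complex.I * z)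

noncomputable def nint (x : ℝ) : ℝ := |x - round x|

noncomputable def dyN (Y : ℝ) : Finset ℕ :=
  (Finset.range (⌈Y⌉₊ + 1)).filter fun m => Y/2 ≤ (m:ℝ) ∧ (m:ℝ) < Y

noncomputable def dyZ (Y : ℝ) : Finset ℤ :=
  (Finset.Icc (-(⌈Y⌉₊:ℤ)) (⌈Y⌉₊:ℤ)).filter fun l => l ≠ 0 ∧ Y/2 ≤ |(l:ℝ)| ∧ |(l:ℝ)| < Y

lemma e_add (x y : ℝ) : e (x + y) = e x * e y := by
  unfold e; rw [← Complex.exp_add]; push_cast; ring_nf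

lemma e_neg (x : ℝ) : e (-x) = (starRingEnd ℂ) (e x) := by
  unfold e
  rw [← Complex.exp_conj]
  simp [Complex.conj_ofReal, map_ofNat]

lemma norm_e (x : ℝ) : ‖e x‖ = 1 := by
  unfold e
  rw [show (2 * (Real.pi : ℂ) * Complex.I * (x : ℂ)) = ((2 * Real.pi * x : ℝ) : ℂ) * Complex.I by
    push_cast; ring]
  exact Complex.norm_exp_ofReal_mul_I _

lemma e_int (k : ℤ) : e k = 1 := by
  unfold e
  rw [Complex.exp_eq_one_iff]
  exact ⟨k, by push_cast; ring⟩

lemma e_zero : e 0 = 1 := by simpa using e_int 0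

lemma e_sub (x y : ℝ) : e (x - y) = e x * (starRingEnd ℂ) (e y) := by
  rw [sub_eq_add_neg, e_add, e_neg]

lemma norm_sum_e_neg {ι : Type*} (s : Finset ι) (f : ι → ℝ) :
    ‖∑ i ∈ s, e (-f i)‖ = ‖∑ i ∈ s, e (f i)‖ := by
  simp only [e_neg, ← map_sum, RCLike.norm_conj]

/-- The correlation of a finite sequence with its shift by `d`. -/
noncomputable def corr (L : ℕ) (z : ℕ → ℂ) (d : ℕ) : ℂ :=
  ∑ n ∈ range (L - d), z (n + d) * (starRingEnd ℂ) (z n)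

/-- The sequence `z` cut off to `[0, L)` and moved to the right by `q`. -/
noncomputable def shiftCut (L : ℕ) (z : ℕ → ℂ) (k q : ℕ) : ℂ :=
  if q ≤ k ∧ k - q < L then z (k - q) else 0

lemma sum_shiftCut (L : ℕ) (z : ℕ → ℂ) {q Q : ℕ} (hq : q < Q) :
    ∑ k ∈ range (L + Q), shiftCut L z k q = ∑ n ∈ range L, z n := by
  unfold shiftCut
  rw [← sum_filter]
  symm
  refine sum_bij' (fun n _ => n + q) (fun k _ => k - q) ?_ ?_ ?_ ?_ ?_ <;>
    simp only [mem_range, mem_filter] <;> intro a ha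
  · omega
  · omega
  · omega
  · omega
  · simp

lemma sum_shiftCut_mul_conj (L : ℕ) (z : ℕ → ℂ) {q d Q : ℕ} (hq : q + d < Q) :
    ∑ k ∈ range (L + Q), shiftCut L z k q * (starRingEnd ℂ) (shiftCut L z k (q + d))
      = corr L z d := by
  unfold shiftCut corr
  have : ∀ k, (if q ≤ k ∧ k - q < L then z (k - q) else 0) *
      (starRingEnd ℂ) (if q + d ≤ k ∧ k - (q + d) < L then z (k - (q + d)) else 0)
      = if q + d ≤ k ∧ k - q < L then z (k - q) * (starRingEnd ℂ) (z (k - (q + d))) else 0 := by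
    intro k
    split_ifs <;> first | rfl | (exfalso; omega) | simp
  simp only [this]
  rw [← sum_filter]
  symm
  refine sum_bij' (fun n _ => n + (q + d)) (fun k _ => k - (q + d)) ?_ ?_ ?_ ?_ ?_ <;>
    simp only [mem_range, mem_filter] <;> intro a ha
  · omega
  · omega
  · omega
  · omega
  · congr 2
    · omega
    · congr 1; omega

lemma sum_range_dist_le (Q q : ℕ) (hq : q < Q) (g : ℕ → ℝ) (hg : ∀ d, 0 ≤ g d) :
    ∑ q' ∈ range Q, g (max q q' - min q q') ≤ 2 * ∑ d ∈ range Q, g d := by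
  rw [← sum_filter_add_sum_filter_not (range Q) (fun q' => q' ≤ q), two_mul]
  refine add_le_add ?_ ?_
  · rw [← sum_image (s := (range Q).filter (fun q' => q' ≤ q)) (f := g)
      (g := fun q' => max q q' - min q q')]
    · refine sum_le_sum_of_subset_of_nonneg ?_ (fun _ _ _ => hg _)
      intro x; simp only [mem_image, mem_filter, mem_range]; rintro ⟨a, ha, rfl⟩; omega
    · intro a ha b hb; simp only [coe_filter, Set.mem_ofPred_eq, mem_range] at ha hb
      simp only; omega
  · rw [← sum_image (s := (range Q).filter (fun q' => ¬ q' ≤ q)) (f := g)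
      (g := fun q' => max q q' - min q q')]
    · refine sum_le_sum_of_subset_of_nonneg ?_ (fun _ _ _ => hg _)
      intro x; simp only [mem_image, mem_filter, mem_range]; rintro ⟨a, ha, rfl⟩; omega
    · intro a ha b hb; simp only [coe_filter, Set.mem_ofPred_eq, mem_range] at ha hb
      simp only; omega

/-- The van der Corput inequality, averaged over a family of sequences. -/
lemma weyl_vdC {ι : Type*} (s : Finset ι) (w : ι → ℝ) (hw : ∀ i ∈ s, 0 ≤ w i)
    (z : ι → ℕ → ℂ) (L Q : ℕ) (hQ : 0 < Q) :
    (Q : ℝ) * ∑ i ∈ s, w i * ‖∑ n ∈ range L, z i n‖ ^ 2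
      ≤ 2 * (L + Q) * ∑ d ∈ range Q, ‖∑ i ∈ s, (w i : ℂ) * corr L (z i) d‖ := by
  set g : ℕ → ℝ := fun d => ‖∑ i ∈ s, (w i : ℂ) * corr L (z i) d‖ with hgdef
  have hcs : ∀ i, (Q : ℝ) ^ 2 * ‖∑ n ∈ range L, z i n‖ ^ 2
      ≤ (L + Q) * ∑ k ∈ range (L + Q), ‖∑ q ∈ range Q, shiftCut L (z i) k q‖ ^ 2 := by
    intro i
    have h1 : (Q : ℂ) * ∑ n ∈ range L, z i n
        = ∑ k ∈ range (L + Q), ∑ q ∈ range Q, shiftCut L (z i) k q := by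
      rw [sum_comm, sum_congr rfl (fun q hq => sum_shiftCut L (z i) (mem_range.1 hq))]
      simp
    have h2 : (Q : ℝ) * ‖∑ n ∈ range L, z i n‖
        ≤ ∑ k ∈ range (L + Q), ‖∑ q ∈ range Q, shiftCut L (z i) k q‖ := by
      have := norm_sum_le (range (L + Q)) (fun k => ∑ q ∈ range Q, shiftCut L (z i) k q)
      rw [← h1, norm_mul] at this
      simpa using this
    calc (Q : ℝ) ^ 2 * ‖∑ n ∈ range L, z i n‖ ^ 2
        = ((Q : ℝ) * ‖∑ n ∈ range L, z i n‖) ^ 2 := by ring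
      _ ≤ (∑ k ∈ range (L + Q), ‖∑ q ∈ range Q, shiftCut L (z i) k q‖) ^ 2 := by
          gcongr
      _ ≤ _ := by
          have := sq_sum_le_card_mul_sum_sq (s := range (L + Q))
            (f := fun k => ‖∑ q ∈ range Q, shiftCut L (z i) k q‖)
          simpa using this
  have hexp : ((∑ i ∈ s, w i * ∑ k ∈ range (L + Q),
        ‖∑ q ∈ range Q, shiftCut L (z i) k q‖ ^ 2 : ℝ) : ℂ)
      = ∑ q ∈ range Q, ∑ q' ∈ range Q, ∑ i ∈ s, (w i : ℂ) * ∑ k ∈ range (L + Q),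
          shiftCut L (z i) k q * (starRingEnd ℂ) (shiftCut L (z i) k q') := by
    push_cast
    have : ∀ i k, ((‖∑ q ∈ range Q, shiftCut L (z i) k q‖ : ℂ)) ^ 2
        = ∑ q ∈ range Q, ∑ q' ∈ range Q,
          shiftCut L (z i) k q * (starRingEnd ℂ) (shiftCut L (z i) k q') := by
      intro i k
      rw [← Complex.mul_conj', map_sum, sum_mul_sum]
    simp only [this]
    simp only [mul_sum]
    rw [sum_congr rfl (fun i _ => sum_comm), sum_comm' (t' := range Q) (s' := fun _ => s)
      (by intros; tauto)]
    refine sum_congr rfl fun q _ => ?_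
    rw [sum_congr rfl (fun i _ => sum_comm), sum_comm]
  have hinner : ∀ q ∈ range Q, ∀ q' ∈ range Q,
      ‖∑ i ∈ s, (w i : ℂ) * ∑ k ∈ range (L + Q),
          shiftCut L (z i) k q * (starRingEnd ℂ) (shiftCut L (z i) k q')‖
        = g (max q q' - min q q') := by
    intro q hq q' hq'
    rw [mem_range] at hq hq'
    rcases le_total q q' with h | h
    · obtain ⟨d, rfl⟩ := Nat.exists_eq_add_of_le h
      rw [max_eq_right h, min_eq_left h, Nat.add_sub_cancel_left]
      simp only [sum_shiftCut_mul_conj L _ hq', hgdef]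
    · obtain ⟨d, rfl⟩ := Nat.exists_eq_add_of_le h
      rw [max_eq_left h, min_eq_right h, Nat.add_sub_cancel_left, ← RCLike.norm_conj]
      simp only [hgdef, map_sum, map_mul, Complex.conj_conj, Complex.conj_ofReal]
      congr 1
      refine sum_congr rfl fun i _ => ?_
      rw [← sum_shiftCut_mul_conj L (z i) hq]
      simp only [mul_comm]
  have hQ' : (0 : ℝ) < Q := by exact_mod_cast hQ
  have hmain : (Q : ℝ) ^ 2 * ∑ i ∈ s, w i * ‖∑ n ∈ range L, z i n‖ ^ 2
      ≤ (L + Q) * ∑ i ∈ s, w i * ∑ k ∈ range (L + Q),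
        ‖∑ q ∈ range Q, shiftCut L (z i) k q‖ ^ 2 := by
    rw [mul_sum, mul_sum]
    refine sum_le_sum fun i hi => ?_
    have := mul_le_mul_of_nonneg_left (hcs i) (hw i hi)
    linarith
  have hdouble : ∑ i ∈ s, w i * ∑ k ∈ range (L + Q),
        ‖∑ q ∈ range Q, shiftCut L (z i) k q‖ ^ 2 ≤ Q * (2 * ∑ d ∈ range Q, g d) := by
    calc _ ≤ |∑ i ∈ s, w i * ∑ k ∈ range (L + Q),
        ‖∑ q ∈ range Q, shiftCut L (z i) k q‖ ^ 2| := le_abs_self _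
      _ = ‖((∑ i ∈ s, w i * ∑ k ∈ range (L + Q),
        ‖∑ q ∈ range Q, shiftCut L (z i) k q‖ ^ 2 : ℝ) : ℂ)‖ := by
          rw [Complex.norm_real, Real.norm_eq_abs]
      _ ≤ ∑ q ∈ range Q, ∑ q' ∈ range Q, g (max q q' - min q q') := by
          rw [hexp]
          refine (norm_sum_le _ _).trans (sum_le_sum fun q hq => ?_)
          exact (norm_sum_le _ _).trans (sum_le_sum fun q' hq' => (hinner q hq q' hq').le)
      _ ≤ ∑ q ∈ range Q, 2 * ∑ d ∈ range Q, g d :=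
          sum_le_sum fun q hq =>
            sum_range_dist_le Q q (mem_range.1 hq) g fun d => norm_nonneg _
      _ = Q * (2 * ∑ d ∈ range Q, g d) := by simp
  have h3 : (Q : ℝ) ^ 2 * ∑ i ∈ s, w i * ‖∑ n ∈ range L, z i n‖ ^ 2
      ≤ (L + Q) * (Q * (2 * ∑ d ∈ range Q, g d)) := hmain.trans (by gcongr)
  have h4 : (Q : ℝ) * ((Q : ℝ) * ∑ i ∈ s, w i * ‖∑ n ∈ range L, z i n‖ ^ 2)
      ≤ Q * (2 * (L + Q) * ∑ d ∈ range Q, g d) := by linarith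
  exact le_of_mul_le_mul_left h4 hQ'

/-- Abel summation against amplitudes of bounded variation. -/
lemma norm_sum_mul_le_of_variation (c z : ℕ → ℂ) (L : ℕ) {A B Z : ℝ} (hA0 : 0 ≤ A)
    (hA : ∀ n < L, ‖c n‖ ≤ A)
    (hB : ∑ n ∈ range (L - 1), ‖c (n + 1) - c n‖ ≤ B)
    (hZ : ∀ l ≤ L, ‖∑ n ∈ range l, z n‖ ≤ Z) :
    ‖∑ n ∈ range L, c n * z n‖ ≤ (A + B) * Z := by
  have hZ0 : 0 ≤ Z := (norm_nonneg _).trans (hZ 0 (Nat.zero_le _))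
  have hB0 : 0 ≤ B := (sum_nonneg fun _ _ => norm_nonneg _).trans hB
  rcases Nat.eq_zero_or_pos L with rfl | hL
  · simpa using mul_nonneg (add_nonneg hA0 hB0) hZ0
  have hparts := sum_range_by_parts c z L
  simp only [smul_eq_mul] at hparts
  rw [hparts]
  calc _ ≤ ‖c (L - 1) * ∑ n ∈ range L, z n‖
        + ‖∑ i ∈ range (L - 1), (c (i + 1) - c i) * ∑ n ∈ range (i + 1), z n‖ := norm_sub_le _ _
    _ ≤ A * Z + ∑ i ∈ range (L - 1), ‖c (i + 1) - c i‖ * Z := by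
        refine add_le_add ?_ ((norm_sum_le _ _).trans (sum_le_sum fun i hi => ?_))
        · rw [norm_mul]
          exact mul_le_mul (hA _ (by omega)) (hZ L le_rfl) (norm_nonneg _) hA0
        · rw [norm_mul]
          exact mul_le_mul_of_nonneg_left (hZ _ (by rw [mem_range] at hi; omega)) (norm_nonneg _)
    _ ≤ A * Z + B * Z := by
        rw [← sum_mul]; gcongr
    _ = _ := by ring

lemma e_eq_cos_sin (x : ℝ) :
    e x = ((Real.cos (Real.pi * x) : ℂ) + Real.sin (Real.pi * x) * Complex.I) ^ 2 := by
  unfold e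
  rw [show (2 * (Real.pi : ℂ) * Complex.I * (x : ℂ))
    = ((2 : ℕ) : ℂ) * (((Real.pi * x : ℝ) : ℂ) * Complex.I) by push_cast; ring, Complex.exp_nat_mul,
    Complex.exp_mul_I, Complex.ofReal_cos, Complex.ofReal_sin]

lemma inv_e_sub_one (x : ℝ) (hx : Real.sin (Real.pi * x) ≠ 0) :
    (e x - 1)⁻¹ = -1 / 2
      - Complex.I / 2 * ((Real.cos (Real.pi * x) / Real.sin (Real.pi * x) : ℝ) : ℂ) := by
  rw [e_eq_cos_sin]
  have h1 : (Real.cos (Real.pi * x) : ℂ) ^ 2 + (Real.sin (Real.pi * x) : ℂ) ^ 2 = 1 := by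
    exact_mod_cast Real.cos_sq_add_sin_sq (Real.pi * x)
  have hs : (Real.sin (Real.pi * x) : ℂ) ≠ 0 := by exact_mod_cast hx
  rw [Complex.ofReal_div]
  set c : ℂ := (Real.cos (Real.pi * x) : ℂ)
  set s : ℂ := (Real.sin (Real.pi * x) : ℂ)
  have hI : Complex.I ^ 2 = -1 := Complex.I_sq
  apply inv_eq_of_mul_eq_one_right
  field_simp
  linear_combination (s - Complex.I * c) * h1
    + (-c * s ^ 2 * Complex.I - 2 * c ^ 2 * s - s ^ 3) * hI

lemma two_mul_le_sin {δ t : ℝ} (hδ : 0 ≤ δ) (h1 : δ ≤ t) (h2 : t ≤ 1 - δ) :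
    2 * δ ≤ Real.sin (Real.pi * t) := by
  rcases le_total t (1 / 2) with h | h
  · have := Real.mul_le_sin (x := Real.pi * t) (by have := Real.pi_pos; nlinarith)
      (by have := Real.pi_pos; nlinarith)
    have h3 : 2 / Real.pi * (Real.pi * t) = 2 * t := by have := Real.pi_pos; field_simp
    linarith
  · have := Real.mul_le_sin (x := Real.pi * (1 - t)) (by have := Real.pi_pos; nlinarith)
      (by have := Real.pi_pos; nlinarith)
    have h3 : 2 / Real.pi * (Real.pi * (1 - t)) = 2 * (1 - t) := by
      have := Real.pi_pos; field_simp
    rw [show Real.pi * (1 - t) = Real.pi - Real.pi * t by ring, Real.sin_pi_sub] at this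
    linarith

lemma sin_pi_mul_pos {t : ℝ} (h0 : 0 < t) (h1 : t < 1) : 0 < Real.sin (Real.pi * t) := by
  have := Real.pi_pos
  exact Real.sin_pos_of_pos_of_lt_pi (by positivity) (by nlinarith)

lemma cot_pi_mul_anti {x y : ℝ} (h0 : 0 < x) (hxy : x ≤ y) (h1 : y < 1) :
    Real.cos (Real.pi * y) / Real.sin (Real.pi * y)
      ≤ Real.cos (Real.pi * x) / Real.sin (Real.pi * x) := by
  have hx := sin_pi_mul_pos h0 (by linarith)
  have hy := sin_pi_mul_pos (by linarith) h1
  have hd : 0 ≤ Real.sin (Real.pi * y - Real.pi * x) := by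
    have := Real.pi_pos
    exact Real.sin_nonneg_of_nonneg_of_le_pi (by nlinarith) (by nlinarith)
  rw [Real.sin_sub] at hd
  rw [div_le_div_iff₀ hy hx]
  linarith

lemma abs_cot_pi_mul_le {δ t : ℝ} (hδ : 0 < δ) (h1 : δ ≤ t) (h2 : t ≤ 1 - δ) :
    |Real.cos (Real.pi * t) / Real.sin (Real.pi * t)| ≤ 1 / (2 * δ) := by
  have hs := two_mul_le_sin hδ.le h1 h2
  rw [abs_div, abs_of_pos (by linarith : 0 < Real.sin (Real.pi * t))]
  exact div_le_div₀ zero_le_one (Real.abs_cos_le_one _) (by linarith) hs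

/-- The Kusmin Landau inequality, with differences reduced to the fundamental interval. -/
lemma kusmin_landau_aux (f : ℕ → ℝ) (L : ℕ) {δ : ℝ} (hδ : 0 < δ)
    (hmono : ∀ n, n + 1 < L → f (n + 1) - f n ≤ f (n + 2) - f (n + 1))
    (hlo : ∀ n < L, δ ≤ f (n + 1) - f n) (hhi : ∀ n < L, f (n + 1) - f n ≤ 1 - δ) :
    ‖∑ n ∈ range L, e (f n)‖ ≤ 2 / δ := by
  rcases Nat.eq_zero_or_pos L with rfl | hL
  · simp; positivity
  set d : ℕ → ℝ := fun n => f (n + 1) - f n with hd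
  set cot : ℝ → ℝ := fun t => Real.cos (Real.pi * t) / Real.sin (Real.pi * t) with hcot
  have hd0 : ∀ n < L, 0 < d n := fun n hn => hδ.trans_le (hlo n hn)
  have hd1 : ∀ n < L, d n < 1 := fun n hn => (hhi n hn).trans_lt (by linarith)
  have hδ2 : δ ≤ 1 / 2 := by linarith [hlo 0 hL, hhi 0 hL]
  have hinv : ∀ n < L, (e (d n) - 1)⁻¹ = -1 / 2 - Complex.I / 2 * (cot (d n) : ℂ) :=
    fun n hn => inv_e_sub_one _ (sin_pi_mul_pos (hd0 n hn) (hd1 n hn)).ne'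
  have hne : ∀ n < L, e (d n) - 1 ≠ 0 := by
    intro n hn h0
    have := hinv n hn
    rw [h0, inv_zero] at this
    have h2 := congrArg Complex.re this
    norm_num [Complex.mul_re] at h2
  have hz : ∑ n ∈ range L, e (f n)
      = ∑ n ∈ range L, (e (d n) - 1)⁻¹ * (e (f (n + 1)) - e (f n)) := by
    refine sum_congr rfl fun n hn => ?_
    have h1 : e (f (n + 1)) = e (f n) * e (d n) := by
      rw [← e_add]; congr 1; simp [hd]
    rw [h1, eq_inv_mul_iff_mul_eq₀ (hne n (mem_range.1 hn))]
    ring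
  rw [hz]
  have hI : ‖Complex.I / 2‖ = 1 / 2 := by simp
  have hA : ∀ n < L, ‖(e (d n) - 1)⁻¹‖ ≤ 1 / (2 * δ) := by
    intro n hn
    rw [hinv n hn]
    refine (norm_sub_le _ _).trans ?_
    rw [norm_mul, hI, Complex.norm_real, Real.norm_eq_abs]
    have h1 := abs_cot_pi_mul_le hδ (hlo n hn) (hhi n hn)
    have h2 : (1 : ℝ) / 2 ≤ 1 / (4 * δ) := by
      rw [div_le_div_iff₀ (by norm_num) (by linarith)]; linarith
    have h3 : (1 : ℝ) / (2 * δ) = 1 / (4 * δ) + 1 / 2 * (1 / (2 * δ)) := by field_simp; norm_num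
    have h4 : ‖(-1 / 2 : ℂ)‖ = 1 / 2 := by norm_num
    rw [h4, h3]
    gcongr
  have hB : ∑ n ∈ range (L - 1), ‖(e (d (n + 1)) - 1)⁻¹ - (e (d n) - 1)⁻¹‖ ≤ 1 / (2 * δ) := by
    have h1 : ∀ n ∈ range (L - 1), ‖(e (d (n + 1)) - 1)⁻¹ - (e (d n) - 1)⁻¹‖
        = 1 / 2 * cot (d n) - 1 / 2 * cot (d (n + 1)) := by
      intro n hn
      have hn' : n + 1 < L := by rw [mem_range] at hn; omega
      rw [hinv _ hn', hinv n (by omega)]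
      rw [show (-1 / 2 - Complex.I / 2 * (cot (d (n + 1)) : ℂ))
        - (-1 / 2 - Complex.I / 2 * (cot (d n) : ℂ))
        = Complex.I / 2 * ((cot (d n) - cot (d (n + 1)) : ℝ) : ℂ) by push_cast; ring]
      rw [norm_mul, hI, Complex.norm_real, Real.norm_eq_abs, abs_of_nonneg, mul_sub]
      exact sub_nonneg.2 (cot_pi_mul_anti (hd0 n (by omega)) (hmono n hn') (hd1 _ hn'))
    rw [sum_congr rfl h1, sum_range_sub' (fun n => 1 / 2 * cot (d n))]
    have h2 := (abs_le.1 (abs_cot_pi_mul_le hδ (hlo 0 hL) (hhi 0 hL))).2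
    have h3 := (abs_le.1 (abs_cot_pi_mul_le hδ (hlo (L - 1) (by omega)) (hhi (L - 1) (by omega)))).1
    change cot (d 0) ≤ _ at h2
    change _ ≤ cot (d (L - 1)) at h3
    linarith
  have hZ : ∀ l ≤ L, ‖∑ n ∈ range l, (e (f (n + 1)) - e (f n))‖ ≤ 2 := by
    intro l _
    rw [sum_range_sub (fun n => e (f n))]
    refine (norm_sub_le _ _).trans ?_
    rw [norm_e, norm_e]; norm_num
  refine (norm_sum_mul_le_of_variation _ _ L (by positivity) hA hB hZ).trans (le_of_eq ?_)
  field_simp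
  norm_num

/-- The Kusmin Landau inequality. -/
lemma kusmin_landau (f : ℕ → ℝ) (L : ℕ) (k : ℤ) {δ : ℝ} (hδ : 0 < δ)
    (hmono : ∀ n, n + 1 < L → f (n + 1) - f n ≤ f (n + 2) - f (n + 1))
    (hlo : ∀ n < L, k + δ ≤ f (n + 1) - f n) (hhi : ∀ n < L, f (n + 1) - f n ≤ k + 1 - δ) :
    ‖∑ n ∈ range L, e (f n)‖ ≤ 2 / δ := by
  have h := kusmin_landau_aux (fun n => f n - k * n) L hδ
    (fun n hn => by have := hmono n hn; push_cast; linarith)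
    (fun n hn => by have := hlo n hn; push_cast; linarith)
    (fun n hn => by have := hhi n hn; push_cast; linarith)
  convert h using 3 with n
  rw [e_sub, show (k : ℝ) * n = ((k * n : ℤ) : ℝ) by push_cast; ring, e_int]
  simp

lemma exists_eq_Ico_of_between (S : Finset ℕ)
    (h : ∀ a ∈ S, ∀ b ∈ S, ∀ n, a ≤ n → n ≤ b → n ∈ S) : ∃ l r, l ≤ r ∧ S = Ico l r := by
  rcases S.eq_empty_or_nonempty with rfl | hS
  · exact ⟨0, 0, le_rfl, by simp⟩
  · refine ⟨S.min' hS, S.max' hS + 1, (S.min'_le_max' hS).trans (Nat.le_succ _), ?_⟩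
    ext n
    rw [mem_Ico]
    refine ⟨fun hn => ⟨S.min'_le n hn, Nat.lt_succ_of_le (S.le_max' n hn)⟩, fun hn => ?_⟩
    exact h _ (S.min'_mem hS) _ (S.max'_mem hS) n hn.1 (Nat.le_of_lt_succ hn.2)

lemma norm_sum_e_le (s : Finset ℕ) (f : ℕ → ℝ) : ‖∑ n ∈ s, e (f n)‖ ≤ #s := by
  refine (norm_sum_le _ _).trans ?_
  simp [norm_e]

lemma increment_lower (d : ℕ → ℝ) (L : ℕ) {a : ℝ} (h : ∀ n < L, a ≤ d (n + 1) - d n)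
    (i t : ℕ) (hit : i + t ≤ L) : a * t ≤ d (i + t) - d i := by
  induction t with
  | zero => simp
  | succ t ih =>
    have h1 := ih (by omega)
    have h2 := h (i + t) (by omega)
    rw [← add_assoc]
    push_cast
    linarith

lemma card_le_of_increment (d : ℕ → ℝ) (L : ℕ) {ν a b : ℝ} (hν : 0 < ν)
    (h : ∀ n < L, ν ≤ d (n + 1) - d n) (S : Finset ℕ) (hab : a ≤ b)
    (hS : ∀ n ∈ S, n < L ∧ a ≤ d n ∧ d n ≤ b) : (#S : ℝ) ≤ (b - a) / ν + 1 := by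
  rcases S.eq_empty_or_nonempty with rfl | hne
  · simp; have := div_nonneg (sub_nonneg.2 hab) hν.le; linarith
  have h1 := hS _ (S.min'_mem hne)
  have h2 := hS _ (S.max'_mem hne)
  obtain ⟨t, ht⟩ := Nat.exists_eq_add_of_le (S.min'_le_max' hne)
  have hsub : S ⊆ Icc (S.min' hne) (S.max' hne) := fun n hn =>
    mem_Icc.2 ⟨S.min'_le n hn, S.le_max' n hn⟩
  have hcard := card_le_card hsub
  rw [Nat.card_Icc] at hcard
  have hc : #S ≤ t + 1 := by omega
  have h3 := increment_lower d L h (S.min' hne) t (by omega)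
  rw [← ht] at h3
  have h4 : (t : ℝ) ≤ (b - a) / ν := by
    rw [le_div_iff₀ hν]; linarith [h1.2.1, h2.2.2]
  have h5 : (#S : ℝ) ≤ t + 1 := by exact_mod_cast hc
  linarith

/-- The second derivative test for exponential sums, in terms of second differences. -/
lemma second_difference_test (f : ℕ → ℝ) (L : ℕ) {ν C : ℝ} (hν : 0 < ν) (hC : 1 ≤ C)
    (hlo : ∀ n < L, ν ^ 2 ≤ (f (n + 2) - f (n + 1)) - (f (n + 1) - f n))
    (hhi : ∀ n < L, (f (n + 2) - f (n + 1)) - (f (n + 1) - f n) ≤ C * ν ^ 2) :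
    ‖∑ n ∈ range L, e (f n)‖ ≤ 16 * C * (L * ν + 1 / ν) := by
  rcases Nat.eq_zero_or_pos L with rfl | hL
  · simp; positivity
  have hL0 : (0 : ℝ) < L := by exact_mod_cast hL
  rcases le_or_gt (1 / 2) ν with hν2 | hν2
  · have h1 := norm_sum_e_le (range L) f
    rw [card_range] at h1
    have h2 : (0 : ℝ) < 1 / ν := by positivity
    have h3 : (L : ℝ) * 1 ≤ L * (2 * ν) := by gcongr; linarith
    have h4 : (L : ℝ) * ν + 1 / ν ≤ C * (L * ν + 1 / ν) := by
      have : 0 < (L : ℝ) * ν + 1 / ν := by positivity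
      nlinarith
    have h5 : 0 ≤ C * (L * ν + 1 / ν) := by positivity
    nlinarith
  set d : ℕ → ℝ := fun n => f (n + 1) - f n with hd
  have hlo' : ∀ n < L, ν ^ 2 ≤ d (n + 1) - d n := hlo
  have hmono : ∀ i j, i ≤ j → j ≤ L → d i ≤ d j := by
    intro i j hij hj
    obtain ⟨t, rfl⟩ := Nat.exists_eq_add_of_le hij
    have := increment_lower d L hlo' i t hj
    have : 0 ≤ ν ^ 2 * (t : ℝ) := by positivity
    linarith
  have hblock : ∀ k : ℤ, ‖∑ n ∈ range L with ⌊d n⌋ = k, e (f n)‖ ≤ 5 / ν := by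
    intro k
    set A := {n ∈ range L | ⌊d n⌋ = k ∧ d n < k + ν} with hA
    set B := {n ∈ range L | ⌊d n⌋ = k ∧ k + 1 - ν < d n} with hB
    set G := {n ∈ range L | k + ν ≤ d n ∧ d n ≤ k + 1 - ν} with hG
    have hfl : ∀ n, ⌊d n⌋ = k → (k : ℝ) ≤ d n ∧ d n < k + 1 := fun n hn => Int.floor_eq_iff.1 hn
    have hsplit : ∑ n ∈ range L with ⌊d n⌋ = k, e (f n)
        = ∑ n ∈ A, e (f n) + ∑ n ∈ B, e (f n) + ∑ n ∈ G, e (f n) := by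
      rw [← sum_union, ← sum_union]
      · congr 1
        ext n
        simp only [hA, hB, hG, mem_union, mem_filter, mem_range]
        constructor
        · rintro ⟨hn, hk⟩
          rcases lt_or_ge (d n) (k + ν) with h | h
          · exact Or.inl (Or.inl ⟨hn, hk, h⟩)
          rcases lt_or_ge (k + 1 - ν) (d n) with h' | h'
          · exact Or.inl (Or.inr ⟨hn, hk, h'⟩)
          exact Or.inr ⟨hn, h, h'⟩
        · rintro ((h | h) | h)
          · exact ⟨h.1, h.2.1⟩
          · exact ⟨h.1, h.2.1⟩
          · exact ⟨h.1, Int.floor_eq_iff.2 ⟨by linarith, by linarith⟩⟩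
      · rw [disjoint_left]
        intro n hn hn'
        simp only [hA, hB, hG, mem_union, mem_filter] at hn hn'
        rcases hn with h | h <;> linarith [h.2.2, hn'.2.1, hn'.2.2]
      · rw [disjoint_left]
        intro n hn hn'
        simp only [hA, hB, mem_filter] at hn hn'
        linarith [hn.2.2, hn'.2.2]
    have hν1 : (k + ν - k) / ν ^ 2 = 1 / ν := by field_simp; ring
    have hν3 : ((k : ℝ) + 1 - (k + 1 - ν)) / ν ^ 2 = 1 / ν := by field_simp; ring
    have hAc : (#A : ℝ) ≤ 1 / ν + 1 := by
      rw [← hν1]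
      refine card_le_of_increment d L (by positivity) hlo' A (by linarith) fun n hn => ?_
      simp only [hA, mem_filter, mem_range] at hn
      exact ⟨hn.1, (hfl n hn.2.1).1, hn.2.2.le⟩
    have hBc : (#B : ℝ) ≤ 1 / ν + 1 := by
      rw [← hν3]
      refine card_le_of_increment d L (by positivity) hlo' B (by linarith) fun n hn => ?_
      simp only [hB, mem_filter, mem_range] at hn
      exact ⟨hn.1, hn.2.2.le, (hfl n hn.2.1).2.le⟩
    have hGb : ‖∑ n ∈ G, e (f n)‖ ≤ 2 / ν := by
      obtain ⟨l, r, hlr, hGe⟩ := exists_eq_Ico_of_between G (by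
        intro a ha b hb n han hnb
        simp only [hG, mem_filter, mem_range] at ha hb ⊢
        have := hmono a n han (by omega)
        have := hmono n b hnb (by omega)
        exact ⟨by omega, by linarith [ha.2.1], by linarith [hb.2.2]⟩)
      have hmem : ∀ n < r - l, l + n < L ∧ k + ν ≤ d (l + n) ∧ d (l + n) ≤ k + 1 - ν := by
        intro n hn
        have : l + n ∈ G := by rw [hGe, mem_Ico]; omega
        simpa only [hG, mem_filter, mem_range] using this
      rw [hGe, sum_Ico_eq_sum_range]
      refine kusmin_landau (fun n => f (l + n)) (r - l) k hν ?_ ?_ ?_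
      · intro n hn
        exact hmono (l + n) (l + n + 1) (by omega) (by have := (hmem n (by omega)).1; omega)
      · intro n hn; exact (hmem n hn).2.1
      · intro n hn; exact (hmem n hn).2.2
    rw [hsplit]
    refine (norm_add_le _ _).trans ?_
    have h6 := (norm_add_le (∑ n ∈ A, e (f n)) (∑ n ∈ B, e (f n)))
    have h7 := norm_sum_e_le A f
    have h8 := norm_sum_e_le B f
    have h9 : (2 : ℝ) ≤ 1 / ν := by rw [le_div_iff₀ hν]; linarith
    have h10 : 5 / ν = 5 * (1 / ν) := by ring
    have h11 : 2 / ν = 2 * (1 / ν) := by ring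
    linarith
  have hmaps : ∀ n ∈ range L, ⌊d n⌋ ∈ Icc ⌊d 0⌋ ⌊d L⌋ := by
    intro n hn
    rw [mem_range] at hn
    rw [mem_Icc]
    exact ⟨Int.floor_mono (hmono 0 n (by omega) hn.le), Int.floor_mono (hmono n L hn.le le_rfl)⟩
  rw [← sum_fiberwise_of_maps_to hmaps]
  have hdL : d L - d 0 ≤ C * ν ^ 2 * L := by
    have := increment_lower (fun n => - d n) L (a := -(C * ν ^ 2))
      (fun n hn => by have := hhi n hn; simp only [hd]; linarith) 0 L (by omega)
    simp only [zero_add] at this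
    linarith
  have hcard : (#(Icc ⌊d 0⌋ ⌊d L⌋) : ℝ) ≤ C * ν ^ 2 * L + 2 := by
    rw [Int.card_Icc]
    have h1 : ⌊d 0⌋ ≤ ⌊d L⌋ := Int.floor_mono (hmono 0 L (by omega) le_rfl)
    have h2 : (((⌊d L⌋ + 1 - ⌊d 0⌋).toNat : ℤ) : ℝ) = ((⌊d L⌋ + 1 - ⌊d 0⌋ : ℤ) : ℝ) := by
      rw [Int.toNat_of_nonneg (by omega)]
    rw [Int.cast_natCast] at h2
    rw [h2]
    push_cast
    linarith [Int.floor_le (d L), Int.lt_floor_add_one (d 0)]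
  calc _ ≤ ∑ k ∈ Icc ⌊d 0⌋ ⌊d L⌋, 5 / ν := (norm_sum_le _ _).trans (sum_le_sum fun k _ => hblock k)
    _ = #(Icc ⌊d 0⌋ ⌊d L⌋) * (5 / ν) := by rw [sum_const, nsmul_eq_mul]
    _ ≤ (C * ν ^ 2 * L + 2) * (5 / ν) := by gcongr
    _ = 5 * C * (L * ν) + 10 * (1 / ν) := by field_simp; ring
    _ ≤ 16 * C * (L * ν + 1 / ν) := by
        have h1 : 0 < (L : ℝ) * ν := by positivity
        have h2 : 0 < 1 / ν := by positivity
        nlinarith [mul_pos (by linarith : 0 < C) h1, mul_le_mul_of_nonneg_right hC h2.le]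

lemma sum_inv_sqrt_le (R : ℕ) : ∑ d ∈ range (R + 1), 1 / √(d : ℝ) ≤ 2 * √(R : ℝ) := by
  induction R with
  | zero => simp
  | succ R ih =>
    rw [sum_range_succ]
    have h0 : (0 : ℝ) ≤ R := Nat.cast_nonneg R
    have h1 : 0 < √((R + 1 : ℕ) : ℝ) := Real.sqrt_pos.2 (by positivity)
    have h2 : √(R : ℝ) ≤ √((R + 1 : ℕ) : ℝ) := Real.sqrt_le_sqrt (by push_cast; linarith)
    have h3 : √((R + 1 : ℕ) : ℝ) ^ 2 = R + 1 := by rw [Real.sq_sqrt (by positivity)]; push_cast; rfl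
    have h4 : √(R : ℝ) ^ 2 = R := Real.sq_sqrt h0
    have h5 : 1 / √((R + 1 : ℕ) : ℝ) ≤ 2 * √((R + 1 : ℕ) : ℝ) - 2 * √(R : ℝ) := by
      rw [div_le_iff₀ h1]
      nlinarith [sq_nonneg (√((R + 1 : ℕ) : ℝ) - √(R : ℝ))]
    linarith

lemma corr_e (L : ℕ) (f : ℕ → ℝ) (d : ℕ) :
    corr L (fun n => e (f n)) d = ∑ n ∈ range (L - d), e (f (n + d) - f n) := by
  unfold corr
  simp only [e_sub]

/-- The third derivative test for exponential sums, in terms of third differences. -/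
lemma third_difference_test (f : ℕ → ℝ) (L : ℕ) {μ C : ℝ} (hμ : 0 < μ) (hC : 1 ≤ C)
    (hlo : ∀ n < L, μ ^ 6 ≤ f (n + 3) - 3 * f (n + 2) + 3 * f (n + 1) - f n)
    (hhi : ∀ n < L, f (n + 3) - 3 * f (n + 2) + 3 * f (n + 1) - f n ≤ C * μ ^ 6) :
    ‖∑ n ∈ range L, e (f n)‖ ≤ 480 * C * (L * μ + √L / μ) := by
  have hL : (0 : ℝ) ≤ L := Nat.cast_nonneg L
  have htriv := norm_sum_e_le (range L) f
  rw [card_range] at htriv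
  have hE : 0 ≤ (L : ℝ) * μ + √L / μ := by positivity
  have hCE : (L : ℝ) * μ + √L / μ ≤ 480 * C * (L * μ + √L / μ) := by nlinarith
  have hsq : √(L : ℝ) * √(L : ℝ) = L := Real.mul_self_sqrt hL
  rcases le_or_gt 1 μ with hμ1 | hμ1
  · refine htriv.trans (le_trans ?_ hCE)
    have : 0 ≤ √(L : ℝ) / μ := by positivity
    nlinarith
  rcases lt_or_ge (L : ℝ) (μ⁻¹ ^ 2) with hLμ | hLμ
  · refine htriv.trans (le_trans ?_ hCE)
    have h1 : √(L : ℝ) ≤ μ⁻¹ := by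
      rw [← Real.sqrt_sq (inv_pos.2 hμ).le]; exact Real.sqrt_le_sqrt hLμ.le
    have h2 : √(L : ℝ) * √(L : ℝ) ≤ √(L : ℝ) * μ⁻¹ := by gcongr
    rw [div_eq_mul_inv]
    have : 0 ≤ (L : ℝ) * μ := by positivity
    linarith
  have hinv1 : 1 ≤ μ⁻¹ := (one_le_inv₀ hμ).2 hμ1.le
  set R := ⌈μ⁻¹ ^ 2⌉₊ with hRdef
  have hR1 : μ⁻¹ ^ 2 ≤ R := Nat.le_ceil _
  have hR2 : (R : ℝ) ≤ μ⁻¹ ^ 2 + 1 := (Nat.ceil_lt_add_one (by positivity)).le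
  have hinv2 : 1 ≤ μ⁻¹ ^ 2 := one_le_pow₀ hinv1
  have hR0 : 0 < R := Nat.ceil_pos.2 (by positivity)
  have hRL : (R : ℝ) ≤ 2 * L := by linarith
  have hRs : √(R : ℝ) ≤ 2 * μ⁻¹ := by
    rw [← Real.sqrt_sq (by positivity : 0 ≤ 2 * μ⁻¹)]
    exact Real.sqrt_le_sqrt (by nlinarith)
  set K := 16 * C with hK
  have hKpos : 0 < K := by positivity
  have hcorr : ∀ d, 1 ≤ d → ‖corr L (fun n => e (f n)) d‖
      ≤ K * (L * (√R * μ ^ 3) + 1 / √d * (1 / μ ^ 3)) ∨ R ≤ d := by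
    intro d hd
    rcases Nat.lt_or_ge d R with hdR | hdR
    swap
    · exact Or.inr hdR
    left
    rw [corr_e]
    have hd0 : (0 : ℝ) < d := by exact_mod_cast hd
    have hsd : √(d : ℝ) ^ 2 = d := Real.sq_sqrt hd0.le
    have hsum : ∀ n, (f (n + 2 + d) - f (n + 2) - (f (n + 1 + d) - f (n + 1)))
        - (f (n + 1 + d) - f (n + 1) - (f (n + d) - f n))
        = (fun j => f (j + 2) - 2 * f (j + 1) + f j) (n + d)
          - (fun j => f (j + 2) - 2 * f (j + 1) + f j) n := by
      intro n
      simp only [show n + 2 + d = n + d + 2 by ring, show n + 1 + d = n + d + 1 by ring]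
      ring
    have h1 := second_difference_test (fun n => f (n + d) - f n) (L - d)
      (ν := √d * μ ^ 3) (C := C) (by positivity) hC
      (by
        intro n hn
        rw [hsum]
        have := increment_lower (fun j => f (j + 2) - 2 * f (j + 1) + f j) L (a := μ ^ 6)
          (fun j hj => by have := hlo j hj; simp only [add_assoc]; norm_num; linarith)
          n d (by omega)
        rw [mul_pow, hsd]
        linarith)
      (by
        intro n hn
        rw [hsum]
        have := increment_lower (fun j => - (f (j + 2) - 2 * f (j + 1) + f j)) L (a := -(C * μ ^ 6))
          (fun j hj => by have := hhi j hj; simp only [add_assoc]; norm_num; linarith)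
          n d (by omega)
        rw [mul_pow, hsd]
        linarith)
    refine h1.trans ?_
    have h2 : ((L - d : ℕ) : ℝ) ≤ L := by exact_mod_cast Nat.sub_le L d
    have h3 : √(d : ℝ) ≤ √(R : ℝ) := Real.sqrt_le_sqrt (by exact_mod_cast hdR.le)
    rw [show 1 / (√(d : ℝ) * μ ^ 3) = 1 / √d * (1 / μ ^ 3) by rw [div_mul_div_comm, one_mul]]
    gcongr
  have hcorr0 : ‖corr L (fun n => e (f n)) 0‖ ≤ L := by
    rw [corr_e]
    simpa using norm_sum_e_le (range L) (fun n => f n - f n)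
  have hsumcorr : ∑ d ∈ range R, ‖corr L (fun n => e (f n)) d‖
      ≤ L + K * (4 * L + 4 * μ⁻¹ ^ 4) := by
    obtain ⟨r, hr⟩ := Nat.exists_eq_succ_of_ne_zero hR0.ne'
    have hrR : (r : ℝ) ≤ R := by rw [hr]; push_cast; linarith
    have hstep : ∑ d ∈ range r, ‖corr L (fun n => e (f n)) (d + 1)‖
        ≤ K * (R * (L * (√R * μ ^ 3)) + 2 * √R * (1 / μ ^ 3)) := by
      calc _ ≤ ∑ d ∈ range r,
            K * (L * (√R * μ ^ 3) + 1 / √((d + 1 : ℕ) : ℝ) * (1 / μ ^ 3)) := by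
            refine sum_le_sum fun d hd => ?_
            rw [mem_range] at hd
            rcases hcorr (d + 1) (by omega) with h | h
            · exact h
            · omega
        _ = K * (r * (L * (√R * μ ^ 3))
              + (∑ d ∈ range r, 1 / √((d + 1 : ℕ) : ℝ)) * (1 / μ ^ 3)) := by
            rw [← mul_sum, sum_add_distrib, sum_const, card_range, nsmul_eq_mul, ← sum_mul]
        _ ≤ _ := by
            have h1 := sum_inv_sqrt_le r
            rw [sum_range_succ'] at h1
            have h2 : ∑ d ∈ range r, 1 / √((d + 1 : ℕ) : ℝ) ≤ 2 * √(R : ℝ) := by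
              have h3 : √(r : ℝ) ≤ √(R : ℝ) := Real.sqrt_le_sqrt hrR
              simp at h1 ⊢
              linarith
            gcongr
    have hsr : (R : ℝ) * (√R * μ ^ 3) ≤ 4 := by
      have h1 : (R : ℝ) ≤ 2 * μ⁻¹ ^ 2 := by linarith
      calc (R : ℝ) * (√R * μ ^ 3) ≤ (2 * μ⁻¹ ^ 2) * ((2 * μ⁻¹) * μ ^ 3) := by gcongr
        _ = 4 := by field_simp; norm_num
    have hsr2 : 2 * √(R : ℝ) * (1 / μ ^ 3) ≤ 4 * μ⁻¹ ^ 4 := by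
      calc 2 * √(R : ℝ) * (1 / μ ^ 3) ≤ 2 * (2 * μ⁻¹) * (1 / μ ^ 3) := by gcongr
        _ = 4 * μ⁻¹ ^ 4 := by field_simp; norm_num
    rw [hr, sum_range_succ', add_comm]
    refine add_le_add hcorr0 (hstep.trans ?_)
    have h5 : (R : ℝ) * (L * (√R * μ ^ 3)) ≤ 4 * L := by
      have : (L : ℝ) * (R * (√R * μ ^ 3)) ≤ L * 4 := by gcongr
      linarith
    gcongr
  have hW := weyl_vdC {()} (fun _ => 1) (by simp) (fun _ n => e (f n)) L R hR0
  simp only [sum_singleton, one_mul, Complex.ofReal_one] at hW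
  set S := ‖∑ n ∈ range L, e (f n)‖ with hS
  have hK1 : 16 ≤ K := by linarith
  have h7 : (R : ℝ) * S ^ 2 ≤ R * (30 * K * (L * μ + √L / μ) ^ 2) := by
    calc (R : ℝ) * S ^ 2 ≤ 2 * (L + R) * (L + K * (4 * L + 4 * μ⁻¹ ^ 4)) := by
          refine hW.trans ?_; gcongr
      _ ≤ 6 * L * (5 * K * (L + μ⁻¹ ^ 4)) := by
          have : 0 ≤ μ⁻¹ ^ 4 := by positivity
          have h8 : (L : ℝ) + K * (4 * L + 4 * μ⁻¹ ^ 4) ≤ 5 * K * (L + μ⁻¹ ^ 4) := by nlinarith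
          have h9 : 2 * ((L : ℝ) + R) ≤ 6 * L := by linarith
          gcongr
      _ = μ⁻¹ ^ 2 * (30 * K * ((L * μ) ^ 2 + (√L / μ) ^ 2)) := by
          rw [div_pow, Real.sq_sqrt hL]; field_simp; ring
      _ ≤ R * (30 * K * (L * μ + √L / μ) ^ 2) := by
          have h10 : 0 ≤ (L * μ) * (√L / μ) := by positivity
          gcongr
          nlinarith
  have h8 : S ^ 2 ≤ 30 * K * (L * μ + √L / μ) ^ 2 :=
    le_of_mul_le_mul_left h7 (by exact_mod_cast hR0)
  have h9 : S ^ 2 ≤ (30 * K * (L * μ + √L / μ)) ^ 2 := by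
    refine h8.trans ?_
    rw [mul_pow (30 * K)]
    gcongr
    nlinarith
  have h10 := (pow_le_pow_iff_left₀ (norm_nonneg _) (by positivity) two_ne_zero).1 h9
  calc S ≤ 30 * K * (L * μ + √L / μ) := h10
    _ = _ := by rw [hK]; ring

lemma difference_mem_Icc {F F' : ℝ → ℝ} {u v a b : ℝ}
    (h : ∀ t ∈ Set.Icc u (v + 1), HasDerivAt F (F' t) t)
    (hb : ∀ t ∈ Set.Icc u (v + 1), F' t ∈ Set.Icc a b) :
    ∀ t ∈ Set.Icc u v, F (t + 1) - F t ∈ Set.Icc a b := by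
  intro t ht
  have hsub : ∀ s ∈ Set.Icc t (t + 1), s ∈ Set.Icc u (v + 1) :=
    fun s hs => ⟨ht.1.trans hs.1, hs.2.trans (by linarith [ht.2])⟩
  obtain ⟨ξ, hξ, hξ'⟩ := exists_hasDerivAt_eq_slope F F' (by linarith : t < t + 1)
    (fun s hs => (h s (hsub s hs)).continuousAt.continuousWithinAt)
    (fun s hs => h s (hsub s (Set.Ioo_subset_Icc_self hs)))
  have h1 : F (t + 1) - F t = F' ξ := by rw [hξ']; simp
  rw [h1]
  exact hb ξ (hsub ξ (Set.Ioo_subset_Icc_self hξ))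

lemma HasDerivAt.forward_difference {F : ℝ → ℝ} {F' : ℝ → ℝ} {t : ℝ}
    (h0 : HasDerivAt F (F' t) t) (h1 : HasDerivAt F (F' (t + 1)) (t + 1)) :
    HasDerivAt (fun s => F (s + 1) - F s) (F' (t + 1) - F' t) t :=
  (h1.comp_add_const t 1).sub h0

lemma third_difference_mem_Icc {F F1 F2 F3 : ℝ → ℝ} {u v a b : ℝ}
    (h1 : ∀ t ∈ Set.Icc u (v + 3), HasDerivAt F (F1 t) t)
    (h2 : ∀ t ∈ Set.Icc u (v + 3), HasDerivAt F1 (F2 t) t)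
    (h3 : ∀ t ∈ Set.Icc u (v + 3), HasDerivAt F2 (F3 t) t)
    (hb : ∀ t ∈ Set.Icc u (v + 3), F3 t ∈ Set.Icc a b) :
    ∀ t ∈ Set.Icc u v, F (t + 3) - 3 * F (t + 2) + 3 * F (t + 1) - F t ∈ Set.Icc a b := by
  have hmem : ∀ {k : ℝ}, k ≤ 2 → ∀ t ∈ Set.Icc u (v + k),
      t ∈ Set.Icc u (v + 3) ∧ t + 1 ∈ Set.Icc u (v + 3) := fun hk t ht =>
    ⟨⟨ht.1, by linarith [ht.2]⟩, ⟨by linarith [ht.1], by linarith [ht.2]⟩⟩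
  have d2 : ∀ t ∈ Set.Icc u (v + 2), F2 (t + 1) - F2 t ∈ Set.Icc a b := by
    apply difference_mem_Icc (F' := F3) <;> rw [show v + 2 + 1 = v + 3 by ring] <;> assumption
  have d1 := difference_mem_Icc (u := u) (v := v + 1) (a := a) (b := b)
    (F := fun s => F1 (s + 1) - F1 s)
    (F' := fun s => F2 (s + 1) - F2 s)
    (fun t ht => by
      rw [show v + 1 + 1 = v + 2 by ring] at ht
      exact (h2 _ (hmem le_rfl t ht).1).forward_difference (h2 _ (hmem le_rfl t ht).2))
    (fun t ht => by rw [show v + 1 + 1 = v + 2 by ring] at ht; exact d2 t ht)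
  have d0 := difference_mem_Icc (u := u) (v := v) (a := a) (b := b)
    (F := fun s => (F (s + 1 + 1) - F (s + 1)) - (F (s + 1) - F s))
    (F' := fun s => (F1 (s + 1 + 1) - F1 (s + 1)) - (F1 (s + 1) - F1 s))
    (fun t ht => by
      have hm := hmem (by norm_num : (1 : ℝ) ≤ 2) t ht
      have hm' := hmem le_rfl (t + 1) ⟨by linarith [ht.1], by linarith [ht.2]⟩
      have e0 := (h1 _ hm.1).forward_difference (h1 _ hm.2)
      have e1 := (h1 _ hm'.1).forward_difference (h1 _ hm'.2)
      exact HasDerivAt.forward_difference (F := fun s => F (s + 1) - F s)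
        (F' := fun s => F1 (s + 1) - F1 s) e0 e1)
    (fun t ht => by simpa using d1 t ht)
  intro t ht
  have := d0 t ht
  simp only [add_assoc] at this
  norm_num at this ⊢
  constructor <;> linarith [this.1, this.2]

/-- The increment `(x + q) ^ γ - x ^ γ`. -/
noncomputable def powInc (γ q x : ℝ) : ℝ := (x + q) ^ γ - x ^ γ

lemma hasDerivAt_powInc (γ : ℝ) {q x : ℝ} (hq : 0 ≤ q) (hx : 0 < x) :
    HasDerivAt (powInc γ q) (γ * powInc (γ - 1) q x) x := by
  unfold powInc
  have h1 := (Real.hasDerivAt_rpow_const (x := x + q) (p := γ)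
    (Or.inl (by positivity))).comp_add_const x q
  have h2 := Real.hasDerivAt_rpow_const (x := x) (p := γ) (Or.inl hx.ne')
  exact (h1.sub h2).congr_deriv (by ring)

lemma integral_rpow_sub (r : ℝ) {q x : ℝ} (hr : r ≠ 0) (hq : 0 ≤ q) (hx : 0 < x) :
    ∫ s in x..(x + q), s ^ (r - 1) = powInc r q x / r := by
  rw [integral_rpow]
  · simp [powInc]
  · right
    refine ⟨fun h => hr (by linarith), ?_⟩
    rw [Set.uIcc_of_le (by linarith)]
    intro h
    linarith [h.1]

lemma integral_rpow_shift_bounds (r : ℝ) (j : ℕ) {q x : ℝ} (hq : 0 ≤ q) (hx : 0 < x) :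
    ∫ s in x..(x + q), s ^ (r - j) ∈ Set.Icc (((x + q) ^ j)⁻¹ * ∫ s in x..(x + q), s ^ r)
      ((x ^ j)⁻¹ * ∫ s in x..(x + q), s ^ r) := by
  have hInt : ∀ t : ℝ, IntervalIntegrable (fun s : ℝ => s ^ t) MeasureTheory.volume x (x + q) := by
    intro t
    apply intervalIntegral.intervalIntegrable_rpow
    right
    rw [Set.uIcc_of_le (by linarith)]
    intro h
    linarith [h.1]
  rw [← intervalIntegral.integral_const_mul, ← intervalIntegral.integral_const_mul]
  have hkey : ∀ s ∈ Set.Icc x (x + q), s ^ (r - j) = (s ^ j)⁻¹ * s ^ r := by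
    intro s hs
    have hs0 : 0 < s := hx.trans_le hs.1
    rw [Real.rpow_sub hs0, Real.rpow_natCast]
    field_simp
  constructor
  · refine intervalIntegral.integral_mono_on (by linarith) ((hInt r).const_mul _) (hInt _) ?_
    intro s hs
    have hs0 : 0 < s := hx.trans_le hs.1
    rw [hkey s hs]
    have := hs.2
    gcongr
  · refine intervalIntegral.integral_mono_on (by linarith) (hInt _) ((hInt r).const_mul _) ?_
    intro s hs
    have hs0 : 0 < s := hx.trans_le hs.1
    rw [hkey s hs]
    have := hs.1
    gcongr

lemma powInc_pos {γ q x : ℝ} (hγ : 0 < γ) (hq : 0 < q) (hx : 0 < x) : 0 < powInc γ q x :=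
  sub_pos.2 (Real.rpow_lt_rpow hx.le (by linarith) hγ)

lemma powInc_bounds {γ q x : ℝ} (hγ : 0 < γ) (hγ1 : γ < 1) (hq : 0 ≤ q) (hx : 0 < x) :
    powInc γ q x ∈ Set.Icc (γ * q * (x + q) ^ (γ - 1)) (γ * q * x ^ (γ - 1)) := by
  have h0 : powInc γ q x = γ * ∫ s in x..(x + q), s ^ (γ - 1) := by
    rw [integral_rpow_sub γ hγ.ne' hq hx]; field_simp
  have hInt : IntervalIntegrable (fun s : ℝ => s ^ (γ - 1)) MeasureTheory.volume x (x + q) := by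
    apply intervalIntegral.intervalIntegrable_rpow
    right
    rw [Set.uIcc_of_le (by linarith)]
    intro h
    linarith [h.1]
  rw [h0, mul_assoc, mul_assoc]
  constructor
  · gcongr
    have := intervalIntegral.integral_mono_on (by linarith : x ≤ x + q)
      (intervalIntegrable_const (c := (x + q) ^ (γ - 1))) hInt
      (fun s hs => Real.rpow_le_rpow_of_nonpos (hx.trans_le hs.1) hs.2 (by linarith))
    simpa using this
  · gcongr
    have := intervalIntegral.integral_mono_on (by linarith : x ≤ x + q) hInt
      (intervalIntegrable_const (c := x ^ (γ - 1)))
      (fun s hs => Real.rpow_le_rpow_of_nonpos hx hs.1 (by linarith))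
    simpa using this

lemma hasDerivAt_rpow_chain {Y Y1 Y2 Y3 : ℝ → ℝ} {x : ℝ} (κ : ℝ) (h0 : 0 < Y x)
    (h1 : HasDerivAt Y (Y1 x) x) (h2 : HasDerivAt Y1 (Y2 x) x) (h3 : HasDerivAt Y2 (Y3 x) x) :
    HasDerivAt (fun t => Y t ^ κ) (κ * Y x ^ (κ - 1) * Y1 x) x ∧
    HasDerivAt (fun t => κ * Y t ^ (κ - 1) * Y1 t)
      (κ * (κ - 1) * Y x ^ (κ - 2) * Y1 x ^ 2 + κ * Y x ^ (κ - 1) * Y2 x) x ∧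
    HasDerivAt (fun t => κ * (κ - 1) * Y t ^ (κ - 2) * Y1 t ^ 2 + κ * Y t ^ (κ - 1) * Y2 t)
      (κ * (κ - 1) * (κ - 2) * Y x ^ (κ - 3) * Y1 x ^ 3
        + 3 * κ * (κ - 1) * Y x ^ (κ - 2) * Y1 x * Y2 x + κ * Y x ^ (κ - 1) * Y3 x) x := by
  have hp : ∀ r : ℝ, HasDerivAt (fun t => Y t ^ r) (Y1 x * r * Y x ^ (r - 1)) x :=
    fun r => h1.rpow_const (Or.inl h0.ne')
  refine ⟨(hp κ).congr_deriv (by ring), ?_, ?_⟩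
  · refine (((hp (κ - 1)).const_mul κ).mul h2).congr_deriv ?_
    rw [show κ - 1 - 1 = κ - 2 by ring]
    ring
  · refine ((((hp (κ - 2)).const_mul (κ * (κ - 1))).mul (h2.pow 2)).add
      (((hp (κ - 1)).const_mul κ).mul h3)).congr_deriv ?_
    rw [show κ - 2 - 1 = κ - 3 by ring, show κ - 1 - 1 = κ - 2 by ring]
    simp only [Pi.pow_apply]
    push_cast
    ring

/-- Logarithmic form of the third derivative of `powInc γ q x ^ (1 / (1 - γ))`. -/
lemma third_deriv_powInc_rpow {γ q x : ℝ} (hγ : 8 / 9 < γ) (hγ1 : γ < 1) (hq : 0 < q)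
    (hqx : q ≤ x) :
    -((1 - γ)⁻¹ * ((1 - γ)⁻¹ - 1) * ((1 - γ)⁻¹ - 2) * powInc γ q x ^ ((1 - γ)⁻¹ - 3)
          * (γ * powInc (γ - 1) q x) ^ 3
        + 3 * (1 - γ)⁻¹ * ((1 - γ)⁻¹ - 1) * powInc γ q x ^ ((1 - γ)⁻¹ - 2)
          * (γ * powInc (γ - 1) q x) * (γ * ((γ - 1) * powInc (γ - 1 - 1) q x))
        + (1 - γ)⁻¹ * powInc γ q x ^ ((1 - γ)⁻¹ - 1)
          * (γ * ((γ - 1) * ((γ - 1 - 1) * powInc (γ - 1 - 1 - 1) q x))))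
      ∈ Set.Icc (powInc γ q x ^ (1 - γ)⁻¹ / (4 * x ^ 3))
        (7 * powInc γ q x ^ (1 - γ)⁻¹ / x ^ 3) := by
  have hx : 0 < x := hq.trans_le hqx
  have hY := powInc_pos (by linarith : 0 < γ) hq hx
  set Y := powInc γ q x with hYdef
  set κ := (1 - γ)⁻¹ with hκ
  have hp0 : 0 < 1 - γ := by linarith
  have hκp : κ * (1 - γ) = 1 := inv_mul_cancel₀ hp0.ne'
  set I0 := ∫ s in x..(x + q), s ^ (γ - 1) with hI0
  have e0 : Y = γ * I0 := by rw [hI0, integral_rpow_sub γ (by linarith) hq.le hx]; field_simp; rfl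
  have e1 : powInc (γ - 1) q x = (γ - 1) * ∫ s in x..(x + q), s ^ (γ - 1 - (1 : ℕ)) := by
    rw [Nat.cast_one, integral_rpow_sub (γ - 1) (by linarith) hq.le hx]
    field_simp [(by linarith : γ - 1 ≠ 0)]
  have e2 : powInc (γ - 1 - 1) q x = (γ - 2) * ∫ s in x..(x + q), s ^ (γ - 1 - (2 : ℕ)) := by
    rw [show γ - 1 - ((2 : ℕ) : ℝ) = (γ - 2) - 1 by push_cast; ring,
      integral_rpow_sub (γ - 2) (by linarith) hq.le hx, show γ - 1 - 1 = γ - 2 by ring]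
    field_simp [(by linarith : γ - 2 ≠ 0)]
  have e3 : powInc (γ - 1 - 1 - 1) q x = (γ - 3) * ∫ s in x..(x + q), s ^ (γ - 1 - (3 : ℕ)) := by
    rw [show γ - 1 - ((3 : ℕ) : ℝ) = (γ - 3) - 1 by push_cast; ring,
      integral_rpow_sub (γ - 3) (by linarith) hq.le hx, show γ - 1 - 1 - 1 = γ - 3 by ring]
    field_simp [(by linarith : γ - 3 ≠ 0)]
  have b1 := integral_rpow_shift_bounds (γ - 1) 1 hq.le hx
  have b2 := integral_rpow_shift_bounds (γ - 1) 2 hq.le hx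
  have b3 := integral_rpow_shift_bounds (γ - 1) 3 hq.le hx
  rw [e1, e2, e3]
  rw [← hI0] at b1 b2 b3
  have hI0pos : 0 < I0 := by
    have : 0 < γ * I0 := e0 ▸ hY
    exact (mul_pos_iff_of_pos_left (by linarith)).1 this
  obtain ⟨a1, ha1⟩ : ∃ a, a * I0 = ∫ s in x..(x + q), s ^ (γ - 1 - (1 : ℕ)) :=
    ⟨_, div_mul_cancel₀ _ hI0pos.ne'⟩
  obtain ⟨a2, ha2⟩ : ∃ a, a * I0 = ∫ s in x..(x + q), s ^ (γ - 1 - (2 : ℕ)) :=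
    ⟨_, div_mul_cancel₀ _ hI0pos.ne'⟩
  obtain ⟨a3, ha3⟩ : ∃ a, a * I0 = ∫ s in x..(x + q), s ^ (γ - 1 - (3 : ℕ)) :=
    ⟨_, div_mul_cancel₀ _ hI0pos.ne'⟩
  rw [← ha1] at b1 ⊢
  rw [← ha2] at b2 ⊢
  rw [← ha3] at b3 ⊢
  have c1 : a1 ∈ Set.Icc ((x + q) ^ 1)⁻¹ (x ^ 1)⁻¹ :=
    ⟨le_of_mul_le_mul_right b1.1 hI0pos, le_of_mul_le_mul_right b1.2 hI0pos⟩
  have c2 : a2 ∈ Set.Icc ((x + q) ^ 2)⁻¹ (x ^ 2)⁻¹ :=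
    ⟨le_of_mul_le_mul_right b2.1 hI0pos, le_of_mul_le_mul_right b2.2 hI0pos⟩
  have c3 : a3 ∈ Set.Icc ((x + q) ^ 3)⁻¹ (x ^ 3)⁻¹ :=
    ⟨le_of_mul_le_mul_right b3.1 hI0pos, le_of_mul_le_mul_right b3.2 hI0pos⟩
  clear ha1 ha2 ha3 b1 b2 b3 e1 e2 e3
  have k1 : Y ^ κ = Y ^ (κ - 1) * Y := by
    rw [← Real.rpow_add_one hY.ne']; congr 1; ring
  have k2 : Y ^ κ = Y ^ (κ - 2) * Y ^ 2 := by
    rw [← Real.rpow_natCast, ← Real.rpow_add hY]; congr 1; push_cast; ring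
  have k3 : Y ^ κ = Y ^ (κ - 3) * Y ^ 3 := by
    rw [← Real.rpow_natCast, ← Real.rpow_add hY]; congr 1; push_cast; ring
  have hT : 0 < Y ^ κ := Real.rpow_pos_of_pos hY κ
  set p := 1 - γ with hp
  have hγp : γ = 1 - p := by rw [hp]; ring
  have hmain : -(κ * (κ - 1) * (κ - 2) * Y ^ (κ - 3) * (γ * ((γ - 1) * (a1 * I0))) ^ 3
        + 3 * κ * (κ - 1) * Y ^ (κ - 2) * (γ * ((γ - 1) * (a1 * I0)))
          * (γ * ((γ - 1) * ((γ - 2) * (a2 * I0))))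
        + κ * Y ^ (κ - 1) * (γ * ((γ - 1) * ((γ - 1 - 1) * ((γ - 3) * (a3 * I0))))))
      = Y ^ κ * ((1 - p) * (1 - 2 * p) * a1 ^ 3 + 3 * (1 - p) * (1 + p) * (a1 * a2)
        + (1 + p) * (2 + p) * a3) := by
    have r1 : γ * ((γ - 1) * (a1 * I0)) = -(p * a1) * Y := by rw [e0, hp]; ring
    have r2 : γ * ((γ - 1) * ((γ - 2) * (a2 * I0))) = p * (1 + p) * a2 * Y := by rw [e0, hp]; ring
    have r3 : γ * ((γ - 1) * ((γ - 1 - 1) * ((γ - 3) * (a3 * I0))))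
        = -(p * (1 + p) * (2 + p) * a3) * Y := by rw [e0, hp]; ring
    rw [r1, r2, r3]
    have s1 : κ * (κ - 1) * (κ - 2) * p ^ 3 = (1 - p) * (1 - 2 * p) := by
      calc κ * (κ - 1) * (κ - 2) * p ^ 3 = (κ * p) * (κ * p - p) * (κ * p - 2 * p) := by ring
        _ = _ := by rw [hκp]; ring
    have s2 : κ * (κ - 1) * p ^ 2 = 1 - p := by
      calc κ * (κ - 1) * p ^ 2 = (κ * p) * (κ * p - p) := by ring
        _ = _ := by rw [hκp]; ring
    calc _ = (κ * (κ - 1) * (κ - 2) * p ^ 3) * a1 ^ 3 * (Y ^ (κ - 3) * Y ^ 3)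
        + 3 * (κ * (κ - 1) * p ^ 2) * (1 + p) * (a1 * a2) * (Y ^ (κ - 2) * Y ^ 2)
        + (κ * p) * (1 + p) * (2 + p) * a3 * (Y ^ (κ - 1) * Y) := by ring
      _ = _ := by rw [s1, s2, hκp, ← k1, ← k2, ← k3]; ring
  rw [hmain]
  have hp9 : p < 1 / 9 := by rw [hp]; linarith
  have hxq : 0 < x + q := by linarith
  have n1 : 0 < a1 := lt_of_lt_of_le (by positivity) c1.1
  have n2 : 0 < a2 := lt_of_lt_of_le (by positivity) c2.1
  have n3 : 0 < a3 := lt_of_lt_of_le (by positivity) c3.1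
  have q1 : 0 < 1 - 2 * p := by linarith
  have q2 : 0 < 1 - p := by linarith
  have w0 : 2 ≤ (1 + p) * (2 + p) := by nlinarith only [hp0]
  have w1 : (1 - p) * (1 - 2 * p) ≤ 1 := mul_le_one₀ (by linarith) q1.le (by linarith)
  have w2 : 3 * (1 - p) * (1 + p) ≤ 3 := by nlinarith only [sq_nonneg p]
  have w3 : (1 + p) * (2 + p) ≤ 3 := by nlinarith only [hp0, hp9]
  constructor
  · have l1 : 1 / (8 * x ^ 3) ≤ a3 := by
      refine le_trans ?_ c3.1
      rw [one_div]
      refine inv_anti₀ (by positivity) ?_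
      calc (x + q) ^ 3 ≤ (2 * x) ^ 3 := by gcongr; linarith
        _ = 8 * x ^ 3 := by ring
    have l2 : 1 / (4 * x ^ 3) ≤ (1 + p) * (2 + p) * a3 := by
      calc 1 / (4 * x ^ 3) = 2 * (1 / (8 * x ^ 3)) := by field_simp; norm_num
        _ ≤ 2 * a3 := by linarith
        _ ≤ (1 + p) * (2 + p) * a3 := by gcongr
    have l3 : 0 ≤ (1 - p) * (1 - 2 * p) * a1 ^ 3 := by positivity
    have l4 : 0 ≤ 3 * (1 - p) * (1 + p) * (a1 * a2) := by positivity
    calc Y ^ κ / (4 * x ^ 3) = Y ^ κ * (1 / (4 * x ^ 3)) := by ring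
      _ ≤ _ := by gcongr; linarith
  · have u1 : a1 ^ 3 ≤ (x ^ 3)⁻¹ := by
      calc a1 ^ 3 ≤ ((x ^ 1)⁻¹) ^ 3 := by have := c1.2; gcongr
        _ = _ := by rw [pow_one, inv_pow]
    have u2 : a1 * a2 ≤ (x ^ 3)⁻¹ := by
      calc a1 * a2 ≤ (x ^ 1)⁻¹ * (x ^ 2)⁻¹ := by have := c1.2; have := c2.2; gcongr
        _ = _ := by rw [← mul_inv]; ring_nf
    have u3 := c3.2
    have hX : 0 < (x ^ 3)⁻¹ := by positivity
    have v1 : (1 - p) * (1 - 2 * p) * a1 ^ 3 ≤ 1 * (x ^ 3)⁻¹ := by gcongr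
    have v2 : 3 * (1 - p) * (1 + p) * (a1 * a2) ≤ 3 * (x ^ 3)⁻¹ := by gcongr
    have v3 : (1 + p) * (2 + p) * a3 ≤ 3 * (x ^ 3)⁻¹ := by gcongr
    calc _ ≤ Y ^ κ * (7 * (x ^ 3)⁻¹) := by gcongr; linarith
      _ = _ := by ring

lemma third_difference_powInc_rpow {γ q u v a b : ℝ} (hγ : 8 / 9 < γ) (hγ1 : γ < 1) (hq : 0 < q)
    (hqu : q ≤ u) {A : ℝ} (hA : 0 < A)
    (hab : ∀ t ∈ Set.Icc u (v + 3), a ≤ A * powInc γ q t ^ (1 - γ)⁻¹ / (4 * t ^ 3)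
      ∧ 7 * (A * powInc γ q t ^ (1 - γ)⁻¹) / t ^ 3 ≤ b) :
    ∀ t ∈ Set.Icc u v, (fun s => -(A * powInc γ q s ^ (1 - γ)⁻¹)) (t + 3)
      - 3 * (fun s => -(A * powInc γ q s ^ (1 - γ)⁻¹)) (t + 2)
      + 3 * (fun s => -(A * powInc γ q s ^ (1 - γ)⁻¹)) (t + 1)
      - (fun s => -(A * powInc γ q s ^ (1 - γ)⁻¹)) t ∈ Set.Icc a b := by
  have hd : ∀ t ∈ Set.Icc u (v + 3), 0 < t := fun t ht => hq.trans_le (hqu.trans ht.1)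
  have hder := fun t (ht : t ∈ Set.Icc u (v + 3)) =>
    hasDerivAt_rpow_chain (Y := powInc γ q) (Y1 := fun x => γ * powInc (γ - 1) q x)
      (Y2 := fun x => γ * ((γ - 1) * powInc (γ - 1 - 1) q x))
      (Y3 := fun x => γ * ((γ - 1) * ((γ - 1 - 1) * powInc (γ - 1 - 1 - 1) q x))) (1 - γ)⁻¹
      (powInc_pos (by linarith) hq (hd t ht))
      (hasDerivAt_powInc γ hq.le (hd t ht))
      ((hasDerivAt_powInc (γ - 1) hq.le (hd t ht)).const_mul γ)
      (((hasDerivAt_powInc (γ - 1 - 1) hq.le (hd t ht)).const_mul (γ - 1)).const_mul γ)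
  refine third_difference_mem_Icc
    (fun t ht => ((hder t ht).1.const_mul A).neg)
    (fun t ht => ((hder t ht).2.1.const_mul A).neg)
    (fun t ht => ((hder t ht).2.2.const_mul A).neg) (fun t ht => ?_)
  have h := third_deriv_powInc_rpow hγ hγ1 hq (hqu.trans ht.1)
  have h' := hab t ht
  rw [← mul_neg]
  constructor
  · refine h'.1.trans ?_
    rw [mul_div_assoc]
    exact mul_le_mul_of_nonneg_left h.1 hA.le
  · refine le_trans ?_ h'.2
    rw [show 7 * (A * powInc γ q t ^ (1 - γ)⁻¹) / t ^ 3
      = A * (7 * powInc γ q t ^ (1 - γ)⁻¹ / t ^ 3) by ring]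
    exact mul_le_mul_of_nonneg_left h.2 hA.le

lemma norm_sum_e_powInc_rpow_le {γ c₁ c₂ : ℝ} (hγ : 8 / 9 < γ) (hγ1 : γ < 1) (hc₁ : 0 < c₁)
    (hc : c₁ ≤ c₂) :
    ∃ K : ℝ, 0 < K ∧ ∀ (N q u A ν φ : ℝ) (L : ℕ), 0 < N → 0 < q → q ≤ u → N / 2 ≤ u →
      u + L + 3 ≤ 2 * N → 0 < A → 0 < ν →
      (∀ t ∈ Set.Icc u (u + L + 3), |φ| * (A * powInc γ q t ^ (1 - γ)⁻¹) ∈ Set.Icc c₁ c₂) →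
      ‖∑ n ∈ range L, e (ν ^ 6 * N ^ 3 * φ * (A * powInc γ q (u + n) ^ (1 - γ)⁻¹))‖
        ≤ K * (L * ν + √L / ν) := by
  set ρ : ℝ := (c₁ / 32) ^ (1 / 6 : ℝ) with hρ
  have hρ0 : 0 < ρ := Real.rpow_pos_of_pos (by linarith) _
  have hρ6 : ρ ^ 6 = c₁ / 32 := by
    rw [hρ, ← Real.rpow_natCast, ← Real.rpow_mul (by linarith)]; norm_num
  set C : ℝ := 56 * 32 * (c₂ / c₁) with hC
  have hcc : 1 ≤ c₂ / c₁ := (one_le_div hc₁).2 hc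
  have hC1 : 1 ≤ C := by rw [hC]; linarith
  refine ⟨480 * C * (ρ + 1 / ρ), by positivity, ?_⟩
  intro N q u A ν φ L hN hq hqu hNu huN hA hν hT
  have hu : 0 < u := hq.trans_le hqu
  have hφ : 0 < |φ| := by
    refine abs_pos.2 fun h0 => ?_
    have := (hT u ⟨le_rfl, by have : (0 : ℝ) ≤ L := Nat.cast_nonneg L; linarith⟩).1
    rw [h0] at this
    simp at this
    linarith
  set B := ν ^ 6 * N ^ 3 * |φ| * A with hB
  have hB0 : 0 < B := by positivity
  set f : ℝ → ℝ := fun s => -(B * powInc γ q s ^ (1 - γ)⁻¹) with hf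
  have hμ : (ρ * ν) ^ 6 = c₁ / 32 * ν ^ 6 := by rw [mul_pow, hρ6]
  have h3 := third_difference_powInc_rpow (u := u) (v := u + L) (a := (ρ * ν) ^ 6)
    (b := C * (ρ * ν) ^ 6) hγ hγ1 hq hqu hB0 (by
      intro t ht
      have ht0 : 0 < t := hu.trans_le ht.1
      have hT' := hT t ht
      set T := A * powInc γ q t ^ (1 - γ)⁻¹ with hTdef
      have hBT : B * powInc γ q t ^ (1 - γ)⁻¹ = ν ^ 6 * N ^ 3 * (|φ| * T) := by
        rw [hB, hTdef]; ring
      rw [hBT, hμ]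
      have hν6 : 0 < ν ^ 6 := by positivity
      constructor
      · rw [le_div_iff₀ (by positivity)]
        have ht3 : t ^ 3 ≤ (2 * N) ^ 3 := by gcongr; linarith [ht.2]
        calc c₁ / 32 * ν ^ 6 * (4 * t ^ 3) ≤ c₁ / 32 * ν ^ 6 * (4 * (2 * N) ^ 3) := by gcongr
          _ = ν ^ 6 * N ^ 3 * c₁ := by ring
          _ ≤ _ := by have := hT'.1; gcongr
      · rw [div_le_iff₀ (by positivity)]
        have ht3 : (N / 2) ^ 3 ≤ t ^ 3 := by gcongr; linarith [ht.1]
        calc 7 * (ν ^ 6 * N ^ 3 * (|φ| * T)) ≤ 7 * (ν ^ 6 * N ^ 3 * c₂) := by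
              have := hT'.2; gcongr
          _ = C * (c₁ / 32 * ν ^ 6) * (N / 2) ^ 3 := by rw [hC]; field_simp; ring
          _ ≤ _ := by gcongr)
  have hmem : ∀ n < L, u + (n : ℝ) ∈ Set.Icc u (u + L) := by
    intro n hn
    have : (n : ℝ) ≤ L := by exact_mod_cast hn.le
    exact ⟨by linarith [(Nat.cast_nonneg n : (0 : ℝ) ≤ n)], by linarith⟩
  have hcast : ∀ n k : ℕ, f (u + n + k) = f (u + ((n + k : ℕ) : ℝ)) := by
    intro n k
    congr 1
    push_cast
    ring
  have htest := third_difference_test (fun m : ℕ => f (u + m)) L (μ := ρ * ν) (C := C)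
    (by positivity) hC1
    (fun n hn => by
      rw [← hcast n 3, ← hcast n 2, ← hcast n 1]; exact_mod_cast (h3 _ (hmem n hn)).1)
    (fun n hn => by
      rw [← hcast n 3, ← hcast n 2, ← hcast n 1]; exact_mod_cast (h3 _ (hmem n hn)).2)
  have hnorm : ‖∑ n ∈ range L, e (ν ^ 6 * N ^ 3 * φ * (A * powInc γ q (u + n) ^ (1 - γ)⁻¹))‖
      = ‖∑ n ∈ range L, e (f (u + n))‖ := by
    rcases le_total 0 φ with h0 | h0
    · rw [← norm_sum_e_neg (range L) (fun n : ℕ => f (u + n))]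
      congr 1
      refine sum_congr rfl fun n _ => ?_
      congr 1
      simp only [hf, hB, abs_of_nonneg h0]
      ring
    · congr 1
      refine sum_congr rfl fun n _ => ?_
      congr 1
      simp only [hf, hB, abs_of_nonpos h0]
      ring
  rw [hnorm]
  refine htest.trans ?_
  rw [mul_assoc (480 * C)]
  refine mul_le_mul_of_nonneg_left ?_ (by positivity)
  have i1 : 0 ≤ 1 / ρ * (L * ν) := by positivity
  have i2 : 0 ≤ ρ * (√L / ν) := by positivity
  calc (L : ℝ) * (ρ * ν) + √L / (ρ * ν) = ρ * (L * ν) + 1 / ρ * (√L / ν) := by field_simp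
    _ ≤ (ρ + 1 / ρ) * (L * ν + √L / ν) := by ring_nf at i1 i2 ⊢; linarith

lemma hasDerivAt_e {ψ : ℝ → ℝ} {ψ' t : ℝ} (h : HasDerivAt ψ ψ' t) :
    HasDerivAt (fun s => e (ψ s)) (2 * Real.pi * Complex.I * ψ' * e (ψ t)) t := by
  unfold e
  exact ((h.ofReal_comp.const_mul (2 * Real.pi * Complex.I)).cexp).congr_deriv (by ring)

lemma continuous_e : Continuous e := by
  unfold e
  fun_prop

/-- Integration by parts against the derivative of an oscillating exponential. -/
lemma integral_mul_deriv_e {a a' ψ ψ' : ℝ → ℝ} {α β : ℝ} (hαβ : α ≤ β)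
    (ha : ∀ t ∈ Set.Icc α β, HasDerivAt a (a' t) t) (ha' : ContinuousOn a' (Set.Icc α β))
    (hψ : ∀ t ∈ Set.Icc α β, HasDerivAt ψ (ψ' t) t) (hψ' : ContinuousOn ψ' (Set.Icc α β))
    (hα : a α = 0) (hβ : a β = 0) :
    2 * Real.pi * Complex.I * ∫ t in α..β, ((a t * ψ' t : ℝ) : ℂ) * e (ψ t)
      = -∫ t in α..β, (a' t : ℂ) * e (ψ t) := by
  have hψc : ContinuousOn (fun t => e (ψ t)) (Set.Icc α β) :=
    continuous_e.comp_continuousOn fun t ht => (hψ t ht).continuousAt.continuousWithinAt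
  have h := intervalIntegral.integral_mul_deriv_eq_deriv_mul
    (u := fun t => (a t : ℂ)) (u' := fun t => (a' t : ℂ)) (v := fun t => e (ψ t))
    (v' := fun t => 2 * Real.pi * Complex.I * ψ' t * e (ψ t)) (a := α) (b := β)
    (fun t ht => (ha t (by rwa [Set.uIcc_of_le hαβ] at ht)).ofReal_comp)
    (fun t ht => hasDerivAt_e (hψ t (by rwa [Set.uIcc_of_le hαβ] at ht)))
    (ContinuousOn.intervalIntegrable_of_Icc hαβ (Complex.continuous_ofReal.comp_continuousOn ha'))
    (ContinuousOn.intervalIntegrable_of_Icc hαβ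
      ((continuousOn_const.mul (Complex.continuous_ofReal.comp_continuousOn hψ')).mul hψc))
  rw [hα, hβ] at h
  simp only [Complex.ofReal_zero, zero_mul, sub_self, zero_sub] at h
  rw [← h, ← intervalIntegral.integral_const_mul]
  congr 1
  ext t
  push_cast
  ring

lemma norm_two_pi_I : ‖(2 * Real.pi * Complex.I : ℂ)‖ = 2 * Real.pi := by
  rw [norm_mul, norm_mul, Complex.norm_I, Complex.norm_real, Real.norm_of_nonneg Real.pi_pos.le]
  simp

lemma norm_integral_mul_deriv_e_le {a a' ψ ψ' : ℝ → ℝ} {α β : ℝ} (hαβ : α ≤ β)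
    (ha : ∀ t ∈ Set.Icc α β, HasDerivAt a (a' t) t) (ha' : ContinuousOn a' (Set.Icc α β))
    (hψ : ∀ t ∈ Set.Icc α β, HasDerivAt ψ (ψ' t) t) (hψ' : ContinuousOn ψ' (Set.Icc α β))
    (hα : a α = 0) (hβ : a β = 0) :
    ‖∫ t in α..β, ((a t * ψ' t : ℝ) : ℂ) * e (ψ t)‖ ≤ ‖∫ t in α..β, (a' t : ℂ) * e (ψ t)‖ := by
  have h := congrArg norm (integral_mul_deriv_e hαβ ha ha' hψ hψ' hα hβ)
  rw [norm_mul, norm_neg, norm_two_pi_I] at h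
  rw [← h]
  have hpi : (1 : ℝ) ≤ 2 * Real.pi := by linarith [Real.pi_gt_three]
  exact le_mul_of_one_le_left (norm_nonneg _) hpi

/-- Two integrations by parts for an oscillating integral without stationary points. -/
lemma norm_integral_e_le_of_no_stationary {w w₁ w₂ ψ ψ₁ ψ₂ ψ₃ : ℝ → ℝ} {α β W P D : ℝ}
    (hαβ : α ≤ β)
    (hw : ∀ t ∈ Set.Icc α β, HasDerivAt w (w₁ t) t)
    (hw₁ : ∀ t ∈ Set.Icc α β, HasDerivAt w₁ (w₂ t) t) (hw₂ : ContinuousOn w₂ (Set.Icc α β))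
    (hψ : ∀ t ∈ Set.Icc α β, HasDerivAt ψ (ψ₁ t) t)
    (hψ₁ : ∀ t ∈ Set.Icc α β, HasDerivAt ψ₁ (ψ₂ t) t)
    (hψ₂ : ∀ t ∈ Set.Icc α β, HasDerivAt ψ₂ (ψ₃ t) t) (hψ₃ : ContinuousOn ψ₃ (Set.Icc α β))
    (hP : 1 ≤ P) (hD : 0 < D)
    (bw : ∀ t ∈ Set.Icc α β, |w t| ≤ W ∧ |w₁ t| ≤ W ∧ |w₂ t| ≤ W)
    (bψ : ∀ t ∈ Set.Icc α β, D ≤ |ψ₁ t| ∧ |ψ₂ t| ≤ P * D ∧ |ψ₃ t| ≤ P * D)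
    (hα : w α = 0) (hβ : w β = 0) (hα₁ : w₁ α = 0) (hβ₁ : w₁ β = 0) :
    ‖∫ t in α..β, (w t : ℂ) * e (ψ t)‖ ≤ 8 * W * P ^ 2 / D ^ 2 * (β - α) := by
  have hW : 0 ≤ W := (abs_nonneg _).trans (bw α ⟨le_rfl, hαβ⟩).1
  have hne : ∀ t ∈ Set.Icc α β, ψ₁ t ≠ 0 := fun t ht =>
    abs_pos.1 (hD.trans_le (bψ t ht).1)
  set g : ℝ → ℝ := fun t => (ψ₁ t)⁻¹ with hg
  set g₁ : ℝ → ℝ := fun t => -(ψ₂ t * g t ^ 2) with hg₁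
  set g₂ : ℝ → ℝ := fun t => -(ψ₃ t * g t ^ 2) + 2 * ψ₂ t ^ 2 * g t ^ 3 with hg₂
  have dg : ∀ t ∈ Set.Icc α β, HasDerivAt g (g₁ t) t := by
    intro t ht
    refine ((hψ₁ t ht).inv (hne t ht)).congr_deriv ?_
    simp only [hg₁, hg]
    field_simp
  have dg₁ : ∀ t ∈ Set.Icc α β, HasDerivAt g₁ (g₂ t) t := by
    intro t ht
    refine ((hψ₂ t ht).mul ((dg t ht).pow 2)).neg.congr_deriv ?_
    simp only [hg₂, hg₁, Pi.pow_apply]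
    push_cast
    ring
  have cont : ∀ {f f' : ℝ → ℝ}, (∀ t ∈ Set.Icc α β, HasDerivAt f (f' t) t) →
      ContinuousOn f (Set.Icc α β) := fun h t ht => (h t ht).continuousAt.continuousWithinAt
  have cw := cont hw
  have cw₁ := cont hw₁
  have cψ₁ := cont hψ₁
  have cψ₂ := cont hψ₂
  have cg := cont dg
  have cg₁ := cont dg₁
  have cg₂ : ContinuousOn g₂ (Set.Icc α β) := by simp only [hg₂]; fun_prop
  have bg : ∀ t ∈ Set.Icc α β, |g t| ≤ 1 / D ∧ |g₁ t| ≤ P / D ∧ |g₂ t| ≤ 3 * P ^ 2 / D := by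
    intro t ht
    obtain ⟨h1, h2, h3⟩ := bψ t ht
    have e1 : |g t| ≤ 1 / D := by
      simp only [hg]
      rw [abs_inv, one_div]
      exact inv_anti₀ hD h1
    have e2 : |g₁ t| ≤ P / D := by
      simp only [hg₁]
      rw [abs_neg, abs_mul, abs_pow]
      calc |ψ₂ t| * |g t| ^ 2 ≤ (P * D) * (1 / D) ^ 2 := by gcongr
        _ = P / D := by field_simp
    refine ⟨e1, e2, ?_⟩
    simp only [hg₂]
    refine (abs_add_le _ _).trans ?_
    rw [abs_neg, abs_mul, abs_mul, abs_mul, abs_pow, abs_pow, abs_pow, abs_two]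
    calc |ψ₃ t| * |g t| ^ 2 + 2 * |ψ₂ t| ^ 2 * |g t| ^ 3
        ≤ (P * D) * (1 / D) ^ 2 + 2 * (P * D) ^ 2 * (1 / D) ^ 3 := by gcongr
      _ = (P + 2 * P ^ 2) / D := by field_simp
      _ ≤ 3 * P ^ 2 / D := by gcongr; nlinarith only [hP]
  set b₁ : ℝ → ℝ := fun t => w₁ t * g t + w t * g₁ t with hb₁
  set b₂ : ℝ → ℝ := fun t => w₂ t * g t + 2 * (w₁ t * g₁ t) + w t * g₂ t with hb₂
  have db₁ : ∀ t ∈ Set.Icc α β, HasDerivAt (fun s => w s * g s) (b₁ t) t :=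
    fun t ht => (hw t ht).mul (dg t ht)
  have db₂ : ∀ t ∈ Set.Icc α β, HasDerivAt b₁ (b₂ t) t := fun t ht =>
    (((hw₁ t ht).mul (dg t ht)).add ((hw t ht).mul (dg₁ t ht))).congr_deriv (by
      simp only [hb₂]; ring)
  have cb₁ := cont db₂
  have cb₂ : ContinuousOn b₂ (Set.Icc α β) := by simp only [hb₂]; fun_prop
  set c : ℝ → ℝ := fun t => b₂ t * g t + b₁ t * g₁ t with hc
  have dc : ∀ t ∈ Set.Icc α β, HasDerivAt (fun s => b₁ s * g s) (c t) t :=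
    fun t ht => (db₂ t ht).mul (dg t ht)
  have cc : ContinuousOn c (Set.Icc α β) := by simp only [hc]; fun_prop
  have s1 := norm_integral_mul_deriv_e_le hαβ db₁ cb₁ hψ cψ₁ (by simp [hα]) (by simp [hβ])
  have s2 := norm_integral_mul_deriv_e_le hαβ dc cc hψ cψ₁ (by simp [hb₁, hα, hα₁])
    (by simp [hb₁, hβ, hβ₁])
  have r1 : ∫ t in α..β, (w t : ℂ) * e (ψ t)
      = ∫ t in α..β, ((w t * g t * ψ₁ t : ℝ) : ℂ) * e (ψ t) := by
    refine intervalIntegral.integral_congr fun t ht => ?_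
    rw [Set.uIcc_of_le hαβ] at ht
    simp only [hg]
    rw [inv_mul_cancel_right₀ (hne t ht)]
  have r2 : ∫ t in α..β, (b₁ t : ℂ) * e (ψ t)
      = ∫ t in α..β, ((b₁ t * g t * ψ₁ t : ℝ) : ℂ) * e (ψ t) := by
    refine intervalIntegral.integral_congr fun t ht => ?_
    rw [Set.uIcc_of_le hαβ] at ht
    simp only [hg]
    rw [inv_mul_cancel_right₀ (hne t ht)]
  rw [r1]
  refine s1.trans ?_
  rw [r2]
  refine s2.trans ?_
  have hb : ∀ t ∈ Set.uIoc α β, ‖(c t : ℂ) * e (ψ t)‖ ≤ 8 * W * P ^ 2 / D ^ 2 := by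
    intro t ht
    rw [Set.uIoc_of_le hαβ] at ht
    have ht' : t ∈ Set.Icc α β := Set.Ioc_subset_Icc_self ht
    obtain ⟨h1, h2, h3⟩ := bw t ht'
    obtain ⟨k1, k2, k3⟩ := bg t ht'
    rw [norm_mul, norm_e, mul_one, Complex.norm_real, Real.norm_eq_abs]
    have m1 : |b₁ t| ≤ 2 * W * P / D := by
      simp only [hb₁]
      refine (abs_add_le _ _).trans ?_
      rw [abs_mul, abs_mul]
      calc |w₁ t| * |g t| + |w t| * |g₁ t| ≤ W * (1 / D) + W * (P / D) := by gcongr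
        _ = W * (1 + P) / D := by ring
        _ ≤ W * (2 * P) / D := by gcongr; linarith
        _ = _ := by ring
    have m2 : |b₂ t| ≤ 6 * W * P ^ 2 / D := by
      simp only [hb₂]
      refine (abs_add_le _ _).trans ((add_le_add_left (abs_add_le _ _) _).trans ?_)
      rw [abs_mul, abs_mul, abs_mul, abs_mul, abs_two]
      calc |w₂ t| * |g t| + 2 * (|w₁ t| * |g₁ t|) + |w t| * |g₂ t|
          ≤ W * (1 / D) + 2 * (W * (P / D)) + W * (3 * P ^ 2 / D) := by gcongr
        _ = W * (1 + 2 * P + 3 * P ^ 2) / D := by ring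
        _ ≤ W * (6 * P ^ 2) / D := by gcongr; nlinarith only [hP]
        _ = _ := by ring
    simp only [hc]
    refine (abs_add_le _ _).trans ?_
    rw [abs_mul, abs_mul]
    calc |b₂ t| * |g t| + |b₁ t| * |g₁ t|
        ≤ 6 * W * P ^ 2 / D * (1 / D) + 2 * W * P / D * (P / D) := by gcongr
      _ = _ := by field_simp; ring
  refine (intervalIntegral.norm_integral_le_of_norm_le_const hb).trans ?_
  rw [abs_of_nonneg (sub_nonneg.2 hαβ)]

/-- A smooth weight supported on `[1/4, 5/4]`, equal to one on `[1/2, 1]`. -/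
noncomputable def dyBump : ContDiffBump (3 / 4 : ℝ) := ⟨1 / 4, 1 / 2, by norm_num, by norm_num⟩

lemma dyBump_contDiff {n : ℕ∞} : ContDiff ℝ n dyBump := dyBump.contDiff

lemma dyBump_nonneg (t : ℝ) : 0 ≤ dyBump t := dyBump.nonneg

lemma dyBump_eq_one {t : ℝ} (h1 : 1 / 2 ≤ t) (h2 : t ≤ 1) : dyBump t = 1 := by
  apply dyBump.one_of_mem_closedBall
  rw [Metric.mem_closedBall, Real.dist_eq, abs_le]
  simp only [dyBump]
  constructor <;> linarith

lemma dyBump_eq_zero {t : ℝ} (h : t ≤ 1 / 4 ∨ 5 / 4 ≤ t) : dyBump t = 0 := by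
  apply dyBump.zero_of_le_dist
  rw [Real.dist_eq, le_abs]
  simp only [dyBump]
  rcases h with h | h
  · right; linarith
  · left; linarith

lemma hasDerivAt_dyBump (t : ℝ) : HasDerivAt dyBump (deriv dyBump t) t :=
  ((dyBump_contDiff (n := 1)).differentiable (by norm_num) t).hasDerivAt

lemma deriv_dyBump_contDiff {n : ℕ} : ContDiff ℝ n (deriv dyBump) := by
  have h : ContDiff ℝ ((n : ℕ∞) + 1 : ℕ∞) dyBump := dyBump_contDiff
  have h' : ContDiff ℝ ((n : WithTop ℕ∞) + 1) dyBump := by exact_mod_cast h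
  exact (contDiff_succ_iff_deriv.1 h').2.2

lemma hasDerivAt_deriv_dyBump (t : ℝ) :
    HasDerivAt (deriv dyBump) (deriv (deriv dyBump) t) t := by
  have h : ContDiff ℝ ((1 : ℕ) : WithTop ℕ∞) (deriv dyBump) := deriv_dyBump_contDiff
  exact (h.differentiable (by norm_num) t).hasDerivAt

lemma continuous_deriv_dyBump : Continuous (deriv dyBump) :=
  (deriv_dyBump_contDiff (n := 0)).continuous

lemma continuous_deriv_deriv_dyBump : Continuous (deriv (deriv dyBump)) := by
  have h : ContDiff ℝ ((1 : ℕ) : WithTop ℕ∞) (deriv dyBump) := deriv_dyBump_contDiff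
  exact h.continuous_deriv (by norm_num)

lemma deriv_dyBump_eq_zero {t : ℝ} (h : t ≤ 1 / 4 ∨ 5 / 4 ≤ t) : deriv dyBump t = 0 := by
  apply IsLocalMin.deriv_eq_zero
  filter_upwards with s
  rw [dyBump_eq_zero h]
  exact dyBump_nonneg s

lemma exists_dyBump_bound : ∃ W : ℝ, 1 ≤ W ∧ ∀ t : ℝ,
    |dyBump t| ≤ W ∧ |deriv dyBump t| ≤ W ∧ |deriv (deriv dyBump) t| ≤ W := by
  have hs : HasCompactSupport dyBump := dyBump.hasCompactSupport
  obtain ⟨A, hA⟩ := hs.exists_bound_of_continuous dyBump.continuous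
  obtain ⟨B, hB⟩ := hs.deriv.exists_bound_of_continuous continuous_deriv_dyBump
  obtain ⟨C, hC⟩ := hs.deriv.deriv.exists_bound_of_continuous continuous_deriv_deriv_dyBump
  refine ⟨max 1 (max A (max B C)), le_max_left _ _, fun t => ⟨?_, ?_, ?_⟩⟩
  · exact (hA t).trans (by simp)
  · exact (hB t).trans (by simp)
  · exact (hC t).trans (by simp)

lemma rpow_near_bounds {γ t : ℝ} (hγ : 8 / 9 < γ) (hγ1 : γ < 1)
    (ht : t ∈ Set.Icc (1 / 4 : ℝ) (5 / 4)) :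
    4 / 5 ≤ t ^ (γ - 1) ∧ t ^ (γ - 1) ≤ 2 ∧ t ^ (γ - 2) ≤ 16 ∧ t ^ (γ - 3) ≤ 64 := by
  obtain ⟨h1, h2⟩ := ht
  have h0 : 0 < t := by linarith
  have hneg : ∀ a : ℝ, a ≤ 0 → t ^ a ≤ (1 / 4 : ℝ) ^ a := fun a ha =>
    Real.rpow_le_rpow_of_nonpos (by norm_num) h1 ha
  have hexp : ∀ a b : ℝ, b ≤ a → (1 / 4 : ℝ) ^ a ≤ (1 / 4 : ℝ) ^ b := fun a b hab =>
    Real.rpow_le_rpow_of_exponent_ge (by norm_num) (by norm_num) hab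
  refine ⟨?_, ?_, ?_, ?_⟩
  · calc (4 / 5 : ℝ) = (5 / 4 : ℝ) ^ (-1 : ℝ) := by rw [Real.rpow_neg_one]; norm_num
      _ ≤ (5 / 4 : ℝ) ^ (γ - 1) :=
        Real.rpow_le_rpow_of_exponent_le (by norm_num) (by linarith)
      _ ≤ t ^ (γ - 1) := Real.rpow_le_rpow_of_nonpos h0 h2 (by linarith)
  · refine (hneg _ (by linarith)).trans ((hexp _ (-(1 / 2)) (by linarith)).trans (le_of_eq ?_))
    rw [Real.rpow_neg (by norm_num), ← Real.sqrt_eq_rpow,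
      show (1 / 4 : ℝ) = (1 / 2) ^ 2 by norm_num, Real.sqrt_sq (by norm_num)]
    norm_num
  · refine (hneg _ (by linarith)).trans ((hexp _ (-2) (by linarith)).trans (le_of_eq ?_))
    rw [Real.rpow_neg (by norm_num)]
    norm_num
  · refine (hneg _ (by linarith)).trans ((hexp _ (-3) (by linarith)).trans (le_of_eq ?_))
    rw [Real.rpow_neg (by norm_num)]
    norm_num

lemma exists_norm_bump_integral_le {γ : ℝ} (hγ : 8 / 9 < γ) (hγ1 : γ < 1) :
    ∃ K : ℝ, 0 < K ∧ ∀ F y B : ℝ, 0 < F → F / 2 ≤ B → B ≤ 2 * F → (y ≤ F / 10 ∨ 8 * F ≤ y) →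
      ‖∫ t in (1 / 4 : ℝ)..(5 / 4), (dyBump t : ℂ) * e (B * t ^ γ - y * t)‖
        ≤ K / (F + |y|) ^ 2 := by
  obtain ⟨W, hW1, hW⟩ := exists_dyBump_bound
  refine ⟨8 * W * 5120 ^ 2 * 400, by positivity, fun F y B hF hB1 hB2 hy => ?_⟩
  have hB0 : 0 < B := by linarith
  have hpos : ∀ t ∈ Set.Icc (1 / 4 : ℝ) (5 / 4), t ≠ 0 := fun t ht => by
    have := ht.1; intro h; rw [h] at this; norm_num at this
  have hd : ∀ (a : ℝ), ∀ t ∈ Set.Icc (1 / 4 : ℝ) (5 / 4),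
      HasDerivAt (fun t : ℝ => t ^ a) (a * t ^ (a - 1)) t := fun a t ht =>
    Real.hasDerivAt_rpow_const (Or.inl (hpos t ht))
  have hy0 : 0 ≤ |y| := abs_nonneg y
  have key := norm_integral_e_le_of_no_stationary (w := dyBump) (w₁ := deriv dyBump)
    (w₂ := deriv (deriv dyBump)) (ψ := fun t => B * t ^ γ - y * t)
    (ψ₁ := fun t => B * (γ * t ^ (γ - 1)) - y)
    (ψ₂ := fun t => B * (γ * ((γ - 1) * t ^ (γ - 2))))
    (ψ₃ := fun t => B * (γ * ((γ - 1) * ((γ - 2) * t ^ (γ - 3)))))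
    (α := 1 / 4) (β := 5 / 4) (W := W) (P := 5120) (D := (F + |y|) / 20)
    (by norm_num) (fun t _ => hasDerivAt_dyBump t) (fun t _ => hasDerivAt_deriv_dyBump t)
    continuous_deriv_deriv_dyBump.continuousOn
    (fun t ht => (((hd γ t ht).const_mul B).sub ((hasDerivAt_id t).const_mul y)).congr_deriv
      (by ring))
    (fun t ht => ((((hd (γ - 1) t ht).const_mul γ).const_mul B).sub_const y).congr_deriv
      (by ring_nf))
    (fun t ht => ((((hd (γ - 2) t ht).const_mul (γ - 1)).const_mul γ).const_mul B).congr_deriv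
      (by ring_nf))
    (by
      refine ContinuousOn.mul continuousOn_const (ContinuousOn.mul continuousOn_const
        (ContinuousOn.mul continuousOn_const (ContinuousOn.mul continuousOn_const ?_)))
      exact fun t ht => (hd (γ - 3) t ht).continuousAt.continuousWithinAt)
    (by norm_num) (by positivity) (fun t _ => hW t)
    (by
      intro t ht
      obtain ⟨p1, p2, p3, p4⟩ := rpow_near_bounds hγ hγ1 ht
      have ht0 : 0 < t := by linarith [ht.1]
      have q3 : 0 < t ^ (γ - 2) := Real.rpow_pos_of_pos ht0 _
      have q4 : 0 < t ^ (γ - 3) := Real.rpow_pos_of_pos ht0 _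
      have l1 : F / 5 ≤ B * (γ * t ^ (γ - 1)) := by
        calc F / 5 ≤ F / 2 * (8 / 9 * (4 / 5)) := by linarith
          _ ≤ _ := by gcongr
      have l2 : B * (γ * t ^ (γ - 1)) ≤ 4 * F := by
        calc B * (γ * t ^ (γ - 1)) ≤ 2 * F * (1 * 2) := by gcongr
          _ = _ := by ring
      refine ⟨?_, ?_, ?_⟩
      · rcases hy with hy | hy
        · refine le_trans ?_ (le_abs_self _)
          rcases abs_cases y with h | h <;> linarith
        · refine le_trans ?_ (neg_le_abs _)
          rcases abs_cases y with h | h <;> linarith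
      · rw [abs_mul, abs_mul, abs_mul, abs_of_pos hB0, abs_of_pos q3,
          abs_of_pos (by linarith : 0 < γ),
          abs_of_neg (by linarith : γ - 1 < 0)]
        have g0 : 0 < γ := by linarith
        obtain ⟨a, ha⟩ : ∃ a, a = -(γ - 1) := ⟨_, rfl⟩
        have ha0 : 0 ≤ a := by linarith
        have ha1 : a ≤ 1 := by linarith
        rw [← ha]
        calc B * (γ * (a * t ^ (γ - 2))) ≤ 2 * F * (1 * (1 * 16)) := by gcongr
          _ ≤ _ := by linarith
      · rw [abs_mul, abs_mul, abs_mul, abs_mul, abs_of_pos hB0, abs_of_pos q4,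
          abs_of_pos (by linarith : 0 < γ),
          abs_of_neg (by linarith : γ - 1 < 0), abs_of_neg (by linarith : γ - 2 < 0)]
        have g0 : 0 < γ := by linarith
        obtain ⟨a, ha⟩ : ∃ a, a = -(γ - 1) := ⟨_, rfl⟩
        obtain ⟨b, hb⟩ : ∃ b, b = -(γ - 2) := ⟨_, rfl⟩
        have ha0 : 0 ≤ a := by linarith
        have ha1 : a ≤ 1 := by linarith
        have hb0 : 0 ≤ b := by linarith
        have hb1 : b ≤ 2 := by linarith
        rw [← ha, ← hb]
        calc B * (γ * (a * (b * t ^ (γ - 3)))) ≤ 2 * F * (1 * (1 * (2 * 64))) := by gcongr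
          _ ≤ _ := by linarith)
    (dyBump_eq_zero (Or.inl le_rfl)) (dyBump_eq_zero (Or.inr le_rfl))
    (deriv_dyBump_eq_zero (Or.inl le_rfl)) (deriv_dyBump_eq_zero (Or.inr le_rfl))
  refine key.trans (le_of_eq ?_)
  have : F + |y| ≠ 0 := by positivity
  field_simp
  norm_num

lemma contDiff_bump_mul_e (γ B : ℝ) :
    ContDiff ℝ (⊤ : ℕ∞) (fun t : ℝ => (dyBump t : ℂ) * e (B * t ^ γ)) := by
  rw [contDiff_iff_contDiffAt]
  intro t
  rcases lt_or_ge t (1 / 4) with ht | ht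
  · have h : (fun t : ℝ => (dyBump t : ℂ) * e (B * t ^ γ)) =ᶠ[nhds t] fun _ => 0 := by
      filter_upwards [Iio_mem_nhds ht] with s hs
      rw [dyBump_eq_zero (Or.inl (le_of_lt hs))]
      simp
    exact contDiffAt_const.congr_of_eventuallyEq h
  · have h1 : ContDiffAt ℝ (⊤ : ℕ∞) (fun t : ℝ => B * t ^ γ) t :=
      contDiffAt_const.mul (Real.contDiffAt_rpow_const_of_ne (by linarith))
    have h2 : ContDiffAt ℝ (⊤ : ℕ∞) (fun t : ℝ => ((B * t ^ γ : ℝ) : ℂ)) t :=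
      Complex.ofRealCLM.contDiff.contDiffAt.comp t h1
    have h3 : ContDiffAt ℝ (⊤ : ℕ∞) (fun t : ℝ => ((dyBump t : ℝ) : ℂ)) t :=
      Complex.ofRealCLM.contDiff.contDiffAt.comp t dyBump_contDiff.contDiffAt
    exact h3.mul (contDiffAt_const.mul h2).cexp

lemma fourier_bump_mul_e {M : ℝ} (hM : 0 < M) (γ B : ℝ) (l : ℤ) :
    FourierTransform.fourier (fun x : ℝ => (dyBump (x / M) : ℂ) * e (B * (x / M) ^ γ)) (l : ℝ)
      = M * ∫ t in (1 / 4 : ℝ)..(5 / 4), (dyBump t : ℂ) * e (B * t ^ γ - l * M * t) := by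
  rw [Real.fourier_real_eq_integral_exp_smul]
  have h1 := MeasureTheory.Measure.integral_comp_div
    (fun t : ℝ => (dyBump t : ℂ) * e (B * t ^ γ - l * M * t)) M
  rw [abs_of_pos hM] at h1
  rw [intervalIntegral.integral_eq_integral_of_support_subset, ← Complex.real_smul, ← h1]
  · refine MeasureTheory.integral_congr_ae (Filter.Eventually.of_forall fun x => ?_)
    have hM' : (M : ℂ) ≠ 0 := by exact_mod_cast hM.ne'
    simp only
    rw [e_sub, ← e_neg, smul_eq_mul, mul_comm, mul_assoc]
    congr 2
    simp only [e]
    congr 1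
    push_cast
    field_simp
  · intro t ht
    rw [Function.mem_support] at ht
    by_contra h
    apply ht
    have : t ≤ 1 / 4 ∨ 5 / 4 ≤ t := by
      by_contra h2
      push Not at h2
      exact h ⟨h2.1, h2.2.le⟩
    rw [dyBump_eq_zero this]
    simp

/-- Poisson summation for the weighted exponential sum over `m`. -/
lemma bump_poisson {M : ℝ} (hM : 0 < M) (γ B : ℝ) :
    Summable (fun l : ℤ => (M : ℂ) *
      ∫ t in (1 / 4 : ℝ)..(5 / 4), (dyBump t : ℂ) * e (B * t ^ γ - l * M * t)) ∧
    ∑ m ∈ range ⌈2 * M⌉₊, (dyBump (m / M) : ℂ) * e (B * ((m : ℝ) / M) ^ γ)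
      = ∑' l : ℤ, (M : ℂ) *
        ∫ t in (1 / 4 : ℝ)..(5 / 4), (dyBump t : ℂ) * e (B * t ^ γ - l * M * t) := by
  set g : ℝ → ℂ := fun x => (dyBump (x / M) : ℂ) * e (B * (x / M) ^ γ) with hg
  have hsm : ContDiff ℝ (⊤ : ℕ∞) g :=
    (contDiff_bump_mul_e γ B).comp (contDiff_id.div_const M)
  have hcs : HasCompactSupport g := by
    refine HasCompactSupport.intro (isCompact_Icc (a := 0) (b := 2 * M)) fun x hx => ?_
    have : x / M ≤ 1 / 4 ∨ 5 / 4 ≤ x / M := by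
      by_contra h2
      push Not at h2
      apply hx
      rw [lt_div_iff₀ hM, div_lt_iff₀ hM] at h2
      exact ⟨by linarith, by linarith⟩
    simp only [hg]
    rw [dyBump_eq_zero this]
    simp
  set f := hcs.toSchwartzMap hsm with hf
  have hF : ∀ l : ℤ, (FourierTransform.fourier f) (l : ℝ) = (M : ℂ) *
      ∫ t in (1 / 4 : ℝ)..(5 / 4), (dyBump t : ℂ) * e (B * t ^ γ - l * M * t) := by
    intro l
    rw [← fourier_bump_mul_e hM, SchwartzMap.fourier_coe]
    rfl
  constructor
  · simp_rw [← hF]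
    exact summable_of_isBigO (Real.summable_abs_int_rpow one_lt_two)
      (((FourierTransform.fourier f).isBigO_cocompact_rpow (-2)).comp_tendsto
        Int.tendsto_coe_cofinite)
  · have h := f.tsum_eq_tsum_fourier 0
    simp only [zero_add, QuotientAddGroup.mk_zero, fourier_eval_zero, mul_one] at h
    simp_rw [← hF]
    rw [← h]
    have hv : ∀ n : ℤ, f (n : ℝ) = g n := fun n => rfl
    simp_rw [hv]
    rw [tsum_eq_sum (s := (range ⌈2 * M⌉₊).map Nat.castEmbedding)]
    · rw [sum_map]
      simp [hg]
    · intro n hn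
      have : (n : ℝ) / M ≤ 1 / 4 ∨ 5 / 4 ≤ (n : ℝ) / M := by
        by_contra h2
        push Not at h2
        apply hn
        rw [lt_div_iff₀ hM, div_lt_iff₀ hM] at h2
        have hn0 : (0 : ℝ) < n := by linarith
        have hn0' : 0 < n := by exact_mod_cast hn0
        rw [mem_map]
        refine ⟨n.toNat, ?_, by simp [hn0'.le]⟩
        rw [mem_range, Nat.lt_ceil]
        have : ((n.toNat : ℤ) : ℝ) = n := by rw [Int.toNat_of_nonneg hn0'.le]
        rw [Int.cast_natCast] at this
        rw [this]
        linarith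
      simp only [hg]
      rw [dyBump_eq_zero this]
      simp

/-- The regularising factor `1 / (1 + y ψ ^ 2)`, where `ψ` is the derivative of the
normalised phase `u ^ γ - u`. -/
noncomputable def regFactor (γ y u : ℝ) : ℝ := (1 + y * (γ * u ^ (γ - 1) - 1) ^ 2)⁻¹

/-- The amplitude produced by integrating by parts against the regularising factor. -/
noncomputable def regAmplitude (γ y t u : ℝ) : ℂ :=
  2 * Real.pi * Complex.I * ((t * dyBump (t * u) * regFactor γ y u : ℝ) : ℂ)
    - ((t * deriv dyBump (t * u) * ((γ * u ^ (γ - 1) - 1) * regFactor γ y u)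
      + dyBump (t * u) * (γ * ((γ - 1) * u ^ (γ - 2)) * regFactor γ y u
        - 2 * y * (γ * u ^ (γ - 1) - 1) ^ 2 * (γ * ((γ - 1) * u ^ (γ - 2)))
          * regFactor γ y u ^ 2) : ℝ) : ℂ)

lemma one_le_regFactor_denom {γ y : ℝ} (hy : 0 ≤ y) (u : ℝ) :
    1 ≤ 1 + y * (γ * u ^ (γ - 1) - 1) ^ 2 := by
  have : 0 ≤ y * (γ * u ^ (γ - 1) - 1) ^ 2 := by positivity
  linarith

lemma regFactor_pos {γ y : ℝ} (hy : 0 ≤ y) (u : ℝ) : 0 < regFactor γ y u :=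
  inv_pos.2 (by linarith [one_le_regFactor_denom (γ := γ) hy u])

lemma hasDerivAt_rpow_sub_id (γ : ℝ) {u : ℝ} (hu : 0 < u) :
    HasDerivAt (fun u : ℝ => u ^ γ - u) (γ * u ^ (γ - 1) - 1) u :=
  (Real.hasDerivAt_rpow_const (Or.inl hu.ne')).sub (hasDerivAt_id u)

lemma hasDerivAt_mul_rpow_sub_one (γ : ℝ) {u : ℝ} (hu : 0 < u) :
    HasDerivAt (fun u : ℝ => γ * u ^ (γ - 1) - 1) (γ * ((γ - 1) * u ^ (γ - 2))) u :=
  (((Real.hasDerivAt_rpow_const (p := γ - 1) (Or.inl hu.ne')).const_mul γ).sub_const 1).congr_deriv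
    (by ring_nf)

lemma hasDerivAt_mul_regFactor {γ y u : ℝ} (hy : 0 ≤ y) (hu : 0 < u) :
    HasDerivAt (fun u : ℝ => (γ * u ^ (γ - 1) - 1) * regFactor γ y u)
      (γ * ((γ - 1) * u ^ (γ - 2)) * regFactor γ y u
        - 2 * y * (γ * u ^ (γ - 1) - 1) ^ 2 * (γ * ((γ - 1) * u ^ (γ - 2)))
          * regFactor γ y u ^ 2) u := by
  have h := hasDerivAt_mul_rpow_sub_one γ hu
  have hne := (lt_of_lt_of_le one_pos (one_le_regFactor_denom (γ := γ) hy u)).ne'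
  have hR : HasDerivAt (fun u : ℝ => regFactor γ y u)
      (-(2 * y * (γ * u ^ (γ - 1) - 1) * (γ * ((γ - 1) * u ^ (γ - 2)))) * regFactor γ y u ^ 2) u :=
    ((((h.pow 2).const_mul y).const_add 1).inv hne).congr_deriv (by
      simp only [regFactor, Pi.pow_apply, div_eq_mul_inv, inv_pow]
      simp only [Nat.cast_ofNat, Nat.add_one_sub_one, pow_one]
      ring)
  exact (h.mul hR).congr_deriv (by ring)

lemma continuousOn_rpow_pos (a : ℝ) : ContinuousOn (fun u : ℝ => u ^ a) (Set.Ioi 0) :=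
  fun _ hu => (Real.continuousAt_rpow_const _ _ (Or.inl (ne_of_gt hu))).continuousWithinAt

lemma continuousOn_regFactor {γ y : ℝ} (hy : 0 ≤ y) :
    ContinuousOn (fun u : ℝ => regFactor γ y u) (Set.Ioi 0) := by
  have h := continuousOn_rpow_pos (γ - 1)
  refine ContinuousOn.inv₀ (by fun_prop) fun u _ => ?_
  exact (lt_of_lt_of_le one_pos (one_le_regFactor_denom (γ := γ) hy u)).ne'

lemma bump_integral_eq_reg {γ y t ua ub : ℝ} (hy : 0 ≤ y) (ht : 0 < t)
    (hua : 0 < ua) (hub : ua ≤ ub) (h1 : t * ua ≤ 1 / 4) (h2 : 5 / 4 ≤ t * ub) :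
    2 * Real.pi * Complex.I *
      ∫ s in (1 / 4 : ℝ)..(5 / 4), (dyBump s : ℂ) * e (y * t ^ (1 - γ) * s ^ γ - y * s)
      = ∫ u in ua..ub, regAmplitude γ y t u * e (y * t * (u ^ γ - u)) := by
  set f : ℝ → ℂ := fun s => (dyBump s : ℂ) * e (y * t ^ (1 - γ) * s ^ γ - y * s) with hf
  have hsupp : Function.support f ⊆ Set.Ioc (1 / 4) (5 / 4) := by
    intro s hs
    rw [Function.mem_support] at hs
    by_contra h
    apply hs
    have : s ≤ 1 / 4 ∨ 5 / 4 ≤ s := by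
      by_contra h2
      push Not at h2
      exact h ⟨h2.1, h2.2.le⟩
    simp only [hf]
    rw [dyBump_eq_zero this]
    simp
  have hI : ∫ s in (1 / 4 : ℝ)..(5 / 4), f s = ∫ s in (t * ua)..(t * ub), f s := by
    rw [intervalIntegral.integral_eq_integral_of_support_subset hsupp,
      intervalIntegral.integral_eq_integral_of_support_subset
        (hsupp.trans (Set.Ioc_subset_Ioc h1 h2))]
  have hpos : ∀ u ∈ Set.Icc ua ub, 0 < u := fun u hu => hua.trans_le hu.1
  have hsub : Set.Icc ua ub ⊆ Set.Ioi 0 := hpos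
  have hmul : ∀ u ∈ Set.Icc ua ub,
      f (t * u) = (dyBump (t * u) : ℂ) * e (y * t * (u ^ γ - u)) := by
    intro u hu
    simp only [hf]
    congr 2
    rw [Real.mul_rpow ht.le (hpos u hu).le]
    have : t ^ (1 - γ) * t ^ γ = t := by rw [← Real.rpow_add ht]; simp
    linear_combination y * u ^ γ * this
  have hsc := intervalIntegral.integral_comp_mul_left (a := ua) (b := ub) f ht.ne'
  rw [hI, ← intervalIntegral.integral_const_mul]
  have hsc' : ∫ s in (t * ua)..(t * ub), f s = (t : ℂ) * ∫ u in ua..ub, f (t * u) := by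
    rw [hsc, Complex.real_smul, ← mul_assoc]
    push_cast
    rw [mul_inv_cancel₀ (by exact_mod_cast ht.ne'), one_mul]
  rw [intervalIntegral.integral_const_mul, hsc']
  have dbump : ∀ u : ℝ, HasDerivAt (fun u : ℝ => dyBump (t * u)) (deriv dyBump (t * u) * t) u :=
    fun u => (hasDerivAt_dyBump (t * u)).comp u
      (((hasDerivAt_id u).const_mul t).congr_deriv (mul_one t))
  have c0 : Continuous (fun u : ℝ => dyBump (t * u)) :=
    dyBump.continuous.comp (continuous_const.mul continuous_id)
  have c1 : Continuous (fun u : ℝ => deriv dyBump (t * u)) :=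
    continuous_deriv_dyBump.comp (continuous_const.mul continuous_id)
  have r1 := (continuousOn_rpow_pos (γ - 1)).mono hsub
  have r2 := (continuousOn_rpow_pos (γ - 2)).mono hsub
  have r0 := (continuousOn_rpow_pos γ).mono hsub
  have rR := (continuousOn_regFactor (γ := γ) hy).mono hsub
  have gen1 : ∀ p p' : ℝ → ℝ, Continuous p → Continuous p' → ContinuousOn (fun u : ℝ =>
      t * p' u * ((γ * u ^ (γ - 1) - 1) * regFactor γ y u)
      + p u * (γ * ((γ - 1) * u ^ (γ - 2)) * regFactor γ y u
        - 2 * y * (γ * u ^ (γ - 1) - 1) ^ 2 * (γ * ((γ - 1) * u ^ (γ - 2)))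
          * regFactor γ y u ^ 2)) (Set.Icc ua ub) := fun p p' hp hp' => by fun_prop
  have gen2 : ∀ p : ℝ → ℝ, Continuous p → ContinuousOn (fun u : ℝ =>
      t * p u * regFactor γ y u) (Set.Icc ua ub) := fun p hp => by fun_prop
  have gen3 : ∀ p : ℝ → ℝ, Continuous p → ContinuousOn (fun u : ℝ =>
      p u * ((γ * u ^ (γ - 1) - 1) * regFactor γ y u)
        * (y * t * (γ * u ^ (γ - 1) - 1))) (Set.Icc ua ub) := fun p hp => by fun_prop
  have cA : ContinuousOn (fun u : ℝ =>
      t * deriv dyBump (t * u) * ((γ * u ^ (γ - 1) - 1) * regFactor γ y u)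
      + dyBump (t * u) * (γ * ((γ - 1) * u ^ (γ - 2)) * regFactor γ y u
        - 2 * y * (γ * u ^ (γ - 1) - 1) ^ 2 * (γ * ((γ - 1) * u ^ (γ - 2)))
          * regFactor γ y u ^ 2)) (Set.Icc ua ub) := by
    exact gen1 _ _ c0 c1
  have key := integral_mul_deriv_e
    (a := fun u => dyBump (t * u) * ((γ * u ^ (γ - 1) - 1) * regFactor γ y u))
    (ψ := fun u => y * t * (u ^ γ - u))
    (ψ' := fun u => y * t * (γ * u ^ (γ - 1) - 1)) hub
    (fun u hu => ((dbump u).mul (hasDerivAt_mul_regFactor (γ := γ) hy (hpos u hu))).congr_deriv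
      (show _ = t * deriv dyBump (t * u) * ((γ * u ^ (γ - 1) - 1) * regFactor γ y u)
      + dyBump (t * u) * (γ * ((γ - 1) * u ^ (γ - 2)) * regFactor γ y u
        - 2 * y * (γ * u ^ (γ - 1) - 1) ^ 2 * (γ * ((γ - 1) * u ^ (γ - 2)))
          * regFactor γ y u ^ 2) by ring)) cA
    (fun u hu => (hasDerivAt_rpow_sub_id γ (hpos u hu)).const_mul (y * t))
    (by fun_prop)
    (by simp [dyBump_eq_zero (Or.inl h1)]) (by simp [dyBump_eq_zero (Or.inr h2)])
  have cE : ContinuousOn (fun u : ℝ => e (y * t * (u ^ γ - u))) (Set.Icc ua ub) :=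
    continuous_e.comp_continuousOn (by fun_prop)
  have co : ∀ {g : ℝ → ℝ}, ContinuousOn g (Set.Icc ua ub) →
      IntervalIntegrable (fun u => (g u : ℂ) * e (y * t * (u ^ γ - u)))
        MeasureTheory.volume ua ub := fun {g} hg => by
    apply ContinuousOn.intervalIntegrable
    rw [Set.uIcc_of_le hub]
    exact (Complex.continuous_ofReal.comp_continuousOn hg).mul cE
  have i1 := co (g := fun u => t * dyBump (t * u) * regFactor γ y u) (gen2 _ c0)
  have i2 := co (g := fun u => dyBump (t * u) * ((γ * u ^ (γ - 1) - 1) * regFactor γ y u)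
    * (y * t * (γ * u ^ (γ - 1) - 1))) (gen3 _ c0)
  have i3 := co cA
  have e1 : (t : ℂ) * ∫ u in ua..ub, f (t * u)
      = (∫ u in ua..ub, ((t * dyBump (t * u) * regFactor γ y u : ℝ) : ℂ)
          * e (y * t * (u ^ γ - u)))
        + ∫ u in ua..ub, ((dyBump (t * u) * ((γ * u ^ (γ - 1) - 1) * regFactor γ y u)
          * (y * t * (γ * u ^ (γ - 1) - 1)) : ℝ) : ℂ) * e (y * t * (u ^ γ - u)) := by
    rw [← intervalIntegral.integral_add i1 i2, ← intervalIntegral.integral_const_mul]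
    refine intervalIntegral.integral_congr fun u hu => ?_
    rw [Set.uIcc_of_le hub] at hu
    rw [hmul u hu, ← add_mul, ← mul_assoc]
    congr 1
    norm_cast
    have hne := (lt_of_lt_of_le one_pos (one_le_regFactor_denom (γ := γ) hy u)).ne'
    simp only [regFactor]
    field_simp
  rw [e1, mul_add, key, ← intervalIntegral.integral_const_mul, ← sub_eq_add_neg,
    ← intervalIntegral.integral_sub (i1.const_mul _) i3]
  refine intervalIntegral.integral_congr fun u _ => ?_
  simp only [regAmplitude]
  ring

lemma abs_sub_le_of_deriv_bound {f f' : ℝ → ℝ} {W : ℝ} (hf : ∀ t, HasDerivAt f (f' t) t)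
    (hW : ∀ t, |f' t| ≤ W) (a b : ℝ) : |f a - f b| ≤ W * |a - b| := by
  have := Convex.norm_image_sub_le_of_norm_hasDerivWithin_le (s := Set.univ) (x := b) (y := a)
    (fun t _ => (hf t).hasDerivWithinAt) (fun t _ => hW t) convex_univ (Set.mem_univ _)
    (Set.mem_univ _)
  simpa [Real.norm_eq_abs] using this

/-- Linear combination of the three building blocks of `regAmplitude`. -/
lemma norm_reg_combination_le {γ y u p q w K₁ K₂ : ℝ} (hy : 0 ≤ y)
    (h1 : |γ * u ^ (γ - 1) - 1| ≤ K₁) (h2 : |γ * ((γ - 1) * u ^ (γ - 2))| ≤ K₂) :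
    ‖2 * Real.pi * Complex.I * ((p * regFactor γ y u : ℝ) : ℂ)
      - ((q * ((γ * u ^ (γ - 1) - 1) * regFactor γ y u)
        + w * (γ * ((γ - 1) * u ^ (γ - 2)) * regFactor γ y u
          - 2 * y * (γ * u ^ (γ - 1) - 1) ^ 2 * (γ * ((γ - 1) * u ^ (γ - 2)))
            * regFactor γ y u ^ 2) : ℝ) : ℂ)‖
      ≤ (7 * |p| + |q| * K₁ + |w| * (3 * K₂)) * regFactor γ y u := by
  have hR := regFactor_pos (γ := γ) hy u
  have hyR : y * (γ * u ^ (γ - 1) - 1) ^ 2 * regFactor γ y u ≤ 1 := by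
    have := one_le_regFactor_denom (γ := γ) hy u
    rw [regFactor, ← div_eq_mul_inv, div_le_one (by linarith)]
    linarith
  have hyR0 : 0 ≤ y * (γ * u ^ (γ - 1) - 1) ^ 2 * regFactor γ y u := by positivity
  set R := regFactor γ y u
  set a := γ * u ^ (γ - 1) - 1
  set b := γ * ((γ - 1) * u ^ (γ - 2))
  have hb : |b * R - 2 * y * a ^ 2 * b * R ^ 2| ≤ 3 * K₂ * R := by
    rw [show b * R - 2 * y * a ^ 2 * b * R ^ 2 = (1 - 2 * (y * a ^ 2 * R)) * (b * R) by ring,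
      abs_mul, abs_mul, abs_of_pos hR]
    have : |1 - 2 * (y * a ^ 2 * R)| ≤ 3 := by
      rw [abs_le]; constructor <;> linarith
    calc |1 - 2 * (y * a ^ 2 * R)| * (|b| * R) ≤ 3 * (K₂ * R) := by gcongr
      _ = _ := by ring
  refine (norm_sub_le _ _).trans ?_
  rw [norm_mul, norm_two_pi_I, Complex.norm_real, Complex.norm_real, Real.norm_eq_abs,
    Real.norm_eq_abs, abs_mul, abs_of_pos hR]
  have hπ : 2 * Real.pi ≤ 7 := by linarith [Real.pi_lt_d2]
  have hq : |q * (a * R) + w * (b * R - 2 * y * a ^ 2 * b * R ^ 2)|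
      ≤ |q| * (K₁ * R) + |w| * (3 * K₂ * R) := by
    refine (abs_add_le _ _).trans ?_
    rw [abs_mul q, abs_mul a R, abs_mul w, abs_of_pos hR]
    gcongr
  calc _ ≤ 7 * (|p| * R) + (|q| * (K₁ * R) + |w| * (3 * K₂ * R)) := by gcongr
    _ = _ := by ring

lemma exists_regAmplitude_bound {γ ua ub T : ℝ} (hua : 0 < ua) (hub : ua ≤ ub) (hT : 0 < T) :
    ∃ C : ℝ, 0 < C ∧ ∀ y u t t' : ℝ, 0 ≤ y → u ∈ Set.Icc ua ub → t ∈ Set.Icc 0 T →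
      t' ∈ Set.Icc 0 T →
      ‖regAmplitude γ y t u‖ ≤ C * regFactor γ y u ∧
      ‖regAmplitude γ y t u - regAmplitude γ y t' u‖ ≤ C * regFactor γ y u * |t - t'| := by
  obtain ⟨W, hW1, hW⟩ := exists_dyBump_bound
  have hsub : Set.Icc ua ub ⊆ Set.Ioi 0 := fun u hu => hua.trans_le hu.1
  have r1 := (continuousOn_rpow_pos (γ - 1)).mono hsub
  have r2 := (continuousOn_rpow_pos (γ - 2)).mono hsub
  obtain ⟨K₁, hK₁⟩ := isCompact_Icc.exists_bound_of_continuousOn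
    (show ContinuousOn (fun u : ℝ => γ * u ^ (γ - 1) - 1) (Set.Icc ua ub) by fun_prop)
  obtain ⟨K₂, hK₂⟩ := isCompact_Icc.exists_bound_of_continuousOn
    (show ContinuousOn (fun u : ℝ => γ * ((γ - 1) * u ^ (γ - 2))) (Set.Icc ua ub) by fun_prop)
  have hK₁0 : 0 ≤ K₁ := (norm_nonneg _).trans (hK₁ ua ⟨le_rfl, hub⟩)
  have hK₂0 : 0 ≤ K₂ := (norm_nonneg _).trans (hK₂ ua ⟨le_rfl, hub⟩)
  have hub0 : 0 < ub := hua.trans_le hub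
  have hW0 : 0 < W := by linarith
  refine ⟨7 * (W + T * W + T * (W * ub)) + (W + T * W + T * (W * ub)) * K₁
    + (W + W * ub) * (3 * K₂), by positivity, fun y u t t' hy hu ht ht' => ?_⟩
  have hR := regFactor_pos (γ := γ) hy u
  have k1 := hK₁ u hu
  have k2 := hK₂ u hu
  rw [Real.norm_eq_abs] at k1 k2
  have hu0 : 0 < u := hsub hu
  have tri : ∀ {f : ℝ → ℝ}, (∀ x, |f x| ≤ W) → (∀ a b, |f a - f b| ≤ W * |a - b|) →
      |f (t * u) - f (t' * u)| ≤ W * ub * |t - t'| ∧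
      |t * f (t * u)| ≤ T * W ∧
      |t * f (t * u) - t' * f (t' * u)| ≤ (W + T * (W * ub)) * |t - t'| := by
    intro f hf hf'
    have a1 : |f (t * u) - f (t' * u)| ≤ W * ub * |t - t'| := by
      refine (hf' _ _).trans ?_
      rw [← sub_mul, abs_mul, abs_of_pos hu0]
      calc W * (|t - t'| * u) ≤ W * (|t - t'| * ub) := by gcongr; exact hu.2
        _ = _ := by ring
    refine ⟨a1, ?_, ?_⟩
    · rw [abs_mul, abs_of_nonneg ht.1]
      gcongr
      · exact ht.2
      · exact hf _
    · rw [show t * f (t * u) - t' * f (t' * u)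
        = (t - t') * f (t * u) + t' * (f (t * u) - f (t' * u)) by ring]
      refine (abs_add_le _ _).trans ?_
      rw [abs_mul, abs_mul, abs_of_nonneg ht'.1]
      calc |t - t'| * |f (t * u)| + t' * |f (t * u) - f (t' * u)|
          ≤ |t - t'| * W + T * (W * ub * |t - t'|) := by
            gcongr
            · exact hf _
            · exact ht'.2
        _ = _ := by ring
  obtain ⟨w1, w2, w3⟩ := tri (f := dyBump) (fun x => (hW x).1)
    (abs_sub_le_of_deriv_bound hasDerivAt_dyBump fun x => (hW x).2.1)
  obtain ⟨_, v2, v3⟩ := tri (f := deriv dyBump) (fun x => (hW x).2.1)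
    (abs_sub_le_of_deriv_bound hasDerivAt_deriv_dyBump fun x => (hW x).2.2)
  have p1 : 0 ≤ T * W := by positivity
  have p2 : 0 ≤ T * (W * ub) := by positivity
  have p3 : 0 ≤ W * ub := by positivity
  constructor
  · refine (norm_reg_combination_le hy k1 k2).trans ?_
    gcongr
    · linarith
    · linarith
    · exact (hW _).1.trans (by linarith)
  · have e1 : regAmplitude γ y t u - regAmplitude γ y t' u =
      2 * Real.pi * Complex.I *
        (((t * dyBump (t * u) - t' * dyBump (t' * u)) * regFactor γ y u : ℝ) : ℂ)
      - (((t * deriv dyBump (t * u) - t' * deriv dyBump (t' * u))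
          * ((γ * u ^ (γ - 1) - 1) * regFactor γ y u)
        + (dyBump (t * u) - dyBump (t' * u)) * (γ * ((γ - 1) * u ^ (γ - 2)) * regFactor γ y u
          - 2 * y * (γ * u ^ (γ - 1) - 1) ^ 2 * (γ * ((γ - 1) * u ^ (γ - 2)))
            * regFactor γ y u ^ 2) : ℝ) : ℂ) := by
      simp only [regAmplitude]
      push_cast
      ring
    rw [e1]
    refine (norm_reg_combination_le hy k1 k2).trans ?_
    have s0 := abs_nonneg (t - t')
    calc _ ≤ (7 * ((W + T * (W * ub)) * |t - t'|) + (W + T * (W * ub)) * |t - t'| * K₁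
          + W * ub * |t - t'| * (3 * K₂)) * regFactor γ y u := by gcongr
      _ = (7 * (W + T * (W * ub)) + (W + T * (W * ub)) * K₁
          + W * ub * (3 * K₂)) * regFactor γ y u * |t - t'| := by ring
      _ ≤ _ := by
          gcongr <;> linarith

lemma exists_integral_regFactor_le {γ ua ub : ℝ} (hγ : 0 < γ) (hγ1 : γ < 1) (hua : 0 < ua)
    (hub : ua ≤ ub) :
    ∃ C : ℝ, 0 < C ∧ ∀ y : ℝ, 0 < y → ∫ u in ua..ub, regFactor γ y u ≤ C / √y := by
  have hub0 : 0 < ub := hua.trans_le hub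
  have hsub : Set.Icc ua ub ⊆ Set.Ioi 0 := fun u hu => hua.trans_le hu.1
  have r1 := (continuousOn_rpow_pos (γ - 1)).mono hsub
  have r2 := (continuousOn_rpow_pos (γ - 2)).mono hsub
  set k := γ * (1 - γ) * ub ^ (γ - 2) with hk
  have hk0 : 0 < k := by
    have : 0 < 1 - γ := by linarith
    positivity
  refine ⟨Real.pi / k, by positivity, fun y hy => ?_⟩
  have hs : 0 < √y := Real.sqrt_pos.2 hy
  have rR := (continuousOn_regFactor (γ := γ) hy.le).mono hsub
  have hd : ∀ u ∈ Set.uIcc ua ub, HasDerivAt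
      (fun u : ℝ => -(k * √y)⁻¹ * Real.arctan (√y * (γ * u ^ (γ - 1) - 1)))
      (k⁻¹ * (γ * ((1 - γ) * u ^ (γ - 2))) * regFactor γ y u) u := by
    intro u hu
    rw [Set.uIcc_of_le hub] at hu
    refine ((((hasDerivAt_mul_rpow_sub_one γ (hsub hu)).const_mul √y).arctan).const_mul
      (-(k * √y)⁻¹)).congr_deriv ?_
    have hne := (lt_of_lt_of_le one_pos (one_le_regFactor_denom (γ := γ) hy.le u)).ne'
    rw [mul_pow, Real.sq_sqrt hy.le, regFactor]
    field_simp
    ring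
  have hcont : ContinuousOn (fun u : ℝ => k⁻¹ * (γ * ((1 - γ) * u ^ (γ - 2))) * regFactor γ y u)
      (Set.Icc ua ub) := by fun_prop
  have hInt := hcont.intervalIntegrable_of_Icc (μ := MeasureTheory.volume) hub
  calc ∫ u in ua..ub, regFactor γ y u
      ≤ ∫ u in ua..ub, k⁻¹ * (γ * ((1 - γ) * u ^ (γ - 2))) * regFactor γ y u := by
        refine intervalIntegral.integral_mono_on hub (rR.intervalIntegrable_of_Icc hub) hInt ?_
        intro u hu
        have hR := regFactor_pos (γ := γ) hy.le u
        have : k ≤ γ * ((1 - γ) * u ^ (γ - 2)) := by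
          have h3 : ub ^ (γ - 2) ≤ u ^ (γ - 2) :=
            Real.rpow_le_rpow_of_nonpos (hsub hu) hu.2 (by linarith)
          have h4 : 0 < 1 - γ := by linarith
          rw [hk, mul_assoc]
          gcongr
        have h1 : 1 ≤ k⁻¹ * (γ * ((1 - γ) * u ^ (γ - 2))) := by
          rw [inv_mul_eq_div, one_le_div hk0]
          exact this
        nlinarith only [h1, hR]
    _ ≤ Real.pi / k / √y := by
        rw [intervalIntegral.integral_eq_sub_of_hasDerivAt hd hInt]
        have a1 := Real.arctan_lt_pi_div_two (√y * (γ * ua ^ (γ - 1) - 1))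
        have a2 := Real.neg_pi_div_two_lt_arctan (√y * (γ * ub ^ (γ - 1) - 1))
        have h0 : 0 < (k * √y)⁻¹ := by positivity
        rw [div_div, div_eq_mul_inv]
        nlinarith only [a1, a2, h0]

lemma continuousOn_regAmplitude {γ y t ua ub : ℝ} (hy : 0 ≤ y) (hua : 0 < ua) :
    ContinuousOn (fun u => regAmplitude γ y t u) (Set.Icc ua ub) := by
  have hsub : Set.Icc ua ub ⊆ Set.Ioi 0 := fun u hu => hua.trans_le hu.1
  have c0 : Continuous (fun u : ℝ => dyBump (t * u)) :=
    dyBump.continuous.comp (continuous_const.mul continuous_id)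
  have c1 : Continuous (fun u : ℝ => deriv dyBump (t * u)) :=
    continuous_deriv_dyBump.comp (continuous_const.mul continuous_id)
  have r1 := (continuousOn_rpow_pos (γ - 1)).mono hsub
  have r2 := (continuousOn_rpow_pos (γ - 2)).mono hsub
  have rR := (continuousOn_regFactor (γ := γ) hy).mono hsub
  have gen1 : ∀ p p' : ℝ → ℝ, Continuous p → Continuous p' → ContinuousOn (fun u : ℝ =>
      t * p' u * ((γ * u ^ (γ - 1) - 1) * regFactor γ y u)
      + p u * (γ * ((γ - 1) * u ^ (γ - 2)) * regFactor γ y u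
        - 2 * y * (γ * u ^ (γ - 1) - 1) ^ 2 * (γ * ((γ - 1) * u ^ (γ - 2)))
          * regFactor γ y u ^ 2)) (Set.Icc ua ub) := fun p p' hp hp' => by fun_prop
  have gen2 : ∀ p : ℝ → ℝ, Continuous p → ContinuousOn (fun u : ℝ =>
      t * p u * regFactor γ y u) (Set.Icc ua ub) := fun p hp => by fun_prop
  exact (continuousOn_const.mul (Complex.continuous_ofReal.comp_continuousOn (gen2 _ c0))).sub
    (Complex.continuous_ofReal.comp_continuousOn (gen1 _ _ c0 c1))

lemma powInc_size {γ q x N : ℝ} (hγ : 8 / 9 < γ) (hγ1 : γ < 1) (hq : 0 < q) (hN : 0 < N)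
    (hqx : q ≤ x) (h1 : N / 2 ≤ x) (h2 : x ≤ 2 * N) :
    q * N ^ (γ - 1) / 2 ≤ powInc γ q x ∧ powInc γ q x ≤ 2 * (q * N ^ (γ - 1)) := by
  have hx : 0 < x := by linarith
  have hNp : 0 < N ^ (γ - 1) := Real.rpow_pos_of_pos hN _
  obtain ⟨b1, b2⟩ := powInc_bounds (by linarith) hγ1 hq.le hx
  constructor
  · refine le_trans ?_ b1
    have h4 : (3 / 4 : ℝ) ≤ 4 ^ (γ - 1) := by
      have h := rpow_one_add_le_one_add_mul_self (s := 3) (p := 1 - γ) (by norm_num)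
        (by linarith) (by linarith)
      have h' : (4 : ℝ) ^ (1 - γ) ≤ 4 / 3 := by
        rw [show (1 : ℝ) + 3 = 4 by norm_num] at h
        linarith
      rw [show γ - 1 = -(1 - γ) by ring, Real.rpow_neg (by norm_num)]
      rw [show (3 / 4 : ℝ) = (4 / 3)⁻¹ by norm_num]
      exact inv_anti₀ (by positivity) h'
    have h5 : 4 ^ (γ - 1) * N ^ (γ - 1) ≤ (x + q) ^ (γ - 1) := by
      rw [← Real.mul_rpow (by norm_num) hN.le]
      exact Real.rpow_le_rpow_of_nonpos (by linarith) (by linarith) (by linarith)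
    calc q * N ^ (γ - 1) / 2 ≤ 8 / 9 * q * (3 / 4 * N ^ (γ - 1)) := by
          have : 0 < q * N ^ (γ - 1) := by positivity
          linarith
      _ ≤ γ * q * (4 ^ (γ - 1) * N ^ (γ - 1)) := by gcongr
      _ ≤ _ := by gcongr
  · refine b2.trans ?_
    have h4 : (1 / 2 : ℝ) ^ (γ - 1) ≤ 2 := by
      calc (1 / 2 : ℝ) ^ (γ - 1) ≤ (1 / 2 : ℝ) ^ (-1 : ℝ) :=
            Real.rpow_le_rpow_of_exponent_ge (by norm_num) (by norm_num) (by linarith)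
        _ = 2 := by rw [Real.rpow_neg_one]; norm_num
    have h5 : x ^ (γ - 1) ≤ (1 / 2 : ℝ) ^ (γ - 1) * N ^ (γ - 1) := by
      rw [← Real.mul_rpow (by norm_num) hN.le]
      exact Real.rpow_le_rpow_of_nonpos (by linarith) (by linarith) (by linarith)
    calc γ * q * x ^ (γ - 1) ≤ 1 * q * (2 * N ^ (γ - 1)) := by
          gcongr
          exact h5.trans (by gcongr)
      _ = _ := by ring

lemma powInc_antitone {γ q x x' : ℝ} (hγ : 0 < γ) (hγ1 : γ < 1) (hq : 0 ≤ q) (hx : 0 < x)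
    (hxx : x ≤ x') : powInc γ q x' ≤ powInc γ q x := by
  have hanti : AntitoneOn (powInc γ q) (Set.Ici x) := by
    refine antitoneOn_of_hasDerivWithinAt_nonpos (f' := fun x => γ * powInc (γ - 1) q x)
      (convex_Ici x)
      (fun s hs => (hasDerivAt_powInc γ hq (hx.trans_le hs)).continuousAt.continuousWithinAt)
      (fun s hs => ?_) fun s hs => ?_
    all_goals rw [interior_Ici] at hs
    · exact (hasDerivAt_powInc γ hq (hx.trans hs)).hasDerivWithinAt
    · have hs0 : 0 < s := hx.trans hs
      have : powInc (γ - 1) q s ≤ 0 :=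
        sub_nonpos.2 (Real.rpow_le_rpow_of_nonpos hs0 (by linarith) (by linarith))
      exact mul_nonpos_of_nonneg_of_nonpos hγ.le this
  exact hanti (Set.mem_Ici.2 le_rfl) hxx hxx

/-- The phase `u^γ - u` and its derivative do not vanish simultaneously. -/
lemma exists_phase_lower_bound {γ ua ub : ℝ} (hγ1 : γ < 1) (hua : 0 < ua) (hub : ua ≤ ub) :
    ∃ c : ℝ, 0 < c ∧ ∀ u ∈ Set.Icc ua ub, c ≤ |u ^ γ - u| ∨ c ≤ |γ * u ^ (γ - 1) - 1| := by
  have hsub : Set.Icc ua ub ⊆ Set.Ioi 0 := fun u hu => hua.trans_le hu.1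
  have r1 := (continuousOn_rpow_pos (γ - 1)).mono hsub
  have r0 := (continuousOn_rpow_pos γ).mono hsub
  have hc : ContinuousOn (fun u : ℝ => |u ^ γ - u| + |γ * u ^ (γ - 1) - 1|) (Set.Icc ua ub) := by
    fun_prop
  obtain ⟨v, hv, hmin⟩ := isCompact_Icc.exists_isMinOn ⟨ua, le_rfl, hub⟩ hc
  have hpos : 0 < |v ^ γ - v| + |γ * v ^ (γ - 1) - 1| := by
    have hv0 : 0 < v := hsub hv
    by_contra h
    have a1 := abs_nonneg (v ^ γ - v)
    have a2 := abs_nonneg (γ * v ^ (γ - 1) - 1)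
    have h1 : |v ^ γ - v| = 0 := by linarith
    have h2 : |γ * v ^ (γ - 1) - 1| = 0 := by linarith
    rw [abs_eq_zero] at h1 h2
    rw [Real.rpow_sub_one hv0.ne', show v ^ γ = v by linarith, div_self hv0.ne'] at h2
    linarith
  refine ⟨(|v ^ γ - v| + |γ * v ^ (γ - 1) - 1|) / 2, by positivity, fun u hu => ?_⟩
  have := isMinOn_iff.1 hmin u hu
  by_contra h
  push Not at h
  linarith [h.1, h.2]

/-- Amplitude-weighted exponential sum at a fixed point `u` of the regularised integral. -/
lemma norm_sum_regAmplitude_le {γ y C Z T u : ℝ} {t : ℕ → ℝ} {z : ℕ → ℂ} {L : ℕ}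
    (hy : 0 ≤ y) (hC : 0 < C) (hT : 0 < T)
    (hamp : ∀ s s' : ℝ, s ∈ Set.Icc 0 T → s' ∈ Set.Icc 0 T →
      ‖regAmplitude γ y s u‖ ≤ C * regFactor γ y u ∧
      ‖regAmplitude γ y s u - regAmplitude γ y s' u‖ ≤ C * regFactor γ y u * |s - s'|)
    (ht : ∀ n, n < L → t n ∈ Set.Icc 0 T) (hanti : ∀ n, t (n + 1) ≤ t n)
    (hZ : ∀ l ≤ L, ‖∑ n ∈ range l, z n‖ ≤ Z) :
    ‖∑ n ∈ range L, regAmplitude γ y (t n) u * z n‖ ≤ C * (1 + T) * regFactor γ y u * Z := by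
  have hR := regFactor_pos (γ := γ) hy u
  have h := norm_sum_mul_le_of_variation (fun n => regAmplitude γ y (t n) u) z L
    (A := C * regFactor γ y u) (B := C * regFactor γ y u * T) (by positivity)
    (fun n hn => (hamp _ _ (ht n hn) (ht n hn)).1) ?_ hZ
  · refine h.trans (le_of_eq (by ring))
  · rcases Nat.eq_zero_or_pos L with rfl | hL
    · simp only [zero_tsub, range_zero, sum_empty]; positivity
    calc ∑ n ∈ range (L - 1), ‖regAmplitude γ y (t (n + 1)) u - regAmplitude γ y (t n) u‖
        ≤ ∑ n ∈ range (L - 1), C * regFactor γ y u * (t n - t (n + 1)) := by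
          refine sum_le_sum fun n hn => ?_
          rw [mem_range] at hn
          refine ((hamp _ _ (ht (n + 1) (by omega)) (ht n (by omega))).2).trans (le_of_eq ?_)
          rw [abs_sub_comm, abs_of_nonneg (by linarith [hanti n])]
      _ = C * regFactor γ y u * (t 0 - t (L - 1)) := by
          rw [← mul_sum, sum_range_sub']
      _ ≤ _ := by
          gcongr
          linarith [(ht 0 hL).2, (ht (L - 1) (by omega)).1]

lemma exists_near_frequency_bound {γ : ℝ} (hγ : 8 / 9 < γ) (hγ1 : γ < 1) :
    ∃ K : ℝ, 0 < K ∧ ∀ (b N q x y ν : ℝ) (L : ℕ), 0 < b → 0 < N → 0 < q → q ≤ x → N / 2 ≤ x →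
      x + L + 3 ≤ 2 * N → 0 < ν → ν ^ 6 * N ^ 3 = y →
      b * (q * N ^ (γ - 1)) / 10 ≤ y → y ≤ 8 * (b * (q * N ^ (γ - 1))) →
      ‖∑ n ∈ range L, ∫ s in (1 / 4 : ℝ)..(5 / 4),
        (dyBump s : ℂ) * e (b * powInc γ q (x + n) * s ^ γ - y * s)‖
        ≤ K * ((L * ν + √L / ν) / √y + L / y) := by
  set κ : ℝ := (1 - γ)⁻¹ with hκ
  have hκ0 : 0 < κ := inv_pos.2 (by linarith)
  set τlo : ℝ := (1 / 16) ^ κ with hτlo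
  set τhi : ℝ := 20 ^ κ with hτhi
  have hlo0 : 0 < τlo := Real.rpow_pos_of_pos (by norm_num) _
  have hhi0 : 0 < τhi := Real.rpow_pos_of_pos (by norm_num) _
  have hlohi : τlo ≤ τhi := Real.rpow_le_rpow (by norm_num) (by norm_num) hκ0.le
  set ua : ℝ := 1 / 4 / τhi with hua
  set ub : ℝ := 5 / 4 / τlo with hub
  have hua0 : 0 < ua := by positivity
  have huab : ua ≤ ub := by rw [hua, hub]; gcongr; norm_num
  have hsub : Set.Icc ua ub ⊆ Set.Ioi 0 := fun u hu => hua0.trans_le hu.1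
  obtain ⟨c, hc0, hc⟩ := exists_phase_lower_bound hγ1 hua0 huab
  obtain ⟨C₁, hC₁0, hamp⟩ := exists_regAmplitude_bound (γ := γ) hua0 huab hhi0
  obtain ⟨C₂, hC₂0, hInt⟩ := exists_integral_regFactor_le (by linarith) hγ1 hua0 huab
  have r0 := (continuousOn_rpow_pos γ).mono hsub
  obtain ⟨P, hP⟩ := isCompact_Icc.exists_bound_of_continuousOn
    (show ContinuousOn (fun u : ℝ => u ^ γ - u) (Set.Icc ua ub) by fun_prop)
  obtain ⟨K, hK0, hK⟩ := norm_sum_e_powInc_rpow_le (c₁ := c * τlo) (c₂ := max P c * τhi) hγ hγ1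
    (by positivity) (mul_le_mul (le_max_right _ _) hlohi hlo0.le (hc0.le.trans (le_max_right _ _)))
  refine ⟨C₁ * (1 + τhi) * K * C₂ + C₁ * (1 + τhi) / c ^ 2 * (ub - ua),
    ?_, fun b N q x y ν L hb hN hq hqx hNx hx2 hν hνy hy1 hy2 => ?_⟩
  · have : 0 ≤ ub - ua := by linarith
    positivity
  have hNp : 0 < N ^ (γ - 1) := Real.rpow_pos_of_pos hN _
  have hy : 0 < y := by rw [← hνy]; positivity
  have hx0 : 0 < x := by linarith
  have hpi : ∀ v ∈ Set.Icc x (x + L + 3), 0 < powInc γ q v := fun v hv =>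
    powInc_pos (by linarith) hq (hx0.trans_le hv.1)
  have hτ : ∀ v ∈ Set.Icc x (x + L + 3),
      (b / y) ^ κ * powInc γ q v ^ κ ∈ Set.Icc τlo τhi := by
    intro v hv
    obtain ⟨s1, s2⟩ := powInc_size hγ hγ1 hq hN (hqx.trans hv.1) (hNx.trans hv.1) (hv.2.trans hx2)
    rw [← Real.mul_rpow (by positivity) (hpi v hv).le]
    constructor
    · apply Real.rpow_le_rpow (by norm_num) _ hκ0.le
      rw [div_mul_eq_mul_div, le_div_iff₀ hy]
      calc 1 / 16 * y ≤ b * (q * N ^ (γ - 1) / 2) := by linarith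
        _ ≤ _ := by gcongr
    · apply Real.rpow_le_rpow (by have := hpi v hv; positivity) _ hκ0.le
      rw [div_mul_eq_mul_div, div_le_iff₀ hy]
      calc b * powInc γ q v ≤ b * (2 * (q * N ^ (γ - 1))) := by gcongr
        _ ≤ _ := by linarith
  have hmem : ∀ n : ℕ, n ≤ L → x + n ∈ Set.Icc x (x + L + 3) := by
    intro n hn
    have : (n : ℝ) ≤ L := by exact_mod_cast hn
    constructor
    · linarith [(Nat.cast_nonneg n : (0 : ℝ) ≤ n)]
    · linarith
  set t : ℕ → ℝ := fun n => (b / y) ^ κ * powInc γ q (x + n) ^ κ with ht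
  have htm : ∀ n, n ≤ L → t n ∈ Set.Icc τlo τhi := fun n hn => hτ _ (hmem n hn)
  have htm0 : ∀ n, n < L → t n ∈ Set.Icc 0 τhi := fun n hn =>
    ⟨hlo0.le.trans (htm n hn.le).1, (htm n hn.le).2⟩
  have hanti : ∀ n, t (n + 1) ≤ t n := by
    intro n
    simp only [ht]
    have hxn : 0 < x + n := by positivity
    have h1 : powInc γ q (x + (n + 1 : ℕ)) ≤ powInc γ q (x + n) :=
      powInc_antitone (by linarith) hγ1 hq.le hxn (by push_cast; linarith)
    have h2 : 0 < powInc γ q (x + (n + 1 : ℕ)) := powInc_pos (by linarith) hq (by positivity)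
    gcongr
  have hphase : ∀ n, n < L → ∀ s : ℝ,
      b * powInc γ q (x + n) * s ^ γ - y * s = y * t n ^ (1 - γ) * s ^ γ - y * s := by
    intro n hn s
    have hp := (hpi _ (hmem n hn.le)).le
    have : t n ^ (1 - γ) = b / y * powInc γ q (x + n) := by
      simp only [ht]
      rw [← Real.mul_rpow (by positivity) hp, ← Real.rpow_mul (by positivity), hκ,
        inv_mul_cancel₀ (by linarith), Real.rpow_one]
    rw [this]
    field_simp
  have hI : ∀ n ∈ range L, 2 * Real.pi * Complex.I * ∫ s in (1 / 4 : ℝ)..(5 / 4),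
      (dyBump s : ℂ) * e (b * powInc γ q (x + n) * s ^ γ - y * s)
      = ∫ u in ua..ub, regAmplitude γ y (t n) u * e (y * t n * (u ^ γ - u)) := by
    intro n hn
    rw [mem_range] at hn
    simp_rw [hphase n hn]
    obtain ⟨t1, t2⟩ := htm n hn.le
    refine bump_integral_eq_reg hy.le (hlo0.trans_le t1) hua0 huab ?_ ?_
    · calc t n * ua ≤ τhi * ua := by gcongr
        _ = 1 / 4 := by rw [hua]; field_simp
    · calc (5 / 4 : ℝ) = τlo * ub := by rw [hub]; field_simp
        _ ≤ _ := by gcongr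
  have hii : ∀ n ∈ range L, IntervalIntegrable
      (fun u => regAmplitude γ y (t n) u * e (y * t n * (u ^ γ - u)))
      MeasureTheory.volume ua ub := fun n _ =>
    ((continuousOn_regAmplitude hy.le hua0).mul
      (continuous_e.comp_continuousOn (by fun_prop))).intervalIntegrable_of_Icc huab
  set S := ∑ n ∈ range L, ∫ s in (1 / 4 : ℝ)..(5 / 4),
    (dyBump s : ℂ) * e (b * powInc γ q (x + n) * s ^ γ - y * s) with hS
  have hSI : 2 * Real.pi * Complex.I * S
      = ∫ u in ua..ub, ∑ n ∈ range L, regAmplitude γ y (t n) u * e (y * t n * (u ^ γ - u)) := by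
    rw [hS, mul_sum, sum_congr rfl hI, intervalIntegral.integral_finsetSum hii]
  set Z := L * ν + √L / ν with hZ
  have hZ0 : 0 ≤ Z := by positivity
  have hpt : ∀ u ∈ Set.Icc ua ub,
      ‖∑ n ∈ range L, regAmplitude γ y (t n) u * e (y * t n * (u ^ γ - u))‖
        ≤ C₁ * (1 + τhi) * K * Z * regFactor γ y u + C₁ * (1 + τhi) / c ^ 2 * L / y := by
    intro u hu
    have hR := regFactor_pos (γ := γ) hy.le u
    have hgen := fun {Z' : ℝ} => norm_sum_regAmplitude_le (Z := Z') (t := t) (L := L)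
      (z := fun n => e (y * t n * (u ^ γ - u))) hy.le hC₁0 hhi0
      (fun s s' hs hs' => hamp y u s s' hy.le hu hs hs') htm0 hanti
    rcases hc u hu with h | h
    · have h1 : ∀ l ≤ L, ‖∑ n ∈ range l, e (y * t n * (u ^ γ - u))‖ ≤ K * Z := by
        intro l hl
        have hl' : (l : ℝ) ≤ L := by exact_mod_cast hl
        have := hK N q x ((b / y) ^ κ) ν (u ^ γ - u) l hN hq hqx hNx (by linarith)
          (by positivity) hν (fun v hv => ?_)
        · rw [hνy] at this
          refine le_trans (le_of_eq ?_) (this.trans ?_)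
          · congr 1
            refine sum_congr rfl fun n _ => ?_
            congr 1
            simp only [ht]
            ring
          · rw [hZ]
            gcongr
        · obtain ⟨t1, t2⟩ := hτ v ⟨hv.1, hv.2.trans (by linarith)⟩
          constructor
          · gcongr
          · gcongr
            · exact hlo0.le.trans t1
            · exact (hP u hu).trans (le_max_left _ _)
      refine (hgen h1).trans ?_
      have : 0 ≤ C₁ * (1 + τhi) / c ^ 2 * L / y := by positivity
      calc _ = C₁ * (1 + τhi) * K * Z * regFactor γ y u := by ring
        _ ≤ _ := by linarith
    · have h1 : ∀ l ≤ L, ‖∑ n ∈ range l, e (y * t n * (u ^ γ - u))‖ ≤ L := by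
        intro l hl
        refine (norm_sum_e_le _ _).trans ?_
        rw [card_range]
        exact_mod_cast hl
      refine (hgen h1).trans ?_
      have hRb : regFactor γ y u ≤ 1 / (c ^ 2 * y) := by
        rw [regFactor, ← one_div]
        apply one_div_le_one_div_of_le (by positivity)
        have : c ^ 2 ≤ (γ * u ^ (γ - 1) - 1) ^ 2 := by
          rw [← sq_abs (γ * u ^ (γ - 1) - 1)]
          gcongr
        nlinarith only [this, hy]
      have h0 : 0 ≤ C₁ * (1 + τhi) * K * Z * regFactor γ y u := by positivity
      calc _ ≤ C₁ * (1 + τhi) * (1 / (c ^ 2 * y)) * L := by gcongr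
        _ = C₁ * (1 + τhi) / c ^ 2 * L / y := by field_simp
        _ ≤ _ := by linarith
  have rR := ((continuousOn_regFactor (γ := γ) hy.le).mono hsub).intervalIntegrable_of_Icc
    (μ := MeasureTheory.volume) huab
  have hbound := intervalIntegral.norm_integral_le_of_norm_le huab
    (Filter.Eventually.of_forall fun u (hu : u ∈ Set.Ioc ua ub) =>
      hpt u (Set.Ioc_subset_Icc_self hu))
    ((rR.const_mul _).add intervalIntegrable_const)
  rw [← hSI, norm_mul, norm_two_pi_I, intervalIntegral.integral_add (rR.const_mul _)
    intervalIntegrable_const, intervalIntegral.integral_const_mul,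
    intervalIntegral.integral_const, smul_eq_mul] at hbound
  have h2π : ‖S‖ ≤ 2 * Real.pi * ‖S‖ := by
    have := Real.pi_gt_three
    nlinarith only [this, norm_nonneg S]
  refine h2π.trans (hbound.trans ?_)
  have hub' : 0 ≤ ub - ua := by linarith
  have hsy : 0 < √y := Real.sqrt_pos.2 hy
  calc _ ≤ C₁ * (1 + τhi) * K * Z * (C₂ / √y)
        + (ub - ua) * (C₁ * (1 + τhi) / c ^ 2 * L / y) := by
        gcongr
        exact hInt y hy
    _ = C₁ * (1 + τhi) * K * C₂ * (Z / √y)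
        + C₁ * (1 + τhi) / c ^ 2 * (ub - ua) * (L / y) := by ring
    _ ≤ _ := by
        have a1 : 0 ≤ C₁ * (1 + τhi) * K * C₂ := by positivity
        have a2 : 0 ≤ C₁ * (1 + τhi) / c ^ 2 * (ub - ua) := by positivity
        have b1 : 0 ≤ Z / √y := by positivity
        have b2 : 0 ≤ L / y := by positivity
        nlinarith only [mul_nonneg a1 b2, mul_nonneg a2 b1]

lemma exists_near_frequency_bound' {γ : ℝ} (hγ : 8 / 9 < γ) (hγ1 : γ < 1) :
    ∃ K : ℝ, 0 < K ∧ ∀ (b N q x y ν : ℝ) (L : ℕ), 0 < b → 0 < N → 0 < q → q ≤ x → N / 2 ≤ x →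
      x + L + 3 ≤ 2 * N → 0 < ν → ν ^ 6 * N ^ 3 = b * (q * N ^ (γ - 1)) →
      b * (q * N ^ (γ - 1)) / 10 ≤ y → y ≤ 8 * (b * (q * N ^ (γ - 1))) →
      ‖∑ n ∈ range L, ∫ s in (1 / 4 : ℝ)..(5 / 4),
        (dyBump s : ℂ) * e (b * powInc γ q (x + n) * s ^ γ - y * s)‖
        ≤ K * ((L * ν + √L / ν) / √(b * (q * N ^ (γ - 1))) + L / (b * (q * N ^ (γ - 1)))) := by
  obtain ⟨K, hK0, hK⟩ := exists_near_frequency_bound hγ hγ1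
  refine ⟨10 * K, by positivity, fun b N q x y ν L hb hN hq hqx hNx hx2 hν hνF hy1 hy2 => ?_⟩
  have hNp : 0 < N ^ (γ - 1) := Real.rpow_pos_of_pos hN _
  have hF0 : 0 < b * (q * N ^ (γ - 1)) := by positivity
  set F := b * (q * N ^ (γ - 1)) with hF
  have hy : 0 < y := by linarith
  obtain ⟨r, hr0, hr⟩ : ∃ r : ℝ, 0 < r ∧ r ^ 6 = y / F := by
    refine ⟨(y / F) ^ (1 / 6 : ℝ), by positivity, ?_⟩
    rw [← Real.rpow_natCast, ← Real.rpow_mul (by positivity)]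
    norm_num
  have hr1 : 1 / 2 ≤ r := by
    refine le_of_pow_le_pow_left₀ (n := 6) (by norm_num) hr0.le ?_
    rw [hr, le_div_iff₀ hF0]
    linarith
  have hr2 : r ≤ 2 := by
    refine le_of_pow_le_pow_left₀ (n := 6) (by norm_num) (by norm_num) ?_
    rw [hr, div_le_iff₀ hF0]
    linarith
  have h := hK b N q x y (ν * r) L hb hN hq hqx hNx hx2 (by positivity)
    (by rw [mul_pow, hr, mul_right_comm, hνF]; field_simp) hy1 hy2
  refine h.trans ?_
  have hsF : 0 < √F := Real.sqrt_pos.2 hF0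
  have hsy : √F / 4 ≤ √y := by
    apply Real.le_sqrt_of_sq_le
    rw [div_pow, Real.sq_sqrt hF0.le]
    linarith
  have h1 : (L * (ν * r) + √L / (ν * r)) ≤ 2 * (L * ν + √L / ν) := by
    have i1 : L * (ν * r) ≤ L * (ν * 2) := by gcongr
    have i2 : √L / (ν * r) ≤ √L / (ν * (1 / 2)) := by gcongr
    have i3 : √L / (ν * (1 / 2)) = 2 * (√L / ν) := by field_simp
    linarith
  have hZ0 : 0 ≤ L * ν + √L / ν := by positivity
  calc K * ((L * (ν * r) + √L / (ν * r)) / √y + L / y)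
      ≤ K * (2 * (L * ν + √L / ν) / (√F / 4) + L / (F / 10)) := by gcongr
    _ = K * (8 * ((L * ν + √L / ν) / √F) + 10 * (L / F)) := by field_simp; ring
    _ ≤ 10 * K * ((L * ν + √L / ν) / √F + L / F) := by
      have : 0 ≤ (L * ν + √L / ν) / √F := by positivity
      nlinarith only [this, hK0, mul_nonneg hK0.le this]

lemma exists_bump_double_sum_bound {γ : ℝ} (hγ : 8 / 9 < γ) (hγ1 : γ < 1) :
    ∃ K : ℝ, 0 < K ∧ ∀ (H M N q x ν : ℝ) (L : ℕ), 0 < H → 0 < M → 0 < N → 0 < q → q ≤ x →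
      N / 2 ≤ x → x + L + 3 ≤ 2 * N → 0 < ν →
      ν ^ 6 * N ^ 3 = H * M ^ γ * (q * N ^ (γ - 1)) →
      ‖∑ n ∈ range L, ∑ m ∈ range ⌈2 * M⌉₊,
        (dyBump (m / M) : ℂ) * e (H * (m : ℝ) ^ γ * powInc γ q (x + n))‖
        ≤ K * (L * M / (H * M ^ γ * (q * N ^ (γ - 1))) ^ 2 + L / M
          + √(H * M ^ γ * (q * N ^ (γ - 1))) * (L * ν + √L / ν) + L) := by
  obtain ⟨K₁, hK₁0, hnear⟩ := exists_near_frequency_bound' hγ hγ1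
  obtain ⟨K₂, hK₂0, hfar⟩ := exists_norm_bump_integral_le hγ hγ1
  have hs2 := Real.summable_abs_int_rpow one_lt_two
  set ζ : ℝ := ∑' l : ℤ, |(l : ℝ)| ^ (-2 : ℝ) with hζ
  have hζ0 : 0 ≤ ζ := tsum_nonneg fun l => by positivity
  refine ⟨8 * K₁ + K₂ + K₂ * ζ, by positivity,
    fun H M N q x ν L hH hM hN hq hqx hNx hx2 hν hνF => ?_⟩
  have hNp : 0 < N ^ (γ - 1) := Real.rpow_pos_of_pos hN _
  have hMp : 0 < M ^ γ := Real.rpow_pos_of_pos hM _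
  have hF0 : 0 < H * M ^ γ * (q * N ^ (γ - 1)) := by positivity
  set b := H * M ^ γ with hb
  have hb0 : 0 < b := by positivity
  set F := b * (q * N ^ (γ - 1)) with hF
  have hsF : 0 < √F := Real.sqrt_pos.2 hF0
  set Z := L * ν + √L / ν with hZ
  have hZ0 : 0 ≤ Z := by positivity
  set J : ℕ → ℤ → ℂ := fun n l => ∫ s in (1 / 4 : ℝ)..(5 / 4),
    (dyBump s : ℂ) * e (b * powInc γ q (x + n) * s ^ γ - l * M * s) with hJ
  have hpois := fun n : ℕ => bump_poisson hM γ (b * powInc γ q (x + n))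
  have hin : ∀ n ∈ range L, ∑ m ∈ range ⌈2 * M⌉₊,
      (dyBump (m / M) : ℂ) * e (H * (m : ℝ) ^ γ * powInc γ q (x + n))
      = ∑' l : ℤ, (M : ℂ) * J n l := by
    intro n _
    rw [← (hpois n).2]
    refine sum_congr rfl fun m _ => ?_
    congr 2
    rw [Real.div_rpow (Nat.cast_nonneg m) hM.le, hb]
    field_simp
  rw [sum_congr rfl hin, ← Summable.tsum_finsetSum fun n _ => (hpois n).1]
  set near : Finset ℤ := (Icc 1 ⌊8 * F / M⌋).filter fun l => F / 10 ≤ l * M with hne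
  have hcard : ((near.card : ℕ) : ℝ) ≤ 8 * F / M := by
    have h1 : near.card ≤ (⌊8 * F / M⌋).toNat := by
      refine (card_filter_le _ _).trans ?_
      rw [Int.card_Icc]
      simp
    have h2 : 0 ≤ ⌊8 * F / M⌋ := Int.floor_nonneg.2 (by positivity)
    calc ((near.card : ℕ) : ℝ) ≤ (((⌊8 * F / M⌋).toNat : ℕ) : ℝ) := by exact_mod_cast h1
      _ = ((⌊8 * F / M⌋ : ℤ) : ℝ) := by
        rw [← Int.cast_natCast, Int.toNat_of_nonneg h2]
      _ ≤ _ := Int.floor_le _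
  set A := M * (K₁ * (Z / √F + L / F)) with hA
  have hA0 : 0 ≤ A := by positivity
  have g1 : HasSum (fun l : ℤ => if l ∈ near then A else 0)
      (∑ l ∈ near, if l ∈ near then A else 0) :=
    hasSum_sum_of_ne_finset_zero fun l hl => if_neg hl
  have g2 := hasSum_ite_eq (0 : ℤ) (L * M * K₂ / F ^ 2)
  have g3 : HasSum (fun l : ℤ => L * K₂ / M * |(l : ℝ)| ^ (-2 : ℝ)) (L * K₂ / M * ζ) :=
    hs2.hasSum.mul_left _
  have hb1 := tsum_of_norm_bounded (f := fun l : ℤ => ∑ n ∈ range L, (M : ℂ) * J n l)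
    ((g1.add g2).add g3) ?_
  · refine hb1.trans ?_
    have hsum : (∑ l ∈ near, if l ∈ near then A else 0) ≤ 8 * K₁ * (√F * Z + L) := by
      rw [sum_congr rfl fun l hl => if_pos hl, sum_const, nsmul_eq_mul]
      calc (near.card : ℝ) * A ≤ 8 * F / M * A := by gcongr
        _ = 8 * K₁ * (F / √F * Z + L) := by rw [hA]; field_simp
        _ = _ := by rw [Real.div_sqrt]
    calc _ ≤ 8 * K₁ * (√F * Z + L) + L * M * K₂ / F ^ 2 + L * K₂ / M * ζ := by
          gcongr
      _ = 8 * K₁ * (√F * Z + L) + K₂ * (L * M / F ^ 2) + K₂ * ζ * (L / M) := by ring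
      _ ≤ _ := by
          have a1 : 0 ≤ √F * Z := by positivity
          have a2 : (0 : ℝ) ≤ L := by positivity
          have a3 : 0 ≤ L * M / F ^ 2 := by positivity
          have a4 : 0 ≤ L / M := by positivity
          have a5 : 0 ≤ K₂ * ζ := by positivity
          nlinarith only [mul_nonneg hK₁0.le a3, mul_nonneg hK₁0.le a4, mul_nonneg hK₂0.le a1,
            mul_nonneg hK₂0.le a2, mul_nonneg hK₂0.le a4, mul_nonneg a5 a1, mul_nonneg a5 a2,
            mul_nonneg a5 a3]
  · intro l
    rw [← mul_sum, norm_mul, Complex.norm_real, Real.norm_eq_abs, abs_of_pos hM]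
    have t1 : 0 ≤ if l = 0 then L * M * K₂ / F ^ 2 else 0 := by
      split_ifs
      · positivity
      · exact le_rfl
    have t2 : 0 ≤ L * K₂ / M * |(l : ℝ)| ^ (-2 : ℝ) := by positivity
    by_cases hl : l ∈ near
    · rw [if_pos hl]
      rw [hne, mem_filter, mem_Icc, Int.le_floor, le_div_iff₀ hM] at hl
      have h := hnear b N q x (l * M) ν L hb0 hN hq hqx hNx hx2 hν hνF hl.2 hl.1.2
      have : M * ‖∑ n ∈ range L, J n l‖ ≤ A := by
        rw [hA]
        gcongr
      linarith
    · rw [if_neg hl, zero_add]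
      have hy : (l * M : ℝ) ≤ F / 10 ∨ 8 * F ≤ l * M := by
        by_contra hcon
        push Not at hcon
        apply hl
        rw [hne, mem_filter, mem_Icc, Int.le_floor, le_div_iff₀ hM]
        have hpos : (0 : ℝ) < l := by
          by_contra h0
          push Not at h0
          have := mul_nonpos_of_nonpos_of_nonneg h0 hM.le
          linarith [hcon.1]
        have hpos' : 0 < l := by exact_mod_cast hpos
        exact ⟨⟨by omega, hcon.2.le⟩, hcon.1.le⟩
      have hJb : ∀ n ∈ range L, ‖J n l‖ ≤ K₂ / (F + |l * M|) ^ 2 := by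
        intro n hn
        rw [mem_range] at hn
        have hn' : (n : ℝ) ≤ L := by exact_mod_cast hn.le
        have hn0 : (0 : ℝ) ≤ n := Nat.cast_nonneg n
        obtain ⟨s1, s2⟩ := powInc_size (x := x + n) hγ hγ1 hq hN (by linarith) (by linarith)
          (by linarith)
        refine hfar F (l * M) _ hF0 ?_ ?_ hy
        · calc F / 2 = b * (q * N ^ (γ - 1) / 2) := by rw [hF]; ring
            _ ≤ _ := by gcongr
        · calc b * powInc γ q (x + n) ≤ b * (2 * (q * N ^ (γ - 1))) := by gcongr
            _ = _ := by rw [hF]; ring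
      have hsumJ : M * ‖∑ n ∈ range L, J n l‖ ≤ M * (L * (K₂ / (F + |l * M|) ^ 2)) := by
        gcongr
        refine (norm_sum_le_of_le _ hJb).trans (le_of_eq ?_)
        rw [sum_const, card_range, nsmul_eq_mul]
      refine hsumJ.trans ?_
      rcases eq_or_ne l 0 with rfl | hl0
      · rw [if_pos rfl] at t1 ⊢
        have : M * (L * (K₂ / (F + |((0 : ℤ) : ℝ) * M|) ^ 2)) = L * M * K₂ / F ^ 2 := by
          rw [Int.cast_zero, zero_mul, abs_zero, add_zero]; ring
        linarith
      · rw [if_neg hl0, zero_add]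
        have hlp : 0 < |(l : ℝ)| := abs_pos.2 (by exact_mod_cast hl0)
        have h2 : |(l : ℝ)| ^ (-2 : ℝ) = 1 / |(l : ℝ)| ^ 2 := by
          rw [Real.rpow_neg hlp.le, one_div]
          norm_num
        rw [h2, abs_mul, abs_of_pos hM]
        calc M * (L * (K₂ / (F + |(l : ℝ)| * M) ^ 2))
            ≤ M * (L * (K₂ / (|(l : ℝ)| * M) ^ 2)) := by
              gcongr
              linarith
          _ = _ := by field_simp

lemma e_nat_mul (k : ℕ) (x : ℝ) : e (k * x) = e x ^ k := by
  simp only [e]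
  rw [← Complex.exp_nat_mul]
  congr 1
  push_cast
  ring

lemma sum_e_orthogonal {L n n' : ℕ} (hn : n < L) (hn' : n' < L) :
    ∑ k ∈ range L, e (k * (((n : ℝ) - n') / L)) = if n = n' then (L : ℂ) else 0 := by
  have hL : (0 : ℝ) < L := by exact_mod_cast (Nat.zero_le n).trans_lt hn
  split_ifs with h
  · subst h
    simp [e_zero]
  · simp_rw [e_nat_mul]
    set x : ℝ := ((n : ℝ) - n') / L with hx
    have hne : e x ≠ 1 := by
      intro h1
      rw [e, Complex.exp_eq_one_iff] at h1
      obtain ⟨j, hj⟩ := h1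
      have h2 : (x : ℂ) = j := by
        have : (2 * Real.pi * Complex.I : ℂ) ≠ 0 := by simp [Real.pi_ne_zero]
        apply mul_left_cancel₀ this
        rw [hj]; ring
      have h3 : x = j := by exact_mod_cast h2
      have h4 : (n : ℝ) - n' = j * L := by rw [← h3, hx]; field_simp
      have h5 : (n : ℤ) - n' = j * L := by exact_mod_cast h4
      rcases lt_trichotomy j 0 with hj0 | hj0 | hj0
      · have : j * L ≤ -1 * L := by
          have : j ≤ -1 := by omega
          gcongr
        omega
      · rw [hj0] at h5; omega
      · have : 1 * (L : ℤ) ≤ j * L := by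
          have : 1 ≤ j := by omega
          gcongr
        omega
    have h1 : e x ^ L = 1 := by
      rw [← e_nat_mul, hx, mul_div_cancel₀ _ hL.ne']
      have := e_int ((n : ℤ) - n')
      push_cast at this
      exact this
    have h2 := geom_sum_mul (e x) L
    rw [h1, sub_self] at h2
    exact (mul_eq_zero.1 h2).resolve_right (sub_ne_zero.2 hne)

/-- Weights arising when an interval is completed to all residues. -/
noncomputable def completionWeight (L k : ℕ) : ℝ :=
  if k = 0 then 1 else 2 / k + 2 / ((L : ℝ) - k)

lemma norm_sum_Ico_e_le {L a b k : ℕ} (hb : b ≤ L) (hk : k < L) :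
    ‖∑ n ∈ Ico a b, e (-(k * ((n : ℝ) / L)))‖ ≤ L * completionWeight L k := by
  have hL : (0 : ℝ) < L := by exact_mod_cast (Nat.zero_le k).trans_lt hk
  rw [norm_sum_e_neg, completionWeight]
  split_ifs with h0
  · refine (norm_sum_e_le _ _).trans ?_
    rw [Nat.card_Ico, mul_one]
    exact_mod_cast (Nat.sub_le b a).trans hb
  · have hk0 : (0 : ℝ) < k := by exact_mod_cast Nat.pos_of_ne_zero h0
    have hkL : (k : ℝ) < L := by exact_mod_cast hk
    have hLk : 0 < (L : ℝ) - k := by linarith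
    rw [sum_Ico_eq_sum_range]
    have h := kusmin_landau (fun n => (k : ℝ) * (((a + n : ℕ) : ℝ) / L)) (b - a) 0
      (δ := min (k / L) ((L - k) / L)) (by positivity)
      (fun n _ => by
        refine le_of_eq ?_
        push_cast
        field_simp
        ring)
      (fun n _ => by
        refine le_trans (add_le_add_right (min_le_left _ _) _) (le_of_eq ?_)
        push_cast
        field_simp
        ring)
      (fun n _ => by
        have := min_le_right ((k : ℝ) / L) ((L - k) / L)
        have e1 : (k : ℝ) * (((a + (n + 1) : ℕ) : ℝ) / L) - k * (((a + n : ℕ) : ℝ) / L)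
          = 1 - (L - k) / L := by
          push_cast
          field_simp
          ring
        rw [e1]
        push_cast
        linarith)
    refine h.trans ?_
    rcases min_choice ((k : ℝ) / L) ((L - k) / L) with h1 | h1 <;> rw [h1]
    · have : 0 ≤ L * (2 / ((L : ℝ) - k)) := by positivity
      calc 2 / ((k : ℝ) / L) = L * (2 / k) := by field_simp
        _ ≤ _ := by linarith
    · have : 0 ≤ L * (2 / (k : ℝ)) := by positivity
      calc 2 / (((L : ℝ) - k) / L) = L * (2 / ((L : ℝ) - k)) := by field_simp
        _ ≤ _ := by linarith

/-- Completing an incomplete sum at the cost of linear twists. -/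
lemma norm_sum_Ico_le_completed (z : ℕ → ℂ) {L a b : ℕ} (hb : b ≤ L) :
    ‖∑ n ∈ Ico a b, z n‖
      ≤ ∑ k ∈ range L, completionWeight L k * ‖∑ n ∈ range L, z n * e (k * ((n : ℝ) / L))‖ := by
  rcases Nat.eq_zero_or_pos L with rfl | hL
  · simp [Nat.le_zero.1 hb]
  have hL0 : (L : ℂ) ≠ 0 := by exact_mod_cast hL.ne'
  have hLr : (0 : ℝ) < L := by exact_mod_cast hL
  have key : (L : ℂ) * ∑ n ∈ Ico a b, z n = ∑ k ∈ range L,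
      (∑ n ∈ Ico a b, e (-(k * ((n : ℝ) / L)))) * ∑ n ∈ range L, z n * e (k * ((n : ℝ) / L)) := by
    simp_rw [sum_mul_sum]
    rw [sum_comm, mul_sum]
    refine sum_congr rfl fun n' hn' => ?_
    rw [mem_Ico] at hn'
    rw [sum_comm]
    have hin : ∀ n ∈ range L, ∑ k ∈ range L, e (-(k * ((n' : ℝ) / L))) *
        (z n * e (k * ((n : ℝ) / L))) = if n = n' then (L : ℂ) * z n else 0 := by
      intro n hn
      rw [mem_range] at hn
      have := sum_e_orthogonal hn (hn'.2.trans_le hb)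
      calc _ = z n * ∑ k ∈ range L, e (k * (((n : ℝ) - n') / L)) := by
            rw [mul_sum]
            refine sum_congr rfl fun k _ => ?_
            rw [mul_left_comm, ← e_add]
            congr 2
            ring
        _ = _ := by
            rw [this]
            split_ifs <;> ring
    rw [sum_congr rfl hin, sum_ite_eq' (range L) n', if_pos (mem_range.2 (hn'.2.trans_le hb))]
  have h2 : L * ‖∑ n ∈ Ico a b, z n‖ ≤ L * ∑ k ∈ range L,
      completionWeight L k * ‖∑ n ∈ range L, z n * e (k * ((n : ℝ) / L))‖ := by
    calc L * ‖∑ n ∈ Ico a b, z n‖ = ‖(L : ℂ) * ∑ n ∈ Ico a b, z n‖ := by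
          rw [norm_mul, Complex.norm_natCast]
      _ ≤ ∑ k ∈ range L, L * completionWeight L k *
            ‖∑ n ∈ range L, z n * e (k * ((n : ℝ) / L))‖ := by
          rw [key]
          refine norm_sum_le_of_le _ fun k hk => ?_
          rw [norm_mul]
          gcongr
          exact norm_sum_Ico_e_le hb (mem_range.1 hk)
      _ = _ := by
          rw [mul_sum]
          exact sum_congr rfl fun k _ => by ring
  exact le_of_mul_le_mul_left h2 hLr

lemma completionWeight_nonneg {L k : ℕ} (hk : k < L) : 0 ≤ completionWeight L k := by
  have : (k : ℝ) < L := by exact_mod_cast hk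
  have h : 0 ≤ (L : ℝ) - k := by linarith
  rw [completionWeight]
  split_ifs <;> positivity

lemma sum_completionWeight_le {L : ℕ} (hL : 0 < L) :
    ∑ k ∈ range L, completionWeight L k ≤ 5 + 4 * Real.log L := by
  obtain ⟨n, rfl⟩ : ∃ n, L = n + 1 := ⟨L - 1, by omega⟩
  have hh : ∑ j ∈ range n, (1 : ℝ) / ((j : ℝ) + 1) ≤ 1 + Real.log n := by
    have := harmonic_le_one_add_log n
    simp only [harmonic] at this
    push_cast at this
    simpa only [one_div] using this
  have hlog : Real.log n ≤ Real.log (n + 1 : ℕ) := by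
    rcases Nat.eq_zero_or_pos n with rfl | hn
    · simp
    · apply Real.log_le_log (by exact_mod_cast hn)
      push_cast
      linarith
  have hrefl := sum_range_reflect (fun j => (1 : ℝ) / ((j : ℝ) + 1)) n
  rw [sum_range_succ']
  have hterm : ∀ j ∈ range n, completionWeight (n + 1) (j + 1)
      = 2 * (1 / ((j : ℝ) + 1)) + 2 * (1 / (((n - 1 - j : ℕ) : ℝ) + 1)) := by
    intro j hj
    rw [mem_range] at hj
    rw [completionWeight, if_neg (by omega)]
    have : (((n - 1 - j : ℕ) : ℝ) + 1) = ((n + 1 : ℕ) : ℝ) - ((j + 1 : ℕ) : ℝ) := by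
      rw [← Nat.cast_sub (by omega), ← Nat.cast_add_one]
      congr 1
      omega
    rw [this]
    push_cast
    ring
  rw [sum_congr rfl hterm, sum_add_distrib, ← mul_sum, ← mul_sum, hrefl]
  simp only [completionWeight, if_true]
  linarith

lemma rpow_mem_Icc_of_dyadic {κ N t : ℝ} (hN : 0 < N) (h1 : N / 2 ≤ t) (h2 : t ≤ 2 * N)
    (hκ0 : κ ≤ 0) (hκ : -3 ≤ κ) : t ^ κ ∈ Set.Icc (N ^ κ / 8) (8 * N ^ κ) := by
  have ht : 0 < t := by linarith
  have hNκ : 0 < N ^ κ := Real.rpow_pos_of_pos hN _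
  have e2 : (1 / 8 : ℝ) ≤ (2 : ℝ) ^ κ := by
    calc (1 / 8 : ℝ) = (2 : ℝ) ^ (-3 : ℝ) := by
          rw [Real.rpow_neg (by norm_num)]; norm_num
      _ ≤ _ := Real.rpow_le_rpow_of_exponent_le (by norm_num) hκ
  have e3 : ((1 / 2 : ℝ)) ^ κ ≤ 8 := by
    calc (1 / 2 : ℝ) ^ κ ≤ (1 / 2 : ℝ) ^ (-3 : ℝ) :=
          Real.rpow_le_rpow_of_exponent_ge (by norm_num) (by norm_num) hκ
      _ = 8 := by rw [Real.rpow_neg (by norm_num)]; norm_num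
  constructor
  · calc N ^ κ / 8 ≤ 2 ^ κ * N ^ κ := by nlinarith
      _ = (2 * N) ^ κ := (Real.mul_rpow (by norm_num) hN.le).symm
      _ ≤ t ^ κ := Real.rpow_le_rpow_of_nonpos ht h2 hκ0
  · calc t ^ κ ≤ (1 / 2 * N) ^ κ := Real.rpow_le_rpow_of_nonpos (by linarith) (by linarith) hκ0
      _ = (1 / 2) ^ κ * N ^ κ := Real.mul_rpow (by norm_num) hN.le
      _ ≤ 8 * N ^ κ := by gcongr

/-- The third derivative test for a monomial phase on a dyadic range. -/
lemma norm_sum_e_rpow_le {γ : ℝ} (hγ : 0 < γ) (hγ1 : γ < 1) :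
    ∃ K : ℝ, 0 < K ∧ ∀ (N x A ν : ℝ) (L : ℕ), 0 < N → N / 2 ≤ x → x + L + 3 ≤ 2 * N → 0 < ν →
      ν ^ 6 * N ^ 3 = A * N ^ γ →
      ‖∑ n ∈ range L, e (A * (x + n) ^ γ)‖ ≤ K * (L * ν + √L / ν) := by
  set c : ℝ := γ * (γ - 1) * (γ - 2) with hc
  have hc0 : 0 < c := by
    have : 0 < γ * ((1 - γ) * (2 - γ)) := by
      have h1 : 0 < 1 - γ := by linarith
      have h2 : 0 < 2 - γ := by linarith
      positivity
    rw [hc]; linarith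
  set ρ : ℝ := (c / 8) ^ (1 / 6 : ℝ) with hρ
  have hρ0 : 0 < ρ := Real.rpow_pos_of_pos (by linarith) _
  have hρ6 : ρ ^ 6 = c / 8 := by
    rw [hρ, ← Real.rpow_natCast, ← Real.rpow_mul (by linarith)]; norm_num
  refine ⟨480 * 64 * (ρ + 1 / ρ), by positivity, ?_⟩
  intro N x A ν L hN hx hxL hν hA
  have hAN : A * N ^ (γ - 3) = ν ^ 6 := by
    rw [Real.rpow_sub hN, mul_div_assoc', ← hA, Real.rpow_ofNat]
    field_simp
  have hA0 : 0 < A := by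
    have h1 : 0 < A * N ^ γ := by rw [← hA]; positivity
    exact pos_of_mul_pos_left h1 (Real.rpow_nonneg hN.le _)
  have hpos : ∀ t ∈ Set.Icc x (x + L + 3), 0 < t := fun t ht => by linarith [ht.1]
  have hd : ∀ (r : ℝ), ∀ t ∈ Set.Icc x (x + L + 3),
      HasDerivAt (fun t : ℝ => t ^ r) (r * t ^ (r - 1)) t := fun r t ht =>
    Real.hasDerivAt_rpow_const (Or.inl (hpos t ht).ne')
  have key := third_difference_mem_Icc (u := x) (v := x + L)
    (a := c / 8 * ν ^ 6) (b := 8 * c * ν ^ 6)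
    (fun t ht => (hd γ t ht).const_mul A)
    (fun t ht => (((hd (γ - 1) t ht).const_mul γ)).const_mul A)
    (fun t ht => ((((hd (γ - 1 - 1) t ht).const_mul (γ - 1)).const_mul γ)).const_mul A)
    (fun t ht => by
      have hm := rpow_mem_Icc_of_dyadic (κ := γ - 3) (t := t) hN (by linarith [ht.1])
        (by linarith [ht.2]) (by linarith) (by linarith)
      have e1 : A * (γ * ((γ - 1) * ((γ - 1 - 1) * t ^ (γ - 1 - 1 - 1))))
          = c * A * t ^ (γ - 3) := by
        rw [hc, show γ - 1 - 1 - 1 = γ - 3 by ring]; ring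
      rw [e1, ← hAN]
      constructor
      · calc c / 8 * (A * N ^ (γ - 3)) = c * A * (N ^ (γ - 3) / 8) := by ring
          _ ≤ _ := by gcongr; exact hm.1
      · calc c * A * t ^ (γ - 3) ≤ c * A * (8 * N ^ (γ - 3)) := by gcongr; exact hm.2
          _ = _ := by ring)
  have hkey : ∀ n < L, A * (x + (n + 3 : ℕ)) ^ γ - 3 * (A * (x + (n + 2 : ℕ)) ^ γ)
      + 3 * (A * (x + (n + 1 : ℕ)) ^ γ) - A * (x + n) ^ γ
      ∈ Set.Icc (c / 8 * ν ^ 6) (8 * c * ν ^ 6) := by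
    intro n hn
    have hnL : (n : ℝ) ≤ L := by exact_mod_cast hn.le
    have h := key (x + n) ⟨by linarith [Nat.cast_nonneg (α := ℝ) n], by linarith⟩
    simpa [add_assoc] using h
  have h := third_difference_test (fun n => A * (x + n) ^ γ) L (μ := ρ * ν) (C := 64)
    (by positivity) (by norm_num)
    (fun n hn => by rw [mul_pow, hρ6]; exact (hkey n hn).1)
    (fun n hn => by
      rw [mul_pow, hρ6]
      exact (hkey n hn).2.trans (le_of_eq (by ring)))
  refine h.trans ?_
  have h1 : 0 ≤ (L : ℝ) * ν / ρ := by positivity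
  have h2 : 0 ≤ √(L : ℝ) / ν * ρ := by positivity
  calc 480 * 64 * (L * (ρ * ν) + √(L : ℝ) / (ρ * ν))
      ≤ 480 * 64 * (L * (ρ * ν) + √(L : ℝ) / (ρ * ν) + (L * ν / ρ + √(L : ℝ) / ν * ρ)) := by
        linarith
    _ = _ := by field_simp; ring

lemma mem_dyN {Y : ℝ} {m : ℕ} : m ∈ dyN Y ↔ Y / 2 ≤ m ∧ (m : ℝ) < Y := by
  rw [dyN, mem_filter, mem_range, and_iff_right_iff_imp]
  rintro ⟨-, h⟩
  have := Nat.lt_ceil.2 h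
  omega

lemma dyN_eq_Ico (Y : ℝ) : dyN Y = Ico ⌈Y / 2⌉₊ ⌈Y⌉₊ := by
  ext m
  rw [mem_dyN, mem_Ico, Nat.ceil_le, Nat.lt_ceil]

lemma card_dyN_le {Y : ℝ} (hY : 1 ≤ Y) : (#(dyN Y) : ℝ) ≤ 2 * Y := by
  rw [dyN_eq_Ico, Nat.card_Ico]
  calc ((⌈Y⌉₊ - ⌈Y / 2⌉₊ : ℕ) : ℝ) ≤ (⌈Y⌉₊ : ℝ) := by exact_mod_cast Nat.sub_le _ _
    _ ≤ Y + 1 := (Nat.ceil_lt_add_one (by linarith)).le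
    _ ≤ 2 * Y := by linarith

lemma mem_dyZ {Y : ℝ} {h : ℤ} (hh : h ∈ dyZ Y) : 1 ≤ |(h : ℝ)| ∧ |(h : ℝ)| < Y := by
  rw [dyZ, mem_filter] at hh
  refine ⟨?_, hh.2.2.2⟩
  exact_mod_cast Int.one_le_abs hh.2.1

lemma card_dyZ_le {Y : ℝ} (hY : 1 ≤ Y) : (#(dyZ Y) : ℝ) ≤ 5 * Y := by
  have h1 : #(dyZ Y) ≤ 2 * ⌈Y⌉₊ + 1 := by
    refine (card_filter_le _ _).trans ?_
    rw [Int.card_Icc]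
    omega
  have h2 := (Nat.ceil_lt_add_one (show 0 ≤ Y by linarith)).le
  have h3 : (#(dyZ Y) : ℝ) ≤ 2 * ⌈Y⌉₊ + 1 := by exact_mod_cast h1
  linarith

/-- Members of `dyN N` whose product with `m` lies in `[X/2, X)`. -/
noncomputable def dyFiber (X N : ℝ) (m : ℕ) : Finset ℕ :=
  (dyN N).filter fun n => X / 2 ≤ ((m * n : ℕ) : ℝ) ∧ ((m * n : ℕ) : ℝ) < X

lemma dyFiber_eq_Ico (X N : ℝ) {m : ℕ} (hm : 0 < m) :
    dyFiber X N m = Ico (max ⌈N / 2⌉₊ ⌈X / 2 / m⌉₊) (min ⌈N⌉₊ ⌈X / m⌉₊) := by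
  have hm' : (0 : ℝ) < m := by exact_mod_cast hm
  ext n
  rw [dyFiber, mem_filter, mem_dyN, mem_Ico, max_le_iff, lt_min_iff, Nat.ceil_le, Nat.ceil_le,
    Nat.lt_ceil, Nat.lt_ceil, div_le_iff₀ hm', lt_div_iff₀ hm', Nat.cast_mul,
    mul_comm (m : ℝ)]
  tauto

lemma ceil_dyadic_bounds {N : ℝ} (hN : 4 ≤ N) :
    N / 2 ≤ (⌈N / 2⌉₊ : ℝ) ∧ (⌈N / 2⌉₊ : ℝ) + (⌈N⌉₊ - ⌈N / 2⌉₊ : ℕ) + 3 ≤ 2 * N ∧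
      ((⌈N⌉₊ - ⌈N / 2⌉₊ : ℕ) : ℝ) ≤ N ∧ 0 < ⌈N⌉₊ - ⌈N / 2⌉₊ := by
  have h1 := Nat.le_ceil (N / 2)
  have h2 := (Nat.ceil_lt_add_one (show 0 ≤ N by linarith)).le
  have h3 := (Nat.ceil_lt_add_one (show 0 ≤ N / 2 by linarith))
  have h4 := Nat.le_ceil N
  have h5 : ⌈N / 2⌉₊ < ⌈N⌉₊ := by
    have : (⌈N / 2⌉₊ : ℝ) < ⌈N⌉₊ := by linarith
    exact_mod_cast this
  rw [Nat.cast_sub h5.le]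
  exact ⟨h1, by linarith, by linarith, by omega⟩

lemma norm_sum_dyFiber_le {γ : ℝ} (hγ : 0 < γ) (hγ1 : γ < 1) :
    ∃ K : ℝ, 0 < K ∧ ∀ (X N H : ℝ) (m : ℕ), 4 ≤ N → 0 < H → 0 < m →
      ‖∑ n ∈ dyFiber X N m, e (H * ((m : ℝ) * n) ^ γ)‖
        ≤ K * ((H * (m * N) ^ γ) ^ (1 / 6 : ℝ) * √N + N / (H * (m * N) ^ γ) ^ (1 / 6 : ℝ)) := by
  obtain ⟨K, hK, h⟩ := norm_sum_e_rpow_le hγ hγ1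
  refine ⟨K, hK, ?_⟩
  intro X N H m hN hH hm
  have hm' : (0 : ℝ) < m := by exact_mod_cast hm
  have hN0 : 0 < N := by linarith
  have hF : 0 < H * (m * N) ^ γ := by positivity
  set a := max ⌈N / 2⌉₊ ⌈X / 2 / m⌉₊
  set b := min ⌈N⌉₊ ⌈X / m⌉₊
  set f : ℝ := (H * (m * N) ^ γ) ^ (1 / 6 : ℝ) with hf
  have hf0 : 0 < f := Real.rpow_pos_of_pos hF _
  have hf6 : f ^ 6 = H * (m * N) ^ γ := by
    rw [hf, ← Real.rpow_natCast, ← Real.rpow_mul hF.le]; norm_num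
  have hsN : √N ^ 2 = N := Real.sq_sqrt hN0.le
  have hs0 : 0 < √N := Real.sqrt_pos.2 hN0
  rw [dyFiber_eq_Ico X N hm]
  rcases le_or_gt b a with hba | hab
  · rw [Ico_eq_empty_of_le hba, sum_empty, norm_zero]
    positivity
  obtain ⟨c1, c2, c3, -⟩ := ceil_dyadic_bounds hN
  have ha : ⌈N / 2⌉₊ ≤ a := le_max_left _ _
  have hb : b ≤ ⌈N⌉₊ := min_le_left _ _
  have hLle : b - a ≤ ⌈N⌉₊ - ⌈N / 2⌉₊ := by omega
  have hL : ((b - a : ℕ) : ℝ) ≤ N := le_trans (by exact_mod_cast hLle) c3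
  have ha' : N / 2 ≤ (a : ℝ) := c1.trans (by exact_mod_cast ha)
  have hsum : (a : ℝ) + (b - a : ℕ) + 3 ≤ 2 * N := by
    refine le_trans ?_ c2
    have : a + (b - a) ≤ ⌈N / 2⌉₊ + (⌈N⌉₊ - ⌈N / 2⌉₊) := by omega
    have : (a : ℝ) + (b - a : ℕ) ≤ (⌈N / 2⌉₊ : ℝ) + (⌈N⌉₊ - ⌈N / 2⌉₊ : ℕ) := by exact_mod_cast this
    linarith
  have key := h N a (H * m ^ γ) (f / √N) (b - a) hN0 ha' hsum (by positivity) (by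
    rw [div_pow, hf6, show √N ^ 6 = (√N ^ 2) ^ 3 by ring, hsN, Real.mul_rpow hm'.le hN0.le]
    field_simp)
  have e1 : ∑ n ∈ Ico a b, e (H * ((m : ℝ) * n) ^ γ)
      = ∑ n ∈ range (b - a), e (H * (m : ℝ) ^ γ * ((a : ℝ) + n) ^ γ) := by
    rw [sum_Ico_eq_sum_range]
    refine sum_congr rfl fun n _ => ?_
    rw [Real.mul_rpow hm'.le (Nat.cast_nonneg _), Nat.cast_add, mul_assoc]
  rw [e1]
  refine key.trans (mul_le_mul_of_nonneg_left (add_le_add ?_ ?_) hK.le)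
  · calc ((b - a : ℕ) : ℝ) * (f / √N) ≤ √N ^ 2 * (f / √N) := by rw [hsN]; gcongr
      _ = f * √N := by field_simp
  · calc √((b - a : ℕ) : ℝ) / (f / √N) ≤ √N / (f / √N) := by gcongr
      _ = √N ^ 2 / f := by field_simp
      _ = N / f := by rw [hsN]

/-- Cauchy's inequality and differencing for a bilinear sum with a monomial phase. -/
lemma sq_sum_norm_twisted_le {γ H M N T κ : ℝ} {n₀ L Q : ℕ} (hM : 1 ≤ M)
    (hL : (L : ℝ) ≤ N) (hQ : 0 < Q) (hQN : (Q : ℝ) ≤ N) (hT0 : 0 ≤ T)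
    (hT : ∀ d : ℕ, 0 < d → d < Q → ‖∑ n ∈ range (L - d), ∑ m ∈ range ⌈2 * M⌉₊,
      (dyBump (m / M) : ℂ) * e (H * (m : ℝ) ^ γ * powInc γ d (n₀ + n))‖ ≤ T) :
    (∑ m ∈ dyN M, ‖∑ n ∈ range L, e (H * ((m : ℝ) * (n₀ + n : ℕ)) ^ γ + κ * n)‖) ^ 2
      ≤ 8 * M * N * (3 * M * N / Q + T) := by
  have hM0 : 0 < M := by linarith
  have hQ' : (0 : ℝ) < Q := by exact_mod_cast hQ
  set z : ℕ → ℕ → ℂ := fun m n => e (H * ((m : ℝ) * (n₀ + n : ℕ)) ^ γ + κ * n) with hz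
  set w : ℕ → ℝ := fun m => dyBump (m / M) with hw
  have hw0 : ∀ m, 0 ≤ w m := fun m => dyBump_nonneg _
  have hw1 : ∀ m, w m ≤ 1 := fun m => ContDiffBump.le_one _
  have hcard : (#(range ⌈2 * M⌉₊) : ℝ) ≤ 3 * M := by
    rw [card_range]
    linarith [(Nat.ceil_lt_add_one (show 0 ≤ 2 * M by linarith)).le]
  have hsub : dyN M ⊆ range ⌈2 * M⌉₊ := by
    intro m hm
    rw [mem_range, Nat.lt_ceil]
    linarith [(mem_dyN.1 hm).2]
  have hS : (∑ m ∈ dyN M, ‖∑ n ∈ range L, z m n‖) ^ 2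
      ≤ 2 * M * ∑ m ∈ range ⌈2 * M⌉₊, w m * ‖∑ n ∈ range L, z m n‖ ^ 2 := by
    refine (sq_sum_le_card_mul_sum_sq).trans ?_
    have h1 : ∑ m ∈ dyN M, ‖∑ n ∈ range L, z m n‖ ^ 2
        ≤ ∑ m ∈ range ⌈2 * M⌉₊, w m * ‖∑ n ∈ range L, z m n‖ ^ 2 := by
      calc _ = ∑ m ∈ dyN M, w m * ‖∑ n ∈ range L, z m n‖ ^ 2 := by
            refine sum_congr rfl fun m hm => ?_
            have := mem_dyN.1 hm
            rw [hw]
            simp only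
            rw [dyBump_eq_one (by rw [le_div_iff₀ hM0]; linarith [this.1])
              (by rw [div_le_one hM0]; exact this.2.le), one_mul]
        _ ≤ _ := sum_le_sum_of_subset_of_nonneg hsub fun m _ _ =>
            mul_nonneg (hw0 m) (by positivity)
    gcongr
    exact card_dyN_le hM
  have hvdC := weyl_vdC (range ⌈2 * M⌉₊) w (fun m _ => hw0 m) z L Q hQ
  have hd0 : ‖∑ m ∈ range ⌈2 * M⌉₊, (w m : ℂ) * corr L (z m) 0‖ ≤ 3 * M * N := by
    calc _ ≤ ∑ m ∈ range ⌈2 * M⌉₊, (N : ℝ) := by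
          refine norm_sum_le_of_le _ fun m _ => ?_
          rw [norm_mul, Complex.norm_real, Real.norm_eq_abs, abs_of_nonneg (hw0 m)]
          have : ‖corr L (z m) 0‖ ≤ L := by
            rw [hz]
            simp only
            rw [corr_e]
            refine (norm_sum_e_le _ _).trans ?_
            simp
          calc w m * ‖corr L (z m) 0‖ ≤ 1 * N :=
                mul_le_mul (hw1 m) (this.trans hL) (norm_nonneg _) zero_le_one
            _ = N := one_mul _
      _ = #(range ⌈2 * M⌉₊) * N := by rw [sum_const, nsmul_eq_mul]
      _ ≤ 3 * M * N := by
          have : 0 ≤ N := (Nat.cast_nonneg _).trans hL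
          gcongr
  have hdpos : ∀ d, 0 < d → d < Q →
      ‖∑ m ∈ range ⌈2 * M⌉₊, (w m : ℂ) * corr L (z m) d‖ ≤ T := by
    intro d hd hdQ
    refine le_trans (le_of_eq ?_) (hT d hd hdQ)
    have e1 : ∀ m ∈ range ⌈2 * M⌉₊, (w m : ℂ) * corr L (z m) d = e (κ * d) *
        ∑ n ∈ range (L - d), (dyBump (m / M) : ℂ) * e (H * (m : ℝ) ^ γ * powInc γ d (n₀ + n)) := by
      intro m _
      rw [hz]
      simp only
      rw [corr_e, mul_sum, mul_sum]
      refine sum_congr rfl fun n _ => ?_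
      rw [mul_left_comm, ← e_add]
      congr 2
      rw [Real.mul_rpow (Nat.cast_nonneg _) (Nat.cast_nonneg _),
        Real.mul_rpow (Nat.cast_nonneg _) (Nat.cast_nonneg _), powInc]
      push_cast
      rw [show (n₀ : ℝ) + (n + d) = n₀ + n + d by ring]
      ring
    rw [sum_congr rfl e1, ← mul_sum, norm_mul, norm_e, one_mul, sum_comm]
  have hsum : ∑ d ∈ range Q, ‖∑ m ∈ range ⌈2 * M⌉₊, (w m : ℂ) * corr L (z m) d‖
      ≤ 3 * M * N + Q * T := by
    obtain ⟨P, rfl⟩ : ∃ P, Q = P + 1 := ⟨Q - 1, by omega⟩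
    rw [sum_range_succ']
    have : ∑ d ∈ range P, ‖∑ m ∈ range ⌈2 * M⌉₊, (w m : ℂ) * corr L (z m) (d + 1)‖
        ≤ P * T := by
      calc _ ≤ ∑ d ∈ range P, T := sum_le_sum fun d hd =>
            hdpos (d + 1) (by omega) (by rw [mem_range] at hd; omega)
        _ = P * T := by rw [sum_const, nsmul_eq_mul, card_range]
    push_cast
    linarith
  have hN0 : 0 ≤ N := (Nat.cast_nonneg _).trans hL
  have hfin : Q * ∑ m ∈ range ⌈2 * M⌉₊, w m * ‖∑ n ∈ range L, z m n‖ ^ 2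
      ≤ Q * (4 * N * (3 * M * N / Q + T)) := by
    refine hvdC.trans ?_
    calc _ ≤ 2 * (N + N) * (3 * M * N + Q * T) := by gcongr
      _ = _ := by field_simp; ring
  have hfin' := le_of_mul_le_mul_left hfin hQ'
  calc _ ≤ _ := hS
    _ ≤ 2 * M * (4 * N * (3 * M * N / Q + T)) := by gcongr
    _ = _ := by ring

lemma sum_norm_dyFiber_le {γ H M N T X : ℝ} {Q : ℕ} (hM : 1 ≤ M) (hN : 4 ≤ N)
    (hQ : 0 < Q) (hQN : (Q : ℝ) ≤ N) (hT0 : 0 ≤ T)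
    (hT : ∀ d : ℕ, 0 < d → d < Q → ‖∑ n ∈ range (⌈N⌉₊ - ⌈N / 2⌉₊ - d), ∑ m ∈ range ⌈2 * M⌉₊,
      (dyBump (m / M) : ℂ) * e (H * (m : ℝ) ^ γ * powInc γ d (⌈N / 2⌉₊ + n))‖ ≤ T) :
    ∑ m ∈ dyN M, ‖∑ n ∈ dyFiber X N m, e (H * ((m : ℝ) * n) ^ γ)‖
      ≤ (5 + 4 * Real.log N) * √(8 * M * N * (3 * M * N / Q + T)) := by
  obtain ⟨c1, c2, c3, c4⟩ := ceil_dyadic_bounds hN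
  set n₀ := ⌈N / 2⌉₊ with hn₀
  set L := ⌈N⌉₊ - n₀ with hL
  set S : ℕ → ℝ := fun k =>
    ∑ m ∈ dyN M, ‖∑ n ∈ range L, e (H * ((m : ℝ) * (n₀ + n : ℕ)) ^ γ + k / L * n)‖ with hS
  have hSk : ∀ k, S k ≤ √(8 * M * N * (3 * M * N / Q + T)) := fun k =>
    Real.le_sqrt_of_sq_le (sq_sum_norm_twisted_le hM c3 hQ hQN hT0 hT)
  have hm : ∀ m ∈ dyN M, ‖∑ n ∈ dyFiber X N m, e (H * ((m : ℝ) * n) ^ γ)‖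
      ≤ ∑ k ∈ range L, completionWeight L k *
        ‖∑ n ∈ range L, e (H * ((m : ℝ) * (n₀ + n : ℕ)) ^ γ + k / L * n)‖ := by
    intro m hm
    have hm0 : 0 < m := by
      have := (mem_dyN.1 hm).1
      have : (0 : ℝ) < m := by linarith
      exact_mod_cast this
    rw [dyFiber_eq_Ico X N hm0]
    set a := max ⌈N / 2⌉₊ ⌈X / 2 / m⌉₊
    set b := min ⌈N⌉₊ ⌈X / m⌉₊
    have ha : n₀ ≤ a := le_max_left _ _
    have hb : b - n₀ ≤ L := Nat.sub_le_sub_right (min_le_left _ _) _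
    have h := norm_sum_Ico_le_completed
      (fun n => e (H * ((m : ℝ) * (n₀ + n : ℕ)) ^ γ)) (a := a - n₀) hb
    have e1 : ∑ n ∈ Ico a b, e (H * ((m : ℝ) * n) ^ γ)
        = ∑ n ∈ Ico (a - n₀) (b - n₀), e (H * ((m : ℝ) * (n₀ + n : ℕ)) ^ γ) := by
      refine sum_bij' (fun n _ => n - n₀) (fun n _ => n₀ + n) ?_ ?_ ?_ ?_ ?_ <;>
        simp only [mem_Ico] <;> intro n hn
      · omega
      · omega
      · omega
      · omega
      · rw [show n₀ + (n - n₀) = n by omega]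
    rw [e1]
    refine h.trans (le_of_eq (sum_congr rfl fun k _ => ?_))
    congr 2
    refine sum_congr rfl fun n _ => ?_
    rw [← e_add]
    congr 2
    ring
  calc _ ≤ _ := sum_le_sum hm
    _ = ∑ k ∈ range L, completionWeight L k * S k := by
        rw [sum_comm]
        exact sum_congr rfl fun k _ => (mul_sum _ _ _).symm
    _ ≤ ∑ k ∈ range L, completionWeight L k * √(8 * M * N * (3 * M * N / Q + T)) :=
        sum_le_sum fun k hk =>
          mul_le_mul_of_nonneg_left (hSk k) (completionWeight_nonneg (mem_range.1 hk))
    _ = (∑ k ∈ range L, completionWeight L k) * √(8 * M * N * (3 * M * N / Q + T)) :=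
        (sum_mul _ _ _).symm
    _ ≤ _ := by
        gcongr
        refine (sum_completionWeight_le c4).trans ?_
        have : (0 : ℝ) < L := by exact_mod_cast c4
        gcongr

lemma mul_mem_Ioo_of_mem_dyFiber {X M N : ℝ} {m n : ℕ} (hN : 0 ≤ N)
    (hm : m ∈ dyN M) (hn : n ∈ dyFiber X N m) :
    X / 2 ≤ m * N ∧ m * N ≤ 2 * X ∧ X / 2 ≤ M * N ∧ M * N ≤ 4 * X := by
  rw [dyFiber, mem_filter, mem_dyN] at hn
  obtain ⟨⟨h1, h2⟩, h3, h4⟩ := hn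
  obtain ⟨h5, h6⟩ := mem_dyN.1 hm
  push_cast at h3 h4
  have hm0 : (0 : ℝ) ≤ m := Nat.cast_nonneg m
  have a1 : (m : ℝ) * n ≤ m * N := by gcongr
  have a2 : (m : ℝ) * (N / 2) ≤ m * n := by gcongr
  have a3 : (m : ℝ) * N ≤ M * N := by gcongr
  have a4 : M / 2 * N ≤ (m : ℝ) * N := by gcongr
  exact ⟨by linarith, by linarith, by linarith, by linarith⟩

lemma sum_norm_dyFiber_le_of_large {γ η : ℝ} (hγ : 8 / 9 < γ) (hγ1 : γ < 1) (hη : 0 < η)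
    (hηγ : 1 - γ + 5 * η ≤ 1 / 9) :
    ∃ C : ℝ, 0 < C ∧ ∀ X H M N : ℝ, 1 ≤ X → 1 ≤ H → H ≤ 12 * X ^ (1 - γ + η) → 1 ≤ M → 4 ≤ N →
      X ^ (5 / 9 : ℝ) ≤ N →
      ∑ m ∈ dyN M, ‖∑ n ∈ dyFiber X N m, e (H * ((m : ℝ) * n) ^ γ)‖ ≤ C * X ^ (γ - 3 * η) := by
  obtain ⟨K, hK, h⟩ := norm_sum_dyFiber_le (γ := γ) (by linarith) hγ1
  refine ⟨2 * K * (96 + 8), by positivity, ?_⟩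
  intro X H M N hX hH hHX hM hN hXN
  have hX0 : 0 < X := by linarith
  have hN0 : 0 < N := by linarith
  have hM0 : 0 < M := by linarith
  have hC : 0 ≤ 2 * K * (96 + 8) * X ^ (γ - 3 * η) := by positivity
  by_cases hne : ∃ m ∈ dyN M, ∃ n, n ∈ dyFiber X N m
  swap
  · refine le_trans (le_of_eq (sum_eq_zero fun m hm => ?_)) hC
    have : dyFiber X N m = ∅ := by
      by_contra h0
      exact hne ⟨m, hm, nonempty_iff_ne_empty.2 h0⟩
    rw [this, sum_empty, norm_zero]
  have hMN : M * N ≤ 4 * X := by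
    obtain ⟨m, hm, n, hn⟩ := hne
    exact (mul_mem_Ioo_of_mem_dyFiber hN0.le hm hn).2.2.2
  set B : ℝ := K * (24 * X ^ ((1 + η) / 6) * √N + N * (2 * X ^ (-(γ / 6)))) with hB
  have hB0 : 0 ≤ B := by positivity
  have hterm : ∀ m ∈ dyN M, ‖∑ n ∈ dyFiber X N m, e (H * ((m : ℝ) * n) ^ γ)‖ ≤ B := by
    intro m hm
    rcases (dyFiber X N m).eq_empty_or_nonempty with h0 | ⟨n, hn⟩
    · rw [h0, sum_empty, norm_zero]; exact hB0
    obtain ⟨c1, c2, -, -⟩ := mul_mem_Ioo_of_mem_dyFiber hN0.le hm hn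
    have hm0 : 0 < m := by
      have := (mem_dyN.1 hm).1
      have : (0 : ℝ) < m := by linarith
      exact_mod_cast this
    have hm' : (0 : ℝ) < m := by exact_mod_cast hm0
    refine (h X N H m hN (by linarith) hm0).trans ?_
    set F := H * (m * N) ^ γ with hF
    have hF1 : F ≤ 24 * X ^ (1 + η) := by
      calc F ≤ 12 * X ^ (1 - γ + η) * (2 * X) ^ γ := by rw [hF]; gcongr
        _ = 12 * (2 : ℝ) ^ γ * X ^ (1 + η) := by
            rw [Real.mul_rpow (by norm_num) hX0.le, show 1 + η = (1 - γ + η) + γ by ring,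
              Real.rpow_add hX0 (1 - γ + η)]
            ring
        _ ≤ 12 * (2 : ℝ) ^ (1 : ℝ) * X ^ (1 + η) := by
            gcongr; norm_num
        _ = _ := by rw [Real.rpow_one]; ring
    have hF2 : X ^ γ / 2 ≤ F := by
      calc X ^ γ / 2 = (1 / 2 : ℝ) ^ (1 : ℝ) * X ^ γ := by rw [Real.rpow_one]; ring
        _ ≤ (1 / 2 : ℝ) ^ γ * X ^ γ := by
            gcongr ?_ * _
            exact Real.rpow_le_rpow_of_exponent_ge (by norm_num) (by norm_num) hγ1.le
        _ = (1 / 2 * X) ^ γ := (Real.mul_rpow (by norm_num) hX0.le).symm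
        _ ≤ (m * N) ^ γ := Real.rpow_le_rpow (by positivity) (by linarith) (by linarith)
        _ ≤ F := by rw [hF]; exact le_mul_of_one_le_left (by positivity) hH
    have hXγ : 0 < X ^ γ := Real.rpow_pos_of_pos hX0 _
    have hF0 : 0 < F := lt_of_lt_of_le (by positivity) hF2
    have hf1 : F ^ (1 / 6 : ℝ) ≤ 24 * X ^ ((1 + η) / 6) := by
      calc F ^ (1 / 6 : ℝ) ≤ (24 * X ^ (1 + η)) ^ (1 / 6 : ℝ) := by gcongr
        _ = (24 : ℝ) ^ (1 / 6 : ℝ) * X ^ ((1 + η) / 6) := by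
            rw [Real.mul_rpow (by norm_num) (by positivity), ← Real.rpow_mul hX0.le]
            ring_nf
        _ ≤ 24 ^ (1 : ℝ) * X ^ ((1 + η) / 6) := by
            gcongr <;> norm_num
        _ = _ := by rw [Real.rpow_one]
    have hf2 : 1 / F ^ (1 / 6 : ℝ) ≤ 2 * X ^ (-(γ / 6)) := by
      calc 1 / F ^ (1 / 6 : ℝ) = F ^ (-(1 / 6) : ℝ) := by rw [Real.rpow_neg hF0.le, one_div]
        _ ≤ (1 / 2 * X ^ γ) ^ (-(1 / 6) : ℝ) :=
            Real.rpow_le_rpow_of_nonpos (by positivity) (by linarith) (by norm_num)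
        _ = (1 / 2 : ℝ) ^ (-(1 / 6) : ℝ) * X ^ (-(γ / 6)) := by
            rw [Real.mul_rpow (by norm_num) hXγ.le, ← Real.rpow_mul hX0.le]
            ring_nf
        _ ≤ (1 / 2 : ℝ) ^ (-1 : ℝ) * X ^ (-(γ / 6)) := by
            gcongr ?_ * _
            exact Real.rpow_le_rpow_of_exponent_ge (by norm_num) (by norm_num) (by norm_num)
        _ = _ := by rw [Real.rpow_neg_one]; norm_num
    rw [hB, div_eq_mul_one_div N]
    gcongr
  have hsqrt : M * √N ≤ 4 * X ^ (13 / 18 : ℝ) := by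
    have h1 : X ^ (5 / 18 : ℝ) ≤ √N := by
      refine Real.le_sqrt_of_sq_le (le_trans (le_of_eq ?_) hXN)
      rw [← Real.rpow_natCast, ← Real.rpow_mul hX0.le]
      norm_num
    have h2 : √N * √N = N := Real.mul_self_sqrt hN0.le
    have h3 : X ^ (13 / 18 : ℝ) * X ^ (5 / 18 : ℝ) = X := by
      rw [← Real.rpow_add hX0]; norm_num
    have h4 : 0 < X ^ (5 / 18 : ℝ) := Real.rpow_pos_of_pos hX0 _
    refine le_of_mul_le_mul_right ?_ h4
    calc M * √N * X ^ (5 / 18 : ℝ) ≤ M * √N * √N := by gcongr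
      _ = M * N := by rw [mul_assoc, h2]
      _ ≤ 4 * X := hMN
      _ = _ := by rw [mul_assoc, h3]
  calc ∑ m ∈ dyN M, ‖∑ n ∈ dyFiber X N m, e (H * ((m : ℝ) * n) ^ γ)‖
      ≤ ∑ m ∈ dyN M, B := sum_le_sum hterm
    _ = #(dyN M) * B := by rw [sum_const, nsmul_eq_mul]
    _ ≤ 2 * M * B := by gcongr; exact card_dyN_le hM
    _ = 2 * K * (24 * X ^ ((1 + η) / 6) * (M * √N) + M * N * (2 * X ^ (-(γ / 6)))) := by
        rw [hB]; ring
    _ ≤ 2 * K * (24 * X ^ ((1 + η) / 6) * (4 * X ^ (13 / 18 : ℝ))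
          + 4 * X * (2 * X ^ (-(γ / 6)))) := by gcongr
    _ = 2 * K * (96 * X ^ ((1 + η) / 6 + 13 / 18) + 8 * X ^ (1 + -(γ / 6))) := by
        rw [Real.rpow_add hX0, Real.rpow_add hX0 1, Real.rpow_one]; ring
    _ ≤ 2 * K * (96 * X ^ (γ - 3 * η) + 8 * X ^ (γ - 3 * η)) := by
        gcongr <;> linarith
    _ = _ := by ring

lemma sum_norm_dyFiber_le_of_small {γ η : ℝ} (hγ : 8 / 9 < γ) (hγ1 : γ < 1) (hη : 0 < η)
    (hηγ : 1 - γ + 5 * η ≤ 1 / 9) :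
    ∃ C : ℝ, 0 < C ∧ ∀ X H M N : ℝ, 8 ^ 11 ≤ X → 1 ≤ H → H ≤ 12 * X ^ (1 - γ + η) → 1 ≤ M →
      0 < N → N ≤ X ^ (5 / 9 : ℝ) → M ≤ X ^ (15 / 22 : ℝ) →
      ∑ m ∈ dyN M, ‖∑ n ∈ dyFiber X N m, e (H * ((m : ℝ) * n) ^ γ)‖ ≤ C * X ^ (γ - 3 * η) := by
  obtain ⟨K, hK, h⟩ := exists_bump_double_sum_bound hγ hγ1
  refine ⟨(5 + 4 / η) * √(32 * (12 + 400 * K)), by positivity, ?_⟩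
  intro X H M N hX8 hH hHX hM hN0 hNX hMX
  have hX : 1 ≤ X := le_trans (by norm_num) hX8
  have hX0 : 0 < X := by linarith
  have hM0 : 0 < M := by linarith
  have hC : 0 ≤ (5 + 4 / η) * √(32 * (12 + 400 * K)) * X ^ (γ - 3 * η) := by positivity
  by_cases hne : ∃ m ∈ dyN M, ∃ n, n ∈ dyFiber X N m
  swap
  · refine le_trans (le_of_eq (sum_eq_zero fun m hm => ?_)) hC
    have : dyFiber X N m = ∅ := by
      by_contra h0
      exact hne ⟨m, hm, nonempty_iff_ne_empty.2 h0⟩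
    rw [this, sum_empty, norm_zero]
  obtain ⟨hMN1, hMN2⟩ : X / 2 ≤ M * N ∧ M * N ≤ 4 * X := by
    obtain ⟨m, hm, n, hn⟩ := hne
    exact (mul_mem_Ioo_of_mem_dyFiber hN0.le hm hn).2.2
  have hexp : ∀ {a b : ℝ}, a ≤ b → X ^ a ≤ X ^ b := fun hab =>
    Real.rpow_le_rpow_of_exponent_le hX hab
  have hXpos : ∀ a : ℝ, 0 < X ^ a := fun a => Real.rpow_pos_of_pos hX0 a
  set σ : ℝ := 1 - γ + 4 * η with hσ
  have hN1 : X ^ (7 / 22 : ℝ) / 2 ≤ N := by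
    have e1 : X ^ (15 / 22 : ℝ) * X ^ (7 / 22 : ℝ) = X := by
      rw [← Real.rpow_add hX0]; norm_num
    refine le_of_mul_le_mul_left ?_ (hXpos (15 / 22))
    calc X ^ (15 / 22 : ℝ) * (X ^ (7 / 22 : ℝ) / 2) = X / 2 := by rw [mul_div_assoc', e1]
      _ ≤ M * N := hMN1
      _ ≤ _ := by gcongr
  have h8 : 8 * X ^ (2 * σ) ≤ X ^ (7 / 22 : ℝ) := by
    have e1 : (8 : ℝ) ≤ X ^ (1 / 11 : ℝ) := by
      calc (8 : ℝ) = (8 ^ 11) ^ (1 / 11 : ℝ) := by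
            rw [← Real.rpow_natCast, ← Real.rpow_mul (by norm_num)]; norm_num
        _ ≤ _ := by gcongr
    calc 8 * X ^ (2 * σ) ≤ X ^ (1 / 11 : ℝ) * X ^ (2 * σ) := by gcongr
      _ = X ^ (1 / 11 + 2 * σ) := (Real.rpow_add hX0 _ _).symm
      _ ≤ _ := hexp (by rw [hσ]; linarith)
  have hXσ : 1 ≤ X ^ (2 * σ) := Real.one_le_rpow hX (by rw [hσ]; linarith)
  have hN : 4 ≤ N := by linarith
  set Q : ℕ := ⌈X ^ (2 * σ)⌉₊ with hQ
  have hQ1 : X ^ (2 * σ) ≤ Q := Nat.le_ceil _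
  have hQ2 : (Q : ℝ) ≤ 2 * X ^ (2 * σ) := by
    have := (Nat.ceil_lt_add_one (hXpos (2 * σ)).le).le
    linarith
  have hQN : (Q : ℝ) ≤ N / 2 := by linarith
  have hQ0 : 0 < Q := Nat.ceil_pos.2 (hXpos _)
  obtain ⟨c1, c2, c3, -⟩ := ceil_dyadic_bounds hN
  set T : ℝ := K * (400 * X ^ (1 - 2 * σ)) with hT
  have hT0 : 0 ≤ T := by positivity
  have key : ∀ d : ℕ, 0 < d → d < Q →
      ‖∑ n ∈ range (⌈N⌉₊ - ⌈N / 2⌉₊ - d), ∑ m ∈ range ⌈2 * M⌉₊,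
      (dyBump (m / M) : ℂ) * e (H * (m : ℝ) ^ γ * powInc γ d (⌈N / 2⌉₊ + n))‖ ≤ T := by
    intro d hd hdQ
    have hd1 : (1 : ℝ) ≤ d := by exact_mod_cast hd
    have hdQ' : (d : ℝ) ≤ Q := by exact_mod_cast hdQ.le
    have hd0 : (0 : ℝ) < d := by linarith
    set L : ℕ := ⌈N⌉₊ - ⌈N / 2⌉₊ - d with hL
    have hLle : (L : ℝ) ≤ (⌈N⌉₊ - ⌈N / 2⌉₊ : ℕ) := by exact_mod_cast Nat.sub_le _ _
    have hLN : (L : ℝ) ≤ N := hLle.trans c3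
    set F : ℝ := H * M ^ γ * (d * N ^ (γ - 1)) with hF
    have hF' : F = H * d * ((M * N) ^ γ / N) := by
      rw [hF, Real.mul_rpow hM0.le hN0.le, Real.rpow_sub hN0, Real.rpow_one]
      ring
    have hF0 : 0 < F := by positivity
    set f : ℝ := F ^ (1 / 6 : ℝ) with hf
    have hf0 : 0 < f := Real.rpow_pos_of_pos hF0 _
    have hf6 : f ^ 6 = F := by
      rw [hf, ← Real.rpow_natCast, ← Real.rpow_mul hF0.le]; norm_num
    have hsN : √N ^ 2 = N := Real.sq_sqrt hN0.le
    have hs0 : 0 < √N := Real.sqrt_pos.2 hN0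
    have hsF : √F = f ^ 3 := by
      rw [← hf6, show f ^ 6 = (f ^ 3) ^ 2 by ring]
      exact Real.sqrt_sq (by positivity)
    have hb := h H M N d ⌈N / 2⌉₊ (f / √N) L (by linarith) hM0 hN0 hd0 (by linarith) c1
      (by linarith) (by positivity) (by
        rw [div_pow, hf6, show √N ^ 6 = (√N ^ 2) ^ 3 by ring, hsN, hF]
        field_simp)
    refine hb.trans ?_
    rw [hT]
    refine mul_le_mul_of_nonneg_left ?_ hK.le
    change L * M / F ^ 2 + L / M + √F * (L * (f / √N) + √(L : ℝ) / (f / √N)) + L ≤ _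
    have hFlow : X ^ γ / (2 * N) ≤ F := by
      rw [hF']
      calc X ^ γ / (2 * N) = (1 / 2 : ℝ) ^ (1 : ℝ) * X ^ γ / N := by rw [Real.rpow_one]; ring
        _ ≤ (1 / 2 : ℝ) ^ γ * X ^ γ / N := by
            gcongr ?_ * _ / _
            exact Real.rpow_le_rpow_of_exponent_ge (by norm_num) (by norm_num) hγ1.le
        _ = (1 / 2 * X) ^ γ / N := by rw [← Real.mul_rpow (by norm_num) hX0.le]
        _ ≤ (M * N) ^ γ / N := by
            gcongr ?_ / _
            exact Real.rpow_le_rpow (by positivity) (by linarith) (by linarith)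
        _ ≤ _ := le_mul_of_one_le_left (by positivity) (one_le_mul_of_one_le_of_one_le hH hd1)
    have hFup : F ≤ 96 * X ^ (1 + η + 2 * σ) / N := by
      rw [hF']
      calc H * d * ((M * N) ^ γ / N)
          ≤ 12 * X ^ (1 - γ + η) * (2 * X ^ (2 * σ)) * ((4 * X) ^ γ / N) := by
            gcongr
            linarith
        _ = 24 * (4 : ℝ) ^ γ * X ^ (1 + η + 2 * σ) / N := by
            rw [Real.mul_rpow (by norm_num) hX0.le,
              show 1 + η + 2 * σ = (1 - γ + η) + 2 * σ + γ by ring,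
              Real.rpow_add hX0 (1 - γ + η + 2 * σ), Real.rpow_add hX0 (1 - γ + η)]
            ring
        _ ≤ 24 * (4 : ℝ) ^ (1 : ℝ) * X ^ (1 + η + 2 * σ) / N := by
            gcongr; norm_num
        _ = _ := by rw [Real.rpow_one]; ring
    have hf2 : ∀ j : ℕ, j ≤ 6 →
        f ^ j ≤ 96 * X ^ ((1 + η + 2 * σ) * (j / 6)) * N ^ (-(j / 6) : ℝ) := by
      intro j hj
      have hj' : ((j : ℝ) / 6) ≤ 1 := by
        rw [div_le_one (by norm_num)]; exact_mod_cast hj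
      calc f ^ j = F ^ ((j : ℝ) / 6) := by
            rw [hf, ← Real.rpow_natCast, ← Real.rpow_mul hF0.le]; ring_nf
        _ ≤ (96 * X ^ (1 + η + 2 * σ) / N) ^ ((j : ℝ) / 6) := by gcongr
        _ = (96 : ℝ) ^ ((j : ℝ) / 6) * X ^ ((1 + η + 2 * σ) * (j / 6)) * N ^ (-(j / 6) : ℝ) := by
            rw [Real.div_rpow (by positivity) hN0.le, Real.mul_rpow (by norm_num) (hXpos _).le,
              ← Real.rpow_mul hX0.le, Real.rpow_neg hN0.le, div_eq_mul_inv]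
        _ ≤ (96 : ℝ) ^ (1 : ℝ) * X ^ ((1 + η + 2 * σ) * (j / 6)) * N ^ (-(j / 6) : ℝ) := by
            gcongr ?_ * _ * _
            exact Real.rpow_le_rpow_of_exponent_le (by norm_num) hj'
        _ = _ := by rw [Real.rpow_one]
    have t1 : L * M / F ^ 2 ≤ 16 * X ^ (1 - 2 * σ) := by
      calc L * M / F ^ 2 ≤ N * M / (X ^ γ / (2 * N)) ^ 2 := by gcongr
        _ = M * N * (4 * N ^ 2) / (X ^ γ) ^ 2 := by field_simp; ring
        _ ≤ 4 * X * (4 * (X ^ (5 / 9 : ℝ)) ^ 2) / (X ^ γ) ^ 2 := by gcongr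
        _ = 16 * X ^ (1 + 10 / 9 - 2 * γ) := by
            have e1 : (X ^ γ) ^ 2 = X ^ (2 * γ) := by
              rw [← Real.rpow_natCast, ← Real.rpow_mul hX0.le]
              push_cast
              ring_nf
            have e2 : (X ^ (5 / 9 : ℝ)) ^ 2 = X ^ (10 / 9 : ℝ) := by
              rw [← Real.rpow_natCast, ← Real.rpow_mul hX0.le]; norm_num
            rw [e1, e2, Real.rpow_sub hX0, Real.rpow_add hX0, Real.rpow_one]
            ring
        _ ≤ _ := by
            gcongr 16 * ?_
            exact hexp (by rw [hσ]; linarith)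
    have hNσ : N ≤ X ^ (1 - 2 * σ) := hNX.trans (hexp (by rw [hσ]; linarith))
    have t2 : L / M ≤ X ^ (1 - 2 * σ) := (div_le_self (Nat.cast_nonneg _) hM).trans (hLN.trans hNσ)
    have t3 : f ^ 4 * √N ≤ 192 * X ^ (1 - 2 * σ) := by
      have e0 : √N = N ^ (1 / 2 : ℝ) := Real.sqrt_eq_rpow N
      calc f ^ 4 * √N
          ≤ 96 * X ^ ((1 + η + 2 * σ) * ((4 : ℕ) / 6)) * N ^ (-((4 : ℕ) / 6) : ℝ) * √N := by
            gcongr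
            exact hf2 4 (by norm_num)
        _ = 96 * X ^ ((1 + η + 2 * σ) * (2 / 3)) * N ^ (-(1 / 6) : ℝ) := by
            rw [e0, mul_assoc, ← Real.rpow_add hN0]
            norm_num
        _ ≤ 96 * X ^ ((1 + η + 2 * σ) * (2 / 3)) * (1 / 2 * X ^ (7 / 22 : ℝ)) ^ (-(1 / 6) : ℝ) := by
            gcongr 96 * _ * ?_
            exact Real.rpow_le_rpow_of_nonpos (by positivity) (by linarith) (by norm_num)
        _ = 96 * (1 / 2 : ℝ) ^ (-(1 / 6) : ℝ) * X ^ ((1 + η + 2 * σ) * (2 / 3) + -(7 / 132)) := by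
            rw [Real.mul_rpow (by norm_num) (hXpos _).le, ← Real.rpow_mul hX0.le,
              Real.rpow_add hX0]
            norm_num
            ring
        _ ≤ 96 * (1 / 2 : ℝ) ^ (-1 : ℝ) * X ^ (1 - 2 * σ) := by
            gcongr 96 * ?_ * ?_
            · exact Real.rpow_le_rpow_of_exponent_ge (by norm_num) (by norm_num) (by norm_num)
            · exact hexp (by rw [hσ]; linarith)
        _ = _ := by rw [Real.rpow_neg_one]; norm_num
    have t4 : f ^ 2 * N ≤ 96 * X ^ (1 - 2 * σ) := by
      calc f ^ 2 * N
          ≤ 96 * X ^ ((1 + η + 2 * σ) * ((2 : ℕ) / 6)) * N ^ (-((2 : ℕ) / 6) : ℝ) * N := by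
            gcongr
            exact hf2 2 (by norm_num)
        _ = 96 * X ^ ((1 + η + 2 * σ) * (1 / 3)) * N ^ (2 / 3 : ℝ) := by
            have : N ^ (2 / 3 : ℝ) = N ^ (-((2 : ℕ) / 6) : ℝ) * N := by
              rw [← Real.rpow_add_one hN0.ne']; norm_num
            rw [this]
            norm_num
            ring
        _ ≤ 96 * X ^ ((1 + η + 2 * σ) * (1 / 3)) * (X ^ (5 / 9 : ℝ)) ^ (2 / 3 : ℝ) := by gcongr
        _ = 96 * X ^ ((1 + η + 2 * σ) * (1 / 3) + 10 / 27) := by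
            rw [← Real.rpow_mul hX0.le, mul_assoc, ← Real.rpow_add hX0]
            norm_num
        _ ≤ _ := by
            gcongr 96 * ?_
            exact hexp (by rw [hσ]; linarith)
    have t5 : √F * (L * (f / √N) + √(L : ℝ) / (f / √N)) ≤ f ^ 4 * √N + f ^ 2 * N := by
      calc _ ≤ f ^ 3 * (√N ^ 2 * (f / √N) + √N / (f / √N)) := by
            rw [hsF]
            gcongr
            rw [hsN]; exact hLN
        _ = f ^ 4 * √N + f ^ 2 * √N ^ 2 := by field_simp
        _ = _ := by rw [hsN]
    have hXp := hXpos (1 - 2 * σ)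
    linarith [hLN.trans hNσ]
  refine (sum_norm_dyFiber_le (X := X) hM hN hQ0 (by linarith) hT0 key).trans ?_
  have hlog : 5 + 4 * Real.log N ≤ (5 + 4 / η) * X ^ η := by
    have e1 : Real.log N ≤ X ^ η / η := by
      have : N ≤ X := hNX.trans (by
        conv_rhs => rw [← Real.rpow_one X]
        exact hexp (by norm_num))
      exact (Real.log_le_log hN0 this).trans (Real.log_le_rpow_div hX0.le hη)
    have e2 : 1 ≤ X ^ η := Real.one_le_rpow hX hη.le
    calc 5 + 4 * Real.log N ≤ 5 * X ^ η + 4 * (X ^ η / η) := by linarith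
      _ = _ := by ring
  have hlog0 : 0 ≤ (5 + 4 / η) * X ^ η := by positivity
  have hroot : √(8 * M * N * (3 * M * N / Q + T)) ≤ √(32 * (12 + 400 * K)) * X ^ (1 - σ) := by
    have e1 : X * X ^ (1 - 2 * σ) = (X ^ (1 - σ)) ^ 2 := by
      rw [← Real.rpow_one_add' hX0.le (by rw [hσ]; linarith), ← Real.rpow_natCast,
        ← Real.rpow_mul hX0.le]
      push_cast
      ring_nf
    have e2 : 3 * M * N / Q ≤ 12 * X ^ (1 - 2 * σ) := by
      calc 3 * M * N / Q = 3 * (M * N) / Q := by ring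
        _ ≤ 3 * (4 * X) / X ^ (2 * σ) := by gcongr
        _ = _ := by rw [Real.rpow_sub hX0, Real.rpow_one]; ring
    have e3 : 8 * M * N * (3 * M * N / Q + T)
        ≤ 32 * (12 + 400 * K) * (X ^ (1 - σ)) ^ 2 := by
      calc _ = 8 * (M * N) * (3 * M * N / Q + T) := by ring
        _ ≤ 8 * (4 * X) * (12 * X ^ (1 - 2 * σ) + T) := by gcongr
        _ = _ := by rw [hT, ← e1]; ring
    calc _ ≤ √(32 * (12 + 400 * K) * (X ^ (1 - σ)) ^ 2) := Real.sqrt_le_sqrt e3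
      _ = _ := by
        rw [Real.sqrt_mul (by positivity), Real.sqrt_sq (hXpos _).le]
  calc _ ≤ (5 + 4 / η) * X ^ η * (√(32 * (12 + 400 * K)) * X ^ (1 - σ)) := by gcongr
    _ = (5 + 4 / η) * √(32 * (12 + 400 * K)) * (X ^ η * X ^ (1 - σ)) := by ring
    _ = _ := by
      rw [← Real.rpow_add hX0, hσ]
      ring_nf

lemma exists_sum_norm_dyFiber_bound {γ η : ℝ} (hγ : 8 / 9 < γ) (hγ1 : γ < 1) (hη : 0 < η)
    (hηγ : 1 - γ + 5 * η ≤ 1 / 9) :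
    ∃ C : ℝ, 0 < C ∧ ∀ X H M N : ℝ, 8 ^ 11 ≤ X → 1 ≤ H → H ≤ 12 * X ^ (1 - γ + η) → 1 ≤ M →
      1 ≤ N → M ≤ X ^ (15 / 22 : ℝ) →
      ∑ m ∈ dyN M, ‖∑ n ∈ dyFiber X N m, e (H * ((m : ℝ) * n) ^ γ)‖ ≤ C * X ^ (γ - 3 * η) := by
  obtain ⟨C₁, h1, b1⟩ := sum_norm_dyFiber_le_of_large hγ hγ1 hη hηγ
  obtain ⟨C₂, h2, b2⟩ := sum_norm_dyFiber_le_of_small hγ hγ1 hη hηγ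
  refine ⟨C₁ + C₂, by positivity, ?_⟩
  intro X H M N hX8 hH hHX hM hN hMX
  have hX : 1 ≤ X := le_trans (by norm_num) hX8
  have hp : 0 < X ^ (γ - 3 * η) := Real.rpow_pos_of_pos (by linarith) _
  rcases le_total (X ^ (5 / 9 : ℝ)) N with hN' | hN'
  · have h4 : (4 : ℝ) ≤ X ^ (5 / 9 : ℝ) := by
      calc (4 : ℝ) ≤ (8 ^ 11) ^ (1 / 11 : ℝ) := by
            rw [← Real.rpow_natCast, ← Real.rpow_mul (by norm_num)]; norm_num
        _ ≤ X ^ (1 / 11 : ℝ) := by gcongr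
        _ ≤ _ := Real.rpow_le_rpow_of_exponent_le hX (by norm_num)
    have := b1 X H M N hX hH hHX hM (h4.trans hN') hN'
    nlinarith
  · have := b2 X H M N hX8 hH hHX hM (by linarith) hN' hMX
    nlinarith

theorem S2_final (c γ : ℝ) (hc1 : 1 < c) (hc2 : c < 9/8) (hγ : γ = 1/c) :
    ∃ η > (0:ℝ), ∃ C > (0:ℝ), ∃ X₀ > (0:ℝ), ∀ X : ℕ, X₀ ≤ (X:ℝ) →
    ∀ M N V : ℝ, 1 ≤ M → 1 ≤ N → 1 ≤ V →
    M ≤ (X:ℝ)^((15:ℝ)/22) → V ≤ (⌊10 * (X:ℝ)^(1-γ+η) / γ⌋₊ : ℝ) →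
    ∀ am : ℕ → ℂ, ∀ dh : ℤ → ℂ,
    (∀ m ∈ dyN M, ‖am m‖ ≤ 1) → (∀ h ∈ dyZ V, ‖dh h‖ ≤ 1) →
    ‖∑ m ∈ dyN M, ∑ n ∈ (dyN N).filter (fun n => (X:ℝ)/2 ≤ ((m*n:ℕ):ℝ) ∧ ((m*n:ℕ):ℝ) < (X:ℝ)),
        ∑ h ∈ dyZ V, am m * dh h * e ((h:ℝ) * ((m:ℝ)*(n:ℝ))^γ)‖ ≤ C * (X:ℝ)^(1-2*η) := by
  have hγ0 : 8 / 9 < γ := by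
    rw [hγ, lt_div_iff₀ (by linarith)]; linarith
  have hγ1 : γ < 1 := by
    rw [hγ, div_lt_one (by linarith)]; exact hc1
  set η : ℝ := (γ - 8 / 9) / 5 with hη
  have hη0 : 0 < η := by rw [hη]; linarith
  obtain ⟨C, hC, hb⟩ := exists_sum_norm_dyFiber_bound hγ0 hγ1 hη0 (by rw [hη]; linarith)
  refine ⟨η, hη0, 60 * C, by positivity, 8 ^ 11, by positivity, ?_⟩
  intro X hX M N V hM hN hV hMX hVX am dh ham hdh
  have hX0 : (0 : ℝ) < X := lt_of_lt_of_le (by norm_num) hX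
  have hV12 : V ≤ 12 * (X : ℝ) ^ (1 - γ + η) := by
    have hp : 0 < (X : ℝ) ^ (1 - γ + η) := Real.rpow_pos_of_pos hX0 _
    refine (hVX.trans (Nat.floor_le (by positivity))).trans ?_
    rw [div_le_iff₀ (by linarith)]
    nlinarith
  have hh : ∀ h ∈ dyZ V,
      ‖∑ m ∈ dyN M, ∑ n ∈ dyFiber X N m, am m * dh h * e ((h : ℝ) * ((m : ℝ) * n) ^ γ)‖
        ≤ C * (X : ℝ) ^ (γ - 3 * η) := by
    intro h hhV
    obtain ⟨h1, h2⟩ := mem_dyZ hhV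
    refine le_trans (norm_sum_le_of_le _ fun m hm => ?_)
      (hb X |(h : ℝ)| M N hX h1 (h2.le.trans hV12) hM hN hMX)
    rw [← mul_sum, norm_mul, norm_mul]
    have e1 : ‖∑ n ∈ dyFiber X N m, e ((h : ℝ) * ((m : ℝ) * n) ^ γ)‖
        = ‖∑ n ∈ dyFiber X N m, e (|(h : ℝ)| * ((m : ℝ) * n) ^ γ)‖ := by
      rcases abs_choice (h : ℝ) with h3 | h3
      · rw [h3]
      · rw [h3, ← norm_sum_e_neg]
        simp_rw [neg_mul]
    rw [e1]
    exact mul_le_of_le_one_left (norm_nonneg _)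
      (mul_le_one₀ (ham m hm) (norm_nonneg _) (hdh h hhV))
  calc _ = ‖∑ h ∈ dyZ V, ∑ m ∈ dyN M, ∑ n ∈ dyFiber X N m,
          am m * dh h * e ((h : ℝ) * ((m : ℝ) * n) ^ γ)‖ := by
        rw [sum_comm]
        congr 1
        exact sum_congr rfl fun m _ => sum_comm
    _ ≤ ∑ h ∈ dyZ V, C * (X : ℝ) ^ (γ - 3 * η) := norm_sum_le_of_le _ hh
    _ = #(dyZ V) * (C * (X : ℝ) ^ (γ - 3 * η)) := by rw [sum_const, nsmul_eq_mul]
    _ ≤ 5 * (12 * (X : ℝ) ^ (1 - γ + η)) * (C * (X : ℝ) ^ (γ - 3 * η)) := by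
        gcongr
        exact (card_dyZ_le hV).trans (by gcongr)
    _ = 60 * C * ((X : ℝ) ^ (1 - γ + η) * (X : ℝ) ^ (γ - 3 * η)) := by ring
    _ = _ := by
        rw [← Real.rpow_add hX0]
        ring_nf
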